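/- arXiv:1307.3693 — 2 statements merged into one kernel-verified Lean document; each statement's English description precedes it below -/
import Mathlib

section
/- For all γ > 0 there exists an integer n₀ such that the following holds. Suppose H is a 3-graph on n > n₀ vertices with n even and δ₁(H) > (7/16 + γ)·C(n,2). Then H contains a loose Hamilton cycle. -/
/-- The degree of a vertex in a 3-graph: the number of edges containing it. -/
def hdeg {α : Type*} [DecidableEq α] (H : Finset (Finset α)) (v : α) : ℕ :=
  (H.filter (fun e => v ∈ e)).card

/-- A 3-graph on vertex set `Fin n` contains a loose Hamilton cycle. -/
def HasLooseHamCycle (n : ℕ) (H : Finset (Finset (Fin n))) : Prop :=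
  ∃ f : ZMod n → Fin n, Function.Bijective f ∧
    ∀ i : ℕ, i < n / 2 →
      ({f ((2 * i : ℕ) : ZMod n), f ((2 * i + 1 : ℕ) : ZMod n),
        f ((2 * i + 2 : ℕ) : ZMod n)} : Finset (Fin n)) ∈ H

/-- `LoosePath E a b S`: there is a loose path from `a` to `b`, all of whose edges satisfy `E`,
with vertex set `S`. -/
inductive LoosePath {V : Type*} [DecidableEq V] (E : V → V → V → Prop) :
    V → V → Finset V → Prop
  | single (a : V) : LoosePath E a a {a}
  | snoc {a b : V} {S : Finset V} (x c : V) : LoosePath E a b S → E b x c → x ∉ S → c ∉ S →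
      x ≠ c → LoosePath E a c (insert x (insert c S))

namespace LoosePath

variable {V : Type*} [DecidableEq V] {E : V → V → V → Prop}

theorem snoc' {a b : V} {S T : Finset V} {x c : V} (h : LoosePath E a b S) (hE : E b x c)
    (hx : x ∉ S) (hc : c ∉ S) (hxc : x ≠ c) (hT : insert x (insert c S) = T) :
    LoosePath E a c T := hT ▸ h.snoc x c hE hx hc hxc

theorem append {a b c d u z v : V} {S T : Finset V} (hS : LoosePath E a b S)
    (hT : LoosePath E c d T) (h1 : E b u z) (h2 : E z v c) (hST : Disjoint S T)
    (hu : u ∉ S ∪ T) (hz : z ∉ S ∪ T) (hv : v ∉ S ∪ T) (huz : u ≠ z) (huv : u ≠ v)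
    (hzv : z ≠ v) : LoosePath E a d (S ∪ T ∪ {u, z, v}) := by
  induction hT with
  | single =>
    simp only [Finset.mem_union, Finset.mem_singleton, not_or, Finset.disjoint_singleton_right]
      at hu hz hv hST
    refine snoc' (x := v) (snoc' hS h1 hu.1 hz.1 huz rfl) h2 ?_ ?_ hv.2 ?_
    · simp [hv.1, huv.symm, hzv.symm]
    · simp [hST, Ne.symm hu.2, Ne.symm hz.2]
    · ext t; simp; tauto
  | @snoc b' T' x y hT' hE hx hy hxy ih =>
    simp only [Finset.mem_union, Finset.mem_insert, not_or, Finset.disjoint_insert_right]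
      at hu hz hv hST
    refine snoc' (x := x) (ih hST.2.2 ?_ ?_ ?_) hE ?_ ?_ hxy ?_
    · simp [hu]
    · simp [hz]
    · simp [hv]
    · simp [hST, hx, Ne.symm hu.2.1, Ne.symm hz.2.1, Ne.symm hv.2.1]
    · simp [hST, hy, Ne.symm hu.2.2.1, Ne.symm hz.2.2.1, Ne.symm hv.2.2.1]
    · rw [Finset.union_insert x S, Finset.union_insert y S, Finset.insert_union, Finset.insert_union]

theorem exists_seq {a b : V} {S : Finset V} (h : LoosePath E a b S) :
    ∃ (m : ℕ) (f : ℕ → V), S.card = 2 * m + 1 ∧ f 0 = a ∧ f (2 * m) = b ∧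
      Set.InjOn f (Set.Iic (2 * m)) ∧ (∀ i ≤ 2 * m, f i ∈ S) ∧
      ∀ i < m, E (f (2 * i)) (f (2 * i + 1)) (f (2 * i + 2)) := by
  induction h with
  | single => exact ⟨0, fun _ => a, by simp, rfl, rfl, by simp [Set.InjOn], by simp, by simp⟩
  | @snoc b' S' x c h hE hx hc hxc ih =>
    obtain ⟨m, f, hcard, h0, hm, hinj, hmem, hedge⟩ := ih
    refine ⟨m + 1, fun i => if i ≤ 2 * m then f i else if i = 2 * m + 1 then x else c,
      ?_, by simpa using h0, by simp; omega, ?_, ?_, ?_⟩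
    · rw [Finset.card_insert_of_notMem (by simp [hx, hxc]), Finset.card_insert_of_notMem hc, hcard]
      ring
    · intro i hi j hj hij
      simp only [Set.mem_Iic] at hi hj
      dsimp only at hij
      have key : ∀ k ≤ 2 * m, f k ≠ x ∧ f k ≠ c := fun k hk =>
        ⟨fun h => hx (h ▸ hmem k hk), fun h => hc (h ▸ hmem k hk)⟩
      split_ifs at hij with h1 h2 h3 h4 h5 h6 h7 h8
      · exact hinj h1 h2 hij
      · exact absurd hij (key i h1).1
      · exact absurd hij (key i h1).2
      · exact absurd hij.symm (key j (by assumption)).1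
      · omega
      · exact absurd hij hxc
      · exact absurd hij.symm (key j (by assumption)).2
      · exact absurd hij.symm hxc
      · omega
    · intro i hi
      dsimp only
      split_ifs with h1 h2
      · simp [hmem i h1]
      · simp
      · simp
    · intro i hi
      dsimp only
      rcases Nat.lt_succ_iff_lt_or_eq.1 hi with h' | rfl
      · rw [if_pos (by omega), if_pos (by omega), if_pos (by omega)]
        exact hedge i h'
      · rw [if_pos (by omega), if_neg (by omega), if_pos (by omega), if_neg (by omega),
          if_neg (by omega), hm]
        exact hE

theorem card_odd {a b : V} {S : Finset V} (h : LoosePath E a b S) : Odd S.card := by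
  obtain ⟨m, f, hm, -⟩ := h.exists_seq
  exact ⟨m, hm⟩

/-- A loose path on all vertices but `v` closes up to a loose Hamilton cycle. -/
theorem exists_cycle [Fintype V] {a b v : V} (h : LoosePath E a b (Finset.univ \ {v}))
    (hE : E b v a) : ∃ f : ℕ → V, Set.InjOn f (Set.Iio (Fintype.card V)) ∧
      f (Fintype.card V) = f 0 ∧
      ∀ i < Fintype.card V / 2, E (f (2 * i)) (f (2 * i + 1)) (f (2 * i + 2)) := by
  obtain ⟨m, f, hcard, h0, hm, hinj, hmem, hedge⟩ := h.exists_seq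
  have hn : Fintype.card V = 2 * m + 2 := by
    have h1 : (Finset.univ \ {v} : Finset V).card + 1 = Fintype.card V := by
      rw [Finset.card_sdiff_of_subset (Finset.subset_univ _), Finset.card_singleton,
        Finset.card_univ]
      have : 0 < Fintype.card V := Fintype.card_pos_iff.2 ⟨v⟩
      omega
    omega
  have hv : ∀ i ≤ 2 * m, f i ≠ v := fun i hi h => by simpa [h] using hmem i hi
  refine ⟨fun i => if i ≤ 2 * m then f i else if i = 2 * m + 1 then v else a, ?_, ?_, ?_⟩
  · intro i hi j hj hij
    simp only [Set.mem_Iio, hn] at hi hj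
    dsimp only at hij
    split_ifs at hij with h1 h2 h3 h4 h5 h6 h7 h8
    · exact hinj h1 h2 hij
    · exact absurd hij (hv i h1)
    · omega
    · exact absurd hij.symm (hv j (by assumption))
    all_goals omega
  · simp [hn, h0]
  · intro i hi
    dsimp only
    rcases (show i < m ∨ i = m by omega) with h' | rfl
    · rw [if_pos (by omega), if_pos (by omega), if_pos (by omega)]
      exact hedge i h'
    · rw [if_pos (by omega), if_neg (by omega), if_pos (by omega), if_neg (by omega),
          if_neg (by omega), hm]
      exact hE

end LoosePath

section Many

open scoped Classical

/-- At least a proportion `c` of all elements satisfies `P`. -/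
def Many {V : Type*} [Fintype V] (c : ℝ) (P : V → Prop) : Prop :=
  c * Fintype.card V ≤ ((Finset.univ.filter P).card : ℝ)

theorem many_iff {V : Type*} [Fintype V] {c : ℝ} {P : V → Prop} [DecidablePred P] :
    Many c P ↔ c * Fintype.card V ≤ ((Finset.univ.filter P).card : ℝ) := by
  unfold Many
  convert Iff.rfl

theorem Many.mono {V : Type*} [Fintype V] {c c' : ℝ} {P Q : V → Prop} (h : Many c P)
    (hc : c' ≤ c) (hPQ : ∀ v, P v → Q v) : Many c' Q := by
  unfold Many at *
  calc c' * (Fintype.card V : ℝ) ≤ c * Fintype.card V := by gcongr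
    _ ≤ _ := h
    _ ≤ _ := by
      exact_mod_cast Finset.card_le_card (Finset.monotone_filter_right _ fun v _ => hPQ v)

theorem Many.sdiff {V : Type*} [Fintype V] {c : ℝ} {P : V → Prop} (h : Many c P)
    (F : Finset V) (hF : (F.card : ℝ) ≤ c / 2 * Fintype.card V) :
    Many (c / 2) (fun v => P v ∧ v ∉ F) := by
  rw [many_iff] at *
  have h1 : Finset.univ.filter P ⊆ (Finset.univ.filter fun v => P v ∧ v ∉ F) ∪ F := by
    intro v hv
    by_cases h : v ∈ F <;> simp_all
  have h2 := (Finset.card_le_card h1).trans (Finset.card_union_le _ _)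
  have h3 : ((Finset.univ.filter P).card : ℝ) ≤
    ((Finset.univ.filter fun v => P v ∧ v ∉ F).card : ℝ) + F.card := by exact_mod_cast h2
  linarith

theorem Many.inter {V : Type*} [Fintype V] {c d : ℝ} {P Q : V → Prop} (h : Many c P)
    (h' : Many d Q) : Many (c + d - 1) (fun v => P v ∧ Q v) := by
  rw [many_iff] at *
  have h1 := Finset.card_union_add_card_inter (Finset.univ.filter P) (Finset.univ.filter Q)
  have h2 : (Finset.univ.filter P ∪ Finset.univ.filter Q).card ≤ Fintype.card V :=
    Finset.card_le_univ _
  rw [← Finset.filter_and] at h1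
  have h3 : ((Finset.univ.filter P ∪ Finset.univ.filter Q).card : ℝ) ≤ Fintype.card V := by
    exact_mod_cast h2
  have h4 : ((Finset.univ.filter P ∪ Finset.univ.filter Q).card : ℝ) +
    ((Finset.univ.filter fun v => P v ∧ Q v).card : ℝ) =
      (Finset.univ.filter P).card + (Finset.univ.filter Q).card := by exact_mod_cast h1
  linarith

/-- If `∑ v, g v` is at least `2 c n²` and `0 ≤ g ≤ n`, then `g v ≥ c n` for many `v`. -/
theorem many_of_sum {V : Type*} [Fintype V] {c : ℝ} (hc : 0 ≤ c) (g : V → ℝ)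
    (hg : ∀ v, g v ≤ Fintype.card V)
    (h : 2 * c * (Fintype.card V : ℝ) ^ 2 ≤ ∑ v, g v) :
    Many c (fun v => c * Fintype.card V ≤ g v) := by
  unfold Many
  set n : ℝ := ((Fintype.card V : ℕ) : ℝ)
  have hn : 0 ≤ n := Nat.cast_nonneg _
  have h1 : ∑ v, g v ≤ ∑ v, (c * n + if c * n ≤ g v then n else 0) := by
    refine Finset.sum_le_sum fun v _ => ?_
    split_ifs with h
    · nlinarith [hg v]
    · linarith
  rw [Finset.sum_add_distrib, ← Finset.sum_filter, Finset.sum_const, Finset.sum_const] at h1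
  simp only [nsmul_eq_mul, Finset.card_univ] at h1
  rcases hn.eq_or_lt with h0 | h0
  · rw [← h0]; simp
  · refine le_of_mul_le_mul_right ?_ h0
    nlinarith

theorem sum_card_filter_comm {V : Type*} [Fintype V] (P : V → V → Prop)
    [∀ x y, Decidable (P x y)] :
    ∑ x, ((Finset.univ.filter fun y => P x y).card : ℝ) =
      ∑ y, ((Finset.univ.filter fun x => P x y).card : ℝ) := by
  exact_mod_cast Finset.sum_card_bipartiteAbove_eq_sum_card_bipartiteBelow (s := Finset.univ)
    (t := Finset.univ) P

theorem Many.swap {V : Type*} [Fintype V] {c d e : ℝ} {P : V → V → Prop}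
    (hd : 0 ≤ d) (he : 0 ≤ e) (hcd : 2 * e ≤ c * d) (h : Many c fun x => Many d fun y => P x y) :
    Many e fun y => Many e fun x => P x y := by
  refine many_of_sum (c := e) he (fun y => ((Finset.univ.filter fun x => P x y).card : ℝ))
    (fun y => by exact_mod_cast Finset.card_le_univ _) ?_
  rw [← sum_card_filter_comm]
  unfold Many at h
  set n : ℝ := ((Fintype.card V : ℕ) : ℝ)
  have hn : 0 ≤ n := Nat.cast_nonneg _
  have h1 : ∑ x, (if d * n ≤ ((Finset.univ.filter fun y => P x y).card : ℝ) then d * n else 0) ≤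
      ∑ x, ((Finset.univ.filter fun y => P x y).card : ℝ) := by
    refine Finset.sum_le_sum fun x _ => ?_
    split_ifs with h
    · exact h
    · positivity
  rw [← Finset.sum_filter, Finset.sum_const, nsmul_eq_mul] at h1
  refine le_trans ?_ h1
  calc 2 * e * n ^ 2 ≤ (c * d) * n ^ 2 := by gcongr
    _ = (c * n) * (d * n) := by ring
    _ ≤ _ := by gcongr

/-- Iterated version of `Many` for lists of length `k`. -/
def ManyList {V : Type*} [Fintype V] (c : ℝ) : ℕ → (List V → Prop) → Prop
  | 0, P => P []
  | k + 1, P => Many c fun v => ManyList c k fun l => P (v :: l)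

theorem ManyList.mono {V : Type*} [Fintype V] {c : ℝ} {k : ℕ} {P Q : List V → Prop}
    (h : ManyList c k P) (hPQ : ∀ l, P l → Q l) : ManyList c k Q := by
  induction k generalizing P Q with
  | zero => exact hPQ _ h
  | succ k ih => exact Many.mono h le_rfl fun v hv => ih hv fun l hl => hPQ _ hl

theorem ManyList.nodup {V : Type*} [Fintype V] {c : ℝ} {k : ℕ} {P : List V → Prop}
    (h : ManyList c k P) (F : Finset V)
    (hF : (F.card : ℝ) + k ≤ c / 2 * Fintype.card V) :
    ManyList (c / 2) k fun l => P l ∧ l.Nodup ∧ Disjoint l.toFinset F := by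
  induction k generalizing P F with
  | zero => exact ⟨h, by simp, by simp⟩
  | succ k ih =>
    have h1 : Many (c / 2) fun v => (ManyList c k fun l => P (v :: l)) ∧ v ∉ F :=
      Many.sdiff h F (by push_cast at hF; linarith)
    refine h1.mono le_rfl fun v hv => ?_
    refine (ih hv.1 (insert v F) ?_).mono fun l hl => ?_
    · have : ((insert v F).card : ℝ) ≤ F.card + 1 := by exact_mod_cast Finset.card_insert_le _ _
      push_cast at hF
      linarith
    · obtain ⟨h1, h2, h3⟩ := hl
      rw [Finset.disjoint_insert_right] at h3
      refine ⟨h1, List.nodup_cons.2 ⟨by simpa using h3.1, h2⟩, ?_⟩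
      rw [List.toFinset_cons, Finset.disjoint_insert_left]
      exact ⟨hv.2, h3.2⟩

/-- The sum of `f` over all lists of length `k`. -/
def listSum {V : Type*} [Fintype V] : ℕ → (List V → ℝ) → ℝ
  | 0, f => f []
  | k + 1, f => ∑ v, listSum k fun l => f (v :: l)

theorem listSum_finset_sum {V ι : Type*} [Fintype V] (k : ℕ) (s : Finset ι)
    (f : ι → List V → ℝ) : listSum k (fun l => ∑ i ∈ s, f i l) = ∑ i ∈ s, listSum k (f i) := by
  induction k generalizing f with
  | zero => rfl
  | succ k ih =>
    simp only [listSum]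
    rw [Finset.sum_comm]
    exact Finset.sum_congr rfl fun v _ => ih _

theorem listSum_mul {V : Type*} [Fintype V] (k : ℕ) (a : ℝ) (f : List V → ℝ) :
    listSum k (fun l => a * f l) = a * listSum k f := by
  induction k generalizing f with
  | zero => rfl
  | succ k ih =>
    simp only [listSum, Finset.mul_sum]
    exact Finset.sum_congr rfl fun v _ => ih _

theorem ManyList.le_listSum {V : Type*} [Fintype V] {c : ℝ} (hc : 0 ≤ c) {k : ℕ}
    {P : List V → Prop} (h : ManyList c k P) :
    (c * Fintype.card V) ^ k ≤ listSum k fun l => if P l then 1 else 0 := by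
  have nn : ∀ (k : ℕ) (P : List V → Prop), 0 ≤ listSum k fun l => if P l then (1 : ℝ) else 0 := by
    intro k
    induction k with
    | zero => intro P; simp only [listSum]; split_ifs <;> norm_num
    | succ k ih => intro P; exact Finset.sum_nonneg fun v _ => ih fun l => P (v :: l)
  induction k generalizing P with
  | zero => simp only [listSum, ManyList] at *; simp [h]
  | succ k ih =>
    simp only [listSum]
    have h1 : ∑ v, (if ManyList c k (fun l => P (v :: l)) then (c * Fintype.card V) ^ k else 0) ≤
        ∑ v, listSum k fun l => if P (v :: l) then (1 : ℝ) else 0 := by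
      refine Finset.sum_le_sum fun v _ => ?_
      split_ifs with hv
      · exact ih hv
      · exact nn k _
    refine le_trans ?_ h1
    rw [← Finset.sum_filter, Finset.sum_const, nsmul_eq_mul, pow_succ, mul_comm]
    gcongr
    exact h

theorem exists_listSum_le {V : Type*} [Fintype V] (k : ℕ) (f : List V → ℝ)
    (hV : 0 < Fintype.card V) :
    ∃ l : List V, l.length = k ∧ listSum k f ≤ (Fintype.card V : ℝ) ^ k * f l := by
  induction k generalizing f with
  | zero => exact ⟨[], rfl, by simp [listSum]⟩
  | succ k ih =>
    have : (Finset.univ : Finset V).Nonempty := Finset.card_pos.1 (by simpa using hV)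
    obtain ⟨v, -, hv⟩ := Finset.exists_max_image Finset.univ
      (fun v => listSum k fun l => f (v :: l)) this
    obtain ⟨l, hl, hl'⟩ := ih fun l => f (v :: l)
    refine ⟨v :: l, by simp [hl], ?_⟩
    simp only [listSum]
    calc _ ≤ ∑ _x : V, listSum k (fun l => f (v :: l)) := Finset.sum_le_sum fun x hx => hv x hx
      _ = (Fintype.card V : ℝ) * listSum k (fun l => f (v :: l)) := by simp
      _ ≤ (Fintype.card V : ℝ) * ((Fintype.card V : ℝ) ^ k * f (v :: l)) := by gcongr
      _ = _ := by ring

end Many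

section Selection

open scoped Classical

theorem exists_mul_pow_lt_exp (k : ℕ) (C : ℝ) {b : ℝ} (hb : 0 < b) :
    ∃ n₀ : ℕ, ∀ n : ℕ, n₀ ≤ n → C * (n : ℝ) ^ k < Real.exp (b * n) := by
  have h := (isLittleO_pow_exp_pos_mul_atTop k hb).comp_tendsto tendsto_natCast_atTop_atTop
  have h1 := h.def (c := 1 / (|C| + 1)) (by positivity)
  obtain ⟨n₀, hn₀⟩ := Filter.eventually_atTop.1 h1
  refine ⟨n₀, fun n hn => ?_⟩
  have h2 := hn₀ n hn
  simp only [Function.comp, Real.norm_eq_abs, Real.abs_exp] at h2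
  rw [abs_of_nonneg (by positivity), div_mul_eq_mul_div, le_div_iff₀ (by positivity)] at h2
  have h3 := le_abs_self C
  have h4 : (0 : ℝ) ≤ (n : ℝ) ^ k := by positivity
  rcases h4.eq_or_lt with h5 | h5
  · rw [← h5]; simp [Real.exp_pos]
  · nlinarith

/-- One step of the greedy selection: given weights on the families `P i` of lists, some list
avoiding `F` lies in families of large total weight. -/
theorem exists_list_weight {V ι : Type*} [Fintype V] [Fintype ι] {c : ℝ} (hc : 0 ≤ c) {k : ℕ}
    (hV : 0 < Fintype.card V) {P : ι → List V → Prop} (h : ∀ i, ManyList c k (P i))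
    (F : Finset V) (hF : (F.card : ℝ) + k ≤ c / 2 * Fintype.card V) (w : ι → ℝ)
    (hw : ∀ i, 0 ≤ w i) :
    ∃ l : List V, l.length = k ∧
      (c / 2) ^ k * ∑ i, w i ≤
        ∑ i, w i * if P i l ∧ l.Nodup ∧ Disjoint l.toFinset F then 1 else 0 := by
  obtain ⟨l, hl, hl'⟩ := exists_listSum_le k
    (fun l => ∑ i, w i * if P i l ∧ l.Nodup ∧ Disjoint l.toFinset F then 1 else 0) hV
  refine ⟨l, hl, ?_⟩
  rw [listSum_finset_sum] at hl'
  simp only [listSum_mul] at hl'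
  have hn : (0 : ℝ) < (Fintype.card V : ℝ) ^ k := by positivity
  refine le_of_mul_le_mul_left (le_trans ?_ hl') hn
  rw [Finset.mul_sum, Finset.mul_sum]
  refine Finset.sum_le_sum fun i _ => ?_
  have h1 := ((h i).nodup F hF).le_listSum (by positivity)
  rw [mul_pow] at h1
  have h2 := mul_le_mul_of_nonneg_left h1 (hw i)
  calc _ = w i * ((c / 2) ^ k * (Fintype.card V : ℝ) ^ k) := by ring
    _ ≤ _ := h2.trans_eq (by congr!)

theorem exists_selection_aux {V ι : Type*} [Fintype V] [Fintype ι] [Nonempty ι] {c : ℝ}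
    (hc : 0 < c) {k : ℕ} (hk : 0 < k) (hV : 0 < Fintype.card V) {P : ι → List V → Prop}
    (h : ∀ i, ManyList c k (P i)) (F : Finset V) (M : ℕ)
    (hF : (F.card : ℝ) + M * k ≤ c / 2 * Fintype.card V) :
    ∃ 𝒢 : Finset (List V), 𝒢.card = M ∧
      (∀ g ∈ 𝒢, g.length = k ∧ g.Nodup ∧ Disjoint g.toFinset F ∧ ∃ i, P i g) ∧
      (∀ g ∈ 𝒢, ∀ g' ∈ 𝒢, g ≠ g' → Disjoint g.toFinset g'.toFinset) ∧
      ∑ i, (1 / 2 : ℝ) ^ (𝒢.filter (P i)).card ≤ Fintype.card ι * (1 - (c / 2) ^ k / 2) ^ M := by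
  induction M with
  | zero => exact ⟨∅, by simp⟩
  | succ M ih =>
    have hk' : (0 : ℝ) ≤ k := by positivity
    obtain ⟨𝒢, hcard, hG, hdisj, hsum⟩ := ih (by push_cast at hF; nlinarith)
    set w : ι → ℝ := fun i => (1 / 2 : ℝ) ^ (𝒢.filter (P i)).card with hw
    have hwpos : ∀ i, 0 < w i := fun i => by positivity
    have hU : ((F ∪ 𝒢.biUnion List.toFinset).card : ℝ) ≤ F.card + M * k := by
      have h1 : (𝒢.biUnion List.toFinset).card ≤ 𝒢.card * k :=
        Finset.card_biUnion_le_card_mul _ _ _ fun g hg =>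
          (List.toFinset_card_le g).trans (hG g hg).1.le
      have h2 := Finset.card_union_le F (𝒢.biUnion List.toFinset)
      rw [hcard] at h1
      exact_mod_cast h2.trans (by omega)
    obtain ⟨l, hl, hl'⟩ := exists_list_weight hc.le hV h (F ∪ 𝒢.biUnion List.toFinset)
      (by push_cast at hF; linarith) w fun i => (hwpos i).le
    have hpos : 0 < (c / 2) ^ k * ∑ i, w i :=
      mul_pos (by positivity) (Finset.sum_pos (fun i _ => hwpos i) Finset.univ_nonempty)
    obtain ⟨i₀, -, hi₀⟩ := Finset.exists_ne_zero_of_sum_ne_zero (hpos.trans_le hl').ne'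
    have hi₁ : P i₀ l ∧ l.Nodup ∧ Disjoint l.toFinset (F ∪ 𝒢.biUnion List.toFinset) := by
      by_contra hcon
      exact hi₀ (by rw [if_neg hcon, mul_zero])
    obtain ⟨hP, hnd, hdis⟩ := hi₁
    rw [Finset.disjoint_union_right, Finset.disjoint_biUnion_right] at hdis
    have hlne : l.toFinset.Nonempty := by
      rw [List.toFinset_nonempty_iff]
      rintro rfl
      simp at hl
      omega
    have hlG : l ∉ 𝒢 := fun hmem =>
      hlne.ne_empty ((Finset.disjoint_self_iff_empty _).1 (hdis.2 l hmem))
    refine ⟨insert l 𝒢, by rw [Finset.card_insert_of_notMem hlG, hcard], ?_, ?_, ?_⟩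
    · intro g hg
      rcases Finset.mem_insert.1 hg with rfl | hg
      · exact ⟨hl, hnd, hdis.1, i₀, hP⟩
      · exact hG g hg
    · intro g hg g' hg' hne
      rcases Finset.mem_insert.1 hg with h1 | h1 <;> rcases Finset.mem_insert.1 hg' with h2 | h2
      · exact absurd (h1.trans h2.symm) hne
      · exact h1 ▸ hdis.2 g' h2
      · exact h2 ▸ (hdis.2 g h1).symm
      · exact hdisj g h1 g' h2 hne
    · have h1 : ∀ i, (1 / 2 : ℝ) ^ ((insert l 𝒢).filter (P i)).card =
          w i - 1 / 2 * (w i * if P i l ∧ l.Nodup ∧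
            Disjoint l.toFinset (F ∪ 𝒢.biUnion List.toFinset) then 1 else 0) := by
        intro i
        have hdis' : Disjoint l.toFinset (F ∪ 𝒢.biUnion List.toFinset) := by
          rw [Finset.disjoint_union_right, Finset.disjoint_biUnion_right]
          exact hdis
        by_cases hi : P i l
        · rw [Finset.filter_insert, if_pos hi, Finset.card_insert_of_notMem (by simp [hlG]),
            if_pos ⟨hi, hnd, hdis'⟩, pow_succ]
          simp only [hw]
          ring
        · rw [Finset.filter_insert, if_neg hi, if_neg (by tauto)]
          simp [hw]
      rw [Finset.sum_congr rfl fun i _ => h1 i, Finset.sum_sub_distrib, ← Finset.mul_sum]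
      have hq : (c / 2) ^ k ≤ 2 := by
        have h2 : ∑ i, (w i * if P i l ∧ l.Nodup ∧
            Disjoint l.toFinset (F ∪ 𝒢.biUnion List.toFinset) then (1 : ℝ) else 0) ≤ ∑ i, w i := by
          refine Finset.sum_le_sum fun i _ => ?_
          have := hwpos i
          split_ifs <;> linarith
        have h3 : 0 < ∑ i, w i := Finset.sum_pos (fun i _ => hwpos i) Finset.univ_nonempty
        have h4 : (c / 2) ^ k * ∑ i, w i ≤ 1 * ∑ i, w i := by linarith
        linarith [le_of_mul_le_mul_right h4 h3]
      calc _ ≤ (∑ i, w i) * (1 - (c / 2) ^ k / 2) := by linarith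
        _ ≤ (Fintype.card ι * (1 - (c / 2) ^ k / 2) ^ M) * (1 - (c / 2) ^ k / 2) :=
          mul_le_mul_of_nonneg_right hsum (by linarith)
        _ = _ := by ring

/-- A small disjoint family of lists which meets each of the given dense families often. -/
theorem exists_selection {c β : ℝ} (hc : 0 < c) (hc1 : c ≤ 1) (hβ : 0 < β) {k : ℕ} (hk : 0 < k)
    (hβk : β * k ≤ c / 4) :
    ∃ κ : ℝ, 0 < κ ∧ ∃ n₀ : ℕ, ∀ (V : Type) [Fintype V], n₀ ≤ Fintype.card V →
      ∀ P : V × V → List V → Prop, (∀ i, ManyList c k (P i)) →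
      ∀ F : Finset V, (F.card : ℝ) ≤ c / 4 * Fintype.card V →
      ∃ 𝒢 : Finset (List V), (𝒢.card : ℝ) ≤ β * Fintype.card V ∧
        (∀ g ∈ 𝒢, g.length = k ∧ g.Nodup ∧ Disjoint g.toFinset F ∧ ∃ i, P i g) ∧
        (∀ g ∈ 𝒢, ∀ g' ∈ 𝒢, g ≠ g' → Disjoint g.toFinset g'.toFinset) ∧
        ∀ i, κ * Fintype.card V ≤ ((𝒢.filter (P i)).card : ℝ) := by
  set q : ℝ := (c / 2) ^ k / 2 with hq
  have hq0 : 0 < q := by positivity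
  have hq1 : q ≤ 1 := by
    have : (c / 2) ^ k ≤ 1 := pow_le_one₀ (by positivity) (by linarith)
    linarith
  obtain ⟨n₀, hn₀⟩ := exists_mul_pow_lt_exp 2 (Real.exp q) (b := q * β / 2) (by positivity)
  refine ⟨q * β / 2, by positivity, n₀ + 1, fun V _ hn P hP F hF => ?_⟩
  have hV : 0 < Fintype.card V := by omega
  have : Nonempty V := Fintype.card_pos_iff.1 hV
  set n : ℝ := ((Fintype.card V : ℕ) : ℝ) with hndef
  have hn0 : 0 < n := by positivity
  have hM : (⌊β * n⌋₊ : ℝ) ≤ β * n := Nat.floor_le (by positivity)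
  have hM' : β * n < ⌊β * n⌋₊ + 1 := Nat.lt_floor_add_one _
  obtain ⟨𝒢, hcard, hG, hdisj, hsum⟩ := exists_selection_aux hc hk hV hP F ⌊β * n⌋₊ (by
    have h1 : (⌊β * n⌋₊ : ℝ) * k ≤ β * n * k := by gcongr
    have h2 : β * k * n ≤ c / 4 * n := by gcongr
    linarith)
  refine ⟨𝒢, by rw [hcard]; exact hM, hG, hdisj, fun i => ?_⟩
  by_contra! hlt
  have h1 : (1 / 2 : ℝ) ^ (𝒢.filter (P i)).card ≤ n ^ 2 * (1 - q) ^ ⌊β * n⌋₊ := by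
    refine le_trans (Finset.single_le_sum (f := fun i => (1 / 2 : ℝ) ^ (𝒢.filter (P i)).card)
      (fun i _ => by positivity) (Finset.mem_univ i)) (hsum.trans_eq ?_)
    rw [Fintype.card_prod, sq]
    push_cast
    rfl
  have h2 : (1 - q) ^ ⌊β * n⌋₊ ≤ Real.exp (q - q * β * n) := by
    calc (1 - q) ^ ⌊β * n⌋₊ ≤ Real.exp (-q) ^ ⌊β * n⌋₊ :=
          pow_le_pow_left₀ (by linarith) (by linarith [Real.add_one_le_exp (-q)]) _
      _ = Real.exp (⌊β * n⌋₊ * (-q)) := (Real.exp_nat_mul _ _).symm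
      _ ≤ _ := Real.exp_le_exp.2 (by nlinarith)
  have h3 : Real.exp (-(q * β / 2 * n)) ≤ (1 / 2 : ℝ) ^ (𝒢.filter (P i)).card := by
    have h4 : Real.exp (-1) ≤ 1 / 2 := by
      rw [Real.exp_neg, one_div]
      exact inv_anti₀ (by norm_num) (by linarith [Real.add_one_le_exp 1])
    calc Real.exp (-(q * β / 2 * n)) ≤ Real.exp ((𝒢.filter (P i)).card * (-1)) :=
          Real.exp_le_exp.2 (by linarith)
      _ = Real.exp (-1) ^ (𝒢.filter (P i)).card := Real.exp_nat_mul _ _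
      _ ≤ _ := by gcongr
  have h4 := hn₀ (Fintype.card V) (by omega)
  have h5 : Real.exp (-(q * β / 2 * n)) ≤ n ^ 2 * Real.exp (q - q * β * n) :=
    h3.trans (h1.trans (by gcongr))
  have h6 : Real.exp (q - q * β * n) =
      Real.exp q * Real.exp (-(q * β / 2 * n)) * Real.exp (-(q * β / 2 * n)) := by
    rw [← Real.exp_add, ← Real.exp_add]; ring_nf
  have h7 : Real.exp (q * β / 2 * n) * Real.exp (-(q * β / 2 * n)) = 1 := by
    rw [← Real.exp_add]; simp
  have h8 := Real.exp_pos (-(q * β / 2 * n))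
  rw [h6] at h5
  rw [← hndef] at h4
  have h9 := mul_lt_mul_of_pos_right h4 h8
  rw [h7] at h9
  nlinarith

end Selection

section Links

open scoped Classical

theorem sum_good_le {V : Type*} [Fintype V] {G : V → V → Prop} (hG : ∀ x y, G x y → G y x)
    (h : 7 / 16 * (Fintype.card V : ℝ) ^ 2 ≤ ∑ x, ((Finset.univ.filter (G x)).card : ℝ)) :
    873 / 2000 * (Fintype.card V : ℝ) ^ 2 ≤ ∑ x ∈ Finset.univ.filter (fun x => Many (1 / 2000) (G x)),
      ((Finset.univ.filter fun y => G x y ∧ Many (1 / 2000) (G y)).card : ℝ) := by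
  set n : ℝ := ((Fintype.card V : ℕ) : ℝ) with hn
  have hn0 : 0 ≤ n := Nat.cast_nonneg _
  have hbad : ∀ x, ¬ Many (1 / 2000) (G x) →
      ((Finset.univ.filter (G x)).card : ℝ) ≤ 1 / 2000 * n := by
    intro x hx
    rw [many_iff] at hx
    linarith
  have h1 : ∀ x, ((Finset.univ.filter (G x)).card : ℝ) ≤
      ((Finset.univ.filter fun y => G x y ∧ Many (1 / 2000) (G y)).card : ℝ) +
      ((Finset.univ.filter fun y => G x y ∧ ¬ Many (1 / 2000) (G y)).card : ℝ) := by
    intro x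
    rw [← Finset.filter_filter, ← Finset.filter_filter]
    exact_mod_cast (Finset.card_filter_add_card_filter_not _).ge
  have h2 : ∑ x, ((Finset.univ.filter fun y => G x y ∧ ¬ Many (1 / 2000) (G y)).card : ℝ) ≤
      1 / 2000 * n ^ 2 := by
    rw [sum_card_filter_comm]
    calc _ ≤ ∑ _y : V, 1 / 2000 * n := by
          refine Finset.sum_le_sum fun y _ => ?_
          by_cases hy : Many (1 / 2000) (G y)
          · simp only [hy, not_true, and_false, Finset.filter_false, Finset.card_empty]
            push_cast
            positivity
          · refine le_trans ?_ (hbad y hy)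
            exact_mod_cast Finset.card_le_card
              (fun x hx => by simp only [Finset.mem_filter] at hx ⊢; exact ⟨hx.1, hG _ _ hx.2.1⟩)
      _ = _ := by simp [← hn]; ring
  have h3 : ∑ x, ((Finset.univ.filter fun y => G x y ∧ Many (1 / 2000) (G y)).card : ℝ) ≤
      ∑ x ∈ Finset.univ.filter (fun x => Many (1 / 2000) (G x)),
        ((Finset.univ.filter fun y => G x y ∧ Many (1 / 2000) (G y)).card : ℝ) +
      1 / 2000 * n ^ 2 := by
    rw [← Finset.sum_filter_add_sum_filter_not Finset.univ (fun x => Many (1 / 2000) (G x))]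
    gcongr
    calc _ ≤ ∑ x ∈ Finset.univ.filter (fun x => ¬ Many (1 / 2000) (G x)), 1 / 2000 * n := by
          refine Finset.sum_le_sum fun x hx => ?_
          refine le_trans ?_ (hbad x (Finset.mem_filter.1 hx).2)
          exact_mod_cast Finset.card_le_card
              (fun x hx => by simp only [Finset.mem_filter] at hx ⊢; tauto)
      _ ≤ ∑ _x : V, 1 / 2000 * n :=
        Finset.sum_le_sum_of_subset_of_nonneg (Finset.subset_univ _) fun _ _ _ => by positivity
      _ = _ := by simp [← hn]; ring
  have h4 := Finset.sum_le_sum fun x (_ : x ∈ Finset.univ) => h1 x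
  rw [Finset.sum_add_distrib] at h4
  linarith

theorem many_good {V : Type*} [Fintype V] {G : V → V → Prop} (hG : ∀ x y, G x y → G y x)
    (h : 7 / 16 * (Fintype.card V : ℝ) ^ 2 ≤ ∑ x, ((Finset.univ.filter (G x)).card : ℝ)) :
    Many (66 / 100) fun x => Many (1 / 2000) (G x) := by
  have h1 := sum_good_le hG h
  have h2 : ∑ x ∈ Finset.univ.filter (fun x => Many (1 / 2000) (G x)),
      ((Finset.univ.filter fun y => G x y ∧ Many (1 / 2000) (G y)).card : ℝ) ≤
      ∑ x ∈ Finset.univ.filter (fun x => Many (1 / 2000) (G x)),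
      ((Finset.univ.filter fun y => Many (1 / 2000) (G y)).card : ℝ) := by
    refine Finset.sum_le_sum fun x _ => ?_
    exact_mod_cast Finset.card_le_card (fun x hx => by simp only [Finset.mem_filter] at hx ⊢; tauto)
  rw [Finset.sum_const, nsmul_eq_mul] at h2
  rw [many_iff]
  have h3 : (0 : ℝ) ≤ Fintype.card V := Nat.cast_nonneg _
  refine abs_le_of_sq_le_sq' ?_ (Nat.cast_nonneg _) |>.2
  nlinarith

theorem many_many_good {V : Type*} [Fintype V] {G : V → V → Prop} (hG : ∀ x y, G x y → G y x)
    (h : 7 / 16 * (Fintype.card V : ℝ) ^ 2 ≤ ∑ x, ((Finset.univ.filter (G x)).card : ℝ)) :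
    Many (1 / 5) fun x => Many (1 / 2000) (G x) ∧
      Many (1 / 5) fun y => G x y ∧ Many (1 / 2000) (G y) := by
  have h1 := sum_good_le hG h
  rw [Finset.sum_filter] at h1
  have h3 : (0 : ℝ) ≤ Fintype.card V := Nat.cast_nonneg _
  have h2 := many_of_sum (c := 1 / 5) (by norm_num) _ (fun x => ?_) (le_trans ?_ h1)
  · refine h2.mono le_rfl fun x hx => ?_
    have hV : (0 : ℝ) < Fintype.card V := by exact_mod_cast Fintype.card_pos_iff.2 ⟨x⟩
    split_ifs at hx with h4
    · exact ⟨h4, many_iff.2 hx⟩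
    · linarith
  · split_ifs
    · exact_mod_cast Finset.card_le_univ _
    · exact h3
  · nlinarith

theorem many_connector {V : Type*} [Fintype V] {G₁ G₂ : V → V → Prop}
    (hG₁ : ∀ x y, G₁ x y → G₁ y x) (hG₂ : ∀ x y, G₂ x y → G₂ y x)
    (h₁ : 7 / 16 * (Fintype.card V : ℝ) ^ 2 ≤ ∑ x, ((Finset.univ.filter (G₁ x)).card : ℝ))
    (h₂ : 7 / 16 * (Fintype.card V : ℝ) ^ 2 ≤ ∑ x, ((Finset.univ.filter (G₂ x)).card : ℝ)) :
    Many (32 / 100) fun z => Many (1 / 2000) (G₁ z) ∧ Many (1 / 2000) (G₂ z) :=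
  ((many_good hG₁ h₁).inter (many_good hG₂ h₂)).mono (by norm_num) fun _ h => h

theorem many_common_good {V : Type*} [Fintype V] {G₁ G₂ : V → V → Prop}
    (hG₁ : ∀ x y, G₁ x y → G₁ y x)
    (h₁ : 7 / 16 * (Fintype.card V : ℝ) ^ 2 ≤ ∑ x, ((Finset.univ.filter (G₁ x)).card : ℝ))
    (hle : (Finset.univ.filter fun x => Many (1 / 2000) (G₁ x)).card ≤
      (Finset.univ.filter fun x => Many (1 / 2000) (G₂ x)).card) :
    Many (7 / 100) fun p => Many (341 / 1000) (G₁ p) ∧ Many (1 / 2000) (G₂ p) := by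
  have h1 := sum_good_le hG₁ h₁
  set A := Finset.univ.filter fun x => Many (1 / 2000) (G₁ x) with hA
  set C := Finset.univ.filter fun x => Many (1 / 2000) (G₂ x) with hC
  rw [many_iff]
  set B := Finset.univ.filter fun p => Many (341 / 1000) (G₁ p) ∧ Many (1 / 2000) (G₂ p) with hB
  set n : ℝ := ((Fintype.card V : ℕ) : ℝ) with hn
  have hn0 : 0 ≤ n := Nat.cast_nonneg _
  have h2 : ∑ x ∈ A, ((Finset.univ.filter fun y => G₁ x y ∧ Many (1 / 2000) (G₁ y)).card : ℝ) ≤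
      ∑ x ∈ A, ((if x ∈ A \ C then (A.card : ℝ) else 0) + (if x ∈ B then n else 0) +
        if x ∈ A ∩ C then 341 / 1000 * n else 0) := by
    refine Finset.sum_le_sum fun x hx => ?_
    by_cases hxC : x ∈ C
    · have h3 : ((Finset.univ.filter fun y => G₁ x y ∧ Many (1 / 2000) (G₁ y)).card : ℝ) ≤
        (Finset.univ.filter (G₁ x)).card := by
        exact_mod_cast Finset.card_le_card (fun x hx => by simp only [Finset.mem_filter] at hx ⊢; tauto)
      rw [if_neg (by simp [hxC]), if_pos (by simp [hx, hxC] : x ∈ A ∩ C)]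
      by_cases hxB : x ∈ B
      · rw [if_pos hxB]
        have : ((Finset.univ.filter (G₁ x)).card : ℝ) ≤ n := by
          rw [hn]
          exact_mod_cast Finset.card_le_univ _
        linarith
      · rw [if_neg hxB]
        have : ¬ Many (341 / 1000) (G₁ x) := fun hm => hxB (by
          rw [hB, Finset.mem_filter]
          exact ⟨Finset.mem_univ _, hm, (Finset.mem_filter.1 hxC).2⟩)
        rw [many_iff, not_le] at this
        linarith
    · rw [if_pos (by simp [hx, hxC]), if_neg (by simp [hxC] : x ∉ A ∩ C)]
      have h3 : ((Finset.univ.filter fun y => G₁ x y ∧ Many (1 / 2000) (G₁ y)).card : ℝ) ≤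
        A.card := by
        exact_mod_cast Finset.card_le_card (fun x hx => by simp only [A, Finset.mem_filter] at hx ⊢; tauto)
      split_ifs <;> linarith
  rw [Finset.sum_add_distrib, Finset.sum_add_distrib, Finset.sum_ite_mem, Finset.sum_ite_mem,
    Finset.sum_ite_mem, Finset.sum_const, Finset.sum_const, Finset.sum_const] at h2
  simp only [nsmul_eq_mul, Finset.inter_eq_right.2 (Finset.sdiff_subset (s := A) (t := C)),
    Finset.inter_eq_right.2 (Finset.inter_subset_left (s₁ := A) (s₂ := C))] at h2
  have h3 : ((A ∩ B).card : ℝ) ≤ B.card := by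
    exact_mod_cast Finset.card_le_card Finset.inter_subset_right
  have h4 : ((A \ C).card : ℝ) + (A ∩ C).card = A.card := by
    exact_mod_cast Finset.card_sdiff_add_card_inter A C
  have h5 : ((A \ C).card : ℝ) + C.card ≤ n := by
    have : (A \ C).card + C.card ≤ Fintype.card V := by
      rw [← Finset.card_union_of_disjoint Finset.sdiff_disjoint]
      exact Finset.card_le_univ _
    rw [hn]
    exact_mod_cast this
  have h6 : (A.card : ℝ) ≤ C.card := by exact_mod_cast hle
  have h7 : 66 / 100 * n ≤ A.card := many_iff.1 (many_good hG₁ h₁)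
  set α : ℝ := (A.card : ℝ)
  set s : ℝ := ((A \ C).card : ℝ)
  set t : ℝ := ((A ∩ C).card : ℝ)
  have h8 : ((A ∩ B).card : ℝ) * n ≤ B.card * n := by gcongr
  have ht : t = α - s := by linarith
  rw [ht] at h2
  have h9 : s * (α - 341 / 1000 * n) ≤ (n - α) * (α - 341 / 1000 * n) := by
    apply mul_le_mul_of_nonneg_right <;> linarith
  have h10 : 7 / 100 * n * n ≤ B.card * n := by
    nlinarith [sq_nonneg (α - 841 / 1000 * n), sq_nonneg n]
  rcases hn0.eq_or_lt with h0 | h0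
  · rw [← h0]; simp
  · exact le_of_mul_le_mul_right h10 h0

theorem many_swap_aux {V : Type*} [Fintype V] {E : V → V → V → Prop}
    (h12 : ∀ x y z, E x y z → E y x z) (h23 : ∀ x y z, E x y z → E x z y)
    (hD : ∀ v, 7 / 16 * (Fintype.card V : ℝ) ^ 2 ≤
      ∑ x, ((Finset.univ.filter (E v x)).card : ℝ)) (x z : V)
    (hle : (Finset.univ.filter fun p => Many (1 / 2000) (E x p)).card ≤
      (Finset.univ.filter fun p => Many (1 / 2000) (E z p)).card) :
    Many (1 / 2000) fun p => Many (1 / 2000) fun b => Many (1 / 2000) fun a =>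
      Many (1 / 2000) fun q => E x p a ∧ E z p b ∧ E a b q := by
  refine (many_common_good (h23 x) (hD x) hle).mono (by norm_num) fun p ⟨hp1, hp2⟩ => ?_
  refine hp2.mono le_rfl fun b hb => ?_
  refine (hp1.inter (many_good (h23 b) (hD b))).mono (by norm_num) fun a ⟨ha1, ha2⟩ => ?_
  exact ha2.mono le_rfl fun q hq => ⟨ha1, hb, h12 _ _ _ hq⟩

theorem many_swap {V : Type*} [Fintype V] {E : V → V → V → Prop}
    (h12 : ∀ x y z, E x y z → E y x z) (h23 : ∀ x y z, E x y z → E x z y)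
    (hD : ∀ v, 7 / 16 * (Fintype.card V : ℝ) ^ 2 ≤
      ∑ x, ((Finset.univ.filter (E v x)).card : ℝ)) (x z : V) :
    Many (1 / 10 ^ 7) fun p => Many (1 / 10 ^ 7) fun a => Many (1 / 10 ^ 7) fun b =>
      Many (1 / 10 ^ 7) fun q => E x p a ∧ E z p b ∧ E a b q := by
  rcases le_total (Finset.univ.filter fun p => Many (1 / 2000) (E x p)).card
    (Finset.univ.filter fun p => Many (1 / 2000) (E z p)).card with hle | hle
  · refine (many_swap_aux h12 h23 hD x z hle).mono (by norm_num) fun p hp => ?_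
    refine (Many.swap (e := 1 / 10 ^ 7) (by norm_num) (by norm_num)
      (by norm_num) hp).mono le_rfl fun a ha => ha.mono le_rfl fun b hb => ?_
    exact hb.mono (by norm_num) fun q hq => hq
  · refine (many_swap_aux h12 h23 hD z x hle).mono (by norm_num) fun p hp => ?_
    refine hp.mono (by norm_num) fun a ha => ha.mono (by norm_num) fun b hb => ?_
    exact hb.mono (by norm_num) fun q ⟨h1, h2, h3⟩ => ⟨h2, h1, h12 _ _ _ h3⟩

end Links

section Gadgets

open scoped Classical

variable {V : Type*} {E : V → V → V → Prop}

/-- The list `[z, u, v]` links `x` to `y` through the edges `x u z` and `z v y`. -/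
def IsConnector (E : V → V → V → Prop) (x y : V) (l : List V) : Prop :=
  ∃ z u v, l = [z, u, v] ∧ E x u z ∧ E z v y

/-- The list `[p, a, b, q]` allows to exchange `x` and `y` in a path from `p` to `q`. -/
def IsSwap (E : V → V → V → Prop) (x y : V) (l : List V) : Prop :=
  ∃ p a b q, l = [p, a, b, q] ∧ E x p a ∧ E y p b ∧ E a b q

/-- A list carrying a loose path which can be rerouted to absorb `x` and `y`. -/
def IsGadget (E : V → V → V → Prop) (x y : V) (l : List V) : Prop :=
  ∃ a p q x' y' p₁ a₁ b₁ q₁ p₂ a₂ b₂ q₂ z u v z' u' v',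
    l = [a, p, q, x', y', p₁, a₁, b₁, q₁, p₂, a₂, b₂, q₂, z, u, v, z', u', v'] ∧
    (E a p q ∧ E a p x' ∧ E a q y') ∧ (E x p₁ a₁ ∧ E x' p₁ b₁ ∧ E a₁ b₁ q₁) ∧
    (E y p₂ a₂ ∧ E y' p₂ b₂ ∧ E a₂ b₂ q₂) ∧ (E q₁ u z ∧ E z v p) ∧ E q u' z' ∧ E z' v' p₂

/-- Consecutive triples sharing one element are edges. -/
def LooseList (E : V → V → V → Prop) : V → List V → V → Prop
  | a, [], b => a = b
  | _, [_], _ => False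
  | a, x :: c :: l, b => E a x c ∧ LooseList E c l b

theorem LoosePath.append_list {a b c : V} {S : Finset V} (h : LoosePath E a b S) (l : List V)
    (hl : LooseList E b l c) (hnd : l.Nodup) (hS : Disjoint S l.toFinset) :
    LoosePath E a c (S ∪ l.toFinset) := by
  induction hm : l.length using Nat.strong_induction_on generalizing l b S with
  | _ m ih =>
    match l, hl with
    | [], hl => simpa [LooseList] using hl ▸ h
    | x :: d :: l, hl =>
      simp only [List.nodup_cons, List.mem_cons, not_or] at hnd
      simp only [List.toFinset_cons, Finset.disjoint_insert_right] at hS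
      have h1 := h.snoc x d hl.1 hS.1 hS.2.1 hnd.1.1
      have h2 := ih l.length (by simp at hm; omega) h1 l hl.2 hnd.2.2 (by
        rw [Finset.disjoint_insert_left, Finset.disjoint_insert_left]
        simp only [List.mem_toFinset]
        exact ⟨hnd.1.2, hnd.2.1, hS.2.2⟩) rfl
      convert h2 using 1
      simp only [List.toFinset_cons, Finset.insert_union, Finset.union_insert]

theorem LoosePath.of_list {a b : V} {l : List V} (hl : LooseList E a l b) (hnd : (a :: l).Nodup) :
    LoosePath E a b (a :: l).toFinset := by
  rw [List.nodup_cons] at hnd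
  have := (LoosePath.single (E := E) a).append_list l hl hnd.2 (by simpa using hnd.1)
  rwa [List.toFinset_cons, Finset.insert_eq]

theorem LoosePath.of_list_of_mem_iff {a b : V} {l l' : List V} (hl : LooseList E a l b)
    (hnd : l'.Nodup) (hlen : (a :: l).length = l'.length) (hmem : ∀ x, x ∈ a :: l ↔ x ∈ l') :
    LoosePath E a b l'.toFinset := by
  have h1 : (a :: l).toFinset = l'.toFinset := by ext x; simp only [List.mem_toFinset, hmem]
  rw [← h1]
  refine LoosePath.of_list hl (Multiset.coe_nodup.1 ?_)
  rw [← Multiset.toFinset_card_eq_card_iff_nodup]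
  simp only [Multiset.coe_card, hlen]
  change (a :: l).toFinset.card = _
  rw [h1, List.toFinset_card_of_nodup hnd]

theorem gadget_loosePath (h12 : ∀ x y z, E x y z → E y x z) (h23 : ∀ x y z, E x y z → E x z y)
    {g : List V} (hg : g.Nodup) (hex : ∃ i : V × V, IsGadget E i.1 i.2 g) :
    ∃ s t, LoosePath E s t g.toFinset ∧ ∀ x y, IsGadget E x y g → x ≠ y → x ∉ g → y ∉ g →
      LoosePath E s t (g.toFinset ∪ {x, y}) := by
  obtain ⟨⟨x, y⟩, a, p, q, x', y', p₁, a₁, b₁, q₁, p₂, a₂, b₂, q₂, z, u, v, z', u', v', rfl,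
    h1, h2, h3, h4, h5⟩ := hex
  refine ⟨p₁, q₂, ?_, ?_⟩
  · refine LoosePath.of_list_of_mem_iff (l := [x', b₁, a₁, q₁, u, z, v, p, a, q, u', z', v', p₂,
      y', b₂, a₂, q₂]) ?_ hg (by simp) fun w => ?_
    · simp only [LooseList]
      grind
    · simp only [List.mem_cons, List.not_mem_nil, or_false]
      exact iff_of_eq (by ac_rfl)
  · rintro x y hxy hne hx hy
    obtain ⟨_, _, _, _, _, _, _, _, _, _, _, _, _, _, _, _, _, _, _, heq, h1, h2, h3, h4, h5⟩ := hxy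
    simp only [List.cons.injEq, and_true] at heq
    obtain ⟨rfl, rfl, rfl, rfl, rfl, rfl, rfl, rfl, rfl, rfl, rfl, rfl, rfl, rfl, rfl, rfl, rfl,
      rfl, rfl⟩ := heq
    have hnd := List.nodup_cons.2 ⟨hy, hg⟩
    have hnd := List.nodup_cons.2 ⟨by rw [List.mem_cons, not_or]; exact ⟨hne, hx⟩, hnd⟩
    have := LoosePath.of_list_of_mem_iff (E := E) (a := p₁) (b := q₂) 
      (l := [x, a₁, b₁, q₁, u, z, v, p, x', a, y', q, u', z', v', p₂, y, a₂, b₂, q₂]) ?_ hnd (by simp) fun w => ?_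
    · convert this using 1
      ext w
      simp only [List.mem_toFinset, List.mem_cons, List.not_mem_nil, or_false, Finset.mem_union,
        Finset.mem_insert, Finset.mem_singleton]
      exact iff_of_eq (by ac_rfl)
    · simp only [LooseList]
      grind
    · simp only [List.mem_cons, List.not_mem_nil, or_false]
      exact iff_of_eq (by ac_rfl)

variable [Fintype V]

theorem ManyList.cons {c d : ℝ} {k : ℕ} {P : List V → Prop} {Q : V → Prop} (h : Many d Q)
    (hcd : c ≤ d) (hP : ∀ v, Q v → ManyList c k fun l => P (v :: l)) : ManyList c (k + 1) P :=
  h.mono hcd hP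

theorem ManyList.append {c : ℝ} {k m : ℕ} {P Q : List V → Prop} (h : ManyList c k Q)
    (hP : ∀ l, Q l → ManyList c m fun l' => P (l ++ l')) : ManyList c (m + k) P := by
  induction k generalizing P Q with
  | zero => exact hP [] h
  | succ k ih => exact Many.mono h le_rfl fun v hv => ih hv fun l hl => hP _ hl

theorem many_true {c : ℝ} (hc : c ≤ 1) : Many c fun _ : V => True := by
  rw [many_iff]
  simp only [Finset.filter_true, Finset.card_univ]
  nlinarith [(Nat.cast_nonneg (Fintype.card V) : (0 : ℝ) ≤ _)]

variable (h12 : ∀ x y z, E x y z → E y x z) (h23 : ∀ x y z, E x y z → E x z y)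
    (hD : ∀ v, 7 / 16 * (Fintype.card V : ℝ) ^ 2 ≤
      ∑ x, ((Finset.univ.filter (E v x)).card : ℝ))
include h12 h23 hD

theorem manyList_isConnector (x y : V) : ManyList (1 / 10 ^ 7) 3 (IsConnector E x y) := by
  refine ManyList.cons (many_connector (h23 x) (h23 y) (hD x) (hD y)) (by norm_num)
    fun z hz => ?_
  refine ManyList.cons hz.1 (by norm_num) fun u hu => ?_
  refine ManyList.cons hz.2 (by norm_num) fun v hv => ?_
  exact ⟨z, u, v, rfl, h23 _ _ _ hu, h23 _ _ _ (h12 _ _ _ hv)⟩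

theorem manyList_isSwap (x y : V) : ManyList (1 / 10 ^ 7) 4 (IsSwap E x y) := by
  refine ManyList.cons (many_swap h12 h23 hD x y) (by norm_num) fun p hp => ?_
  refine ManyList.cons hp (by norm_num) fun a ha => ?_
  refine ManyList.cons ha (by norm_num) fun b hb => ?_
  refine ManyList.cons hb (by norm_num) fun q hq => ?_
  exact ⟨p, a, b, q, rfl, hq⟩

theorem manyList_isGadget (x y : V) : ManyList (1 / 10 ^ 7) 19 (IsGadget E x y) := by
  refine ManyList.cons (many_true le_rfl) (by norm_num) fun a _ => ?_
  refine ManyList.cons (many_many_good (h23 a) (hD a)) (by norm_num) fun p hp => ?_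
  refine ManyList.cons hp.2 (by norm_num) fun q hq => ?_
  refine ManyList.cons hp.1 (by norm_num) fun x' hx' => ?_
  refine ManyList.cons hq.2 (by norm_num) fun y' hy' => ?_
  refine (manyList_isSwap h12 h23 hD x x').append (m := 10) ?_
  rintro _ ⟨p₁, a₁, b₁, q₁, rfl, h1⟩
  refine (manyList_isSwap h12 h23 hD y y').append (m := 6) ?_
  rintro _ ⟨p₂, a₂, b₂, q₂, rfl, h2⟩
  refine (manyList_isConnector h12 h23 hD q₁ p).append (m := 3) ?_
  rintro _ ⟨z, u, v, rfl, h3⟩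
  refine (manyList_isConnector h12 h23 hD q p₂).mono ?_
  rintro _ ⟨z', u', v', rfl, h4⟩
  exact ⟨a, p, q, x', y', p₁, a₁, b₁, q₁, p₂, a₂, b₂, q₂, z, u, v, z', u', v', rfl,
    ⟨hq.1, hx', hy'⟩, h1, h2, h3, h4⟩

end Gadgets

section Absorbing

open scoped Classical

variable {V : Type*} {E : V → V → V → Prop}

theorem ManyList.exists [Fintype V] {c : ℝ} (hc : 0 < c) (hV : 0 < Fintype.card V) {k : ℕ}
    {P : List V → Prop} (h : ManyList c k P) : ∃ l, P l := by
  induction k generalizing P with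
  | zero => exact ⟨[], h⟩
  | succ k ih =>
    have h1 : Many c fun v => ManyList c k fun l => P (v :: l) := h
    rw [many_iff] at h1
    have h2 : 0 < (Finset.univ.filter fun v => ManyList c k fun l => P (v :: l)).card := by
      have : (0 : ℝ) < c * Fintype.card V := by positivity
      exact_mod_cast this.trans_le h1
    obtain ⟨v, hv⟩ := Finset.card_pos.1 h2
    obtain ⟨l, hl⟩ := ih (Finset.mem_filter.1 hv).2
    exact ⟨_, hl⟩

/-- Any two vertices can be linked inside `R`, avoiding any set with at most `N` elements
in `R`. -/
def LinkedIn (E : V → V → V → Prop) (R : Finset V) (N : ℝ) : Prop :=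
  ∀ b c (F : Finset V), ((F ∩ R).card : ℝ) ≤ N → ∃ u z v, E b u z ∧ E z v c ∧
    u ≠ z ∧ u ≠ v ∧ z ≠ v ∧ ({u, z, v} : Finset V) ⊆ R ∧ u ∉ F ∧ z ∉ F ∧ v ∉ F

theorem linkedIn_univ [Fintype V] (h12 : ∀ x y z, E x y z → E y x z)
    (h23 : ∀ x y z, E x y z → E x z y)
    (hD : ∀ v, 7 / 16 * (Fintype.card V : ℝ) ^ 2 ≤
      ∑ x, ((Finset.univ.filter (E v x)).card : ℝ)) :
    LinkedIn E Finset.univ (1 / 10 ^ 7 / 2 * Fintype.card V - 3) := by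
  intro b c F hF
  rw [Finset.inter_univ] at hF
  have hV : (0 : ℝ) < Fintype.card V := by
    by_contra! hcon
    have : (0 : ℝ) ≤ F.card := Nat.cast_nonneg _
    linarith
  obtain ⟨l, ⟨z, u, v, rfl, h1, h2⟩, hnd, hd⟩ :=
    ((manyList_isConnector h12 h23 hD b c).nodup F (by push_cast; linarith)).exists (by norm_num)
      (by exact_mod_cast hV)
  simp only [List.nodup_cons, List.mem_cons, List.not_mem_nil, or_false, not_or,
    not_false_eq_true, List.nodup_nil, and_true] at hnd
  simp only [List.toFinset_cons, Finset.disjoint_insert_left] at hd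
  exact ⟨u, z, v, h1, h2, Ne.symm hnd.1.1, hnd.2, hnd.1.2, Finset.subset_univ _, hd.2.1, hd.1,
    hd.2.2.1⟩

theorem LinkedIn.exists_chain {ι : Type*} {R : Finset V} {N : ℝ} (hR : LinkedIn E R N)
    (T : ι → Finset V) (s t : ι → V) {m : ℕ} {U S₀ : Finset V} (a₀ b₀ : V) (hU : Disjoint S₀ U)
    (𝒢 : Finset ι) (hTU : ∀ g ∈ 𝒢, T g ⊆ U) (hT : ∀ g ∈ 𝒢, (T g ∩ R).card ≤ m)
    (hdisj : ∀ g ∈ 𝒢, ∀ g' ∈ 𝒢, g ≠ g' → Disjoint (T g) (T g'))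
    (hN : ((S₀ ∩ R).card : ℝ) + (U ∩ R).card + (m + 3) * 𝒢.card ≤ N) :
    ∃ b S, (S ∩ R).card ≤ (S₀ ∩ R).card + (m + 3) * 𝒢.card ∧ S₀ ⊆ S ∧ (∀ g ∈ 𝒢, T g ⊆ S) ∧
      S ∩ U ⊆ 𝒢.biUnion T ∧ S ⊆ S₀ ∪ 𝒢.biUnion T ∪ R ∧
      ∀ (W : Finset V) (φ : ι → Finset V), LoosePath E a₀ b₀ (S₀ ∪ W) → Disjoint W S →
        (∀ g ∈ 𝒢, Disjoint W (φ g)) →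
        (∀ g ∈ 𝒢, LoosePath E (s g) (t g) (T g ∪ φ g)) → (∀ g ∈ 𝒢, Disjoint (φ g) S) →
        (∀ g ∈ 𝒢, ∀ g' ∈ 𝒢, g ≠ g' → Disjoint (φ g) (φ g')) →
        LoosePath E a₀ b (S ∪ W ∪ 𝒢.biUnion φ) := by
  induction 𝒢 using Finset.induction_on with
  | empty =>
    refine ⟨b₀, S₀, by simp, subset_rfl, by simp, ?_, by simp, fun W φ h _ _ _ _ _ => by simpa using h⟩
    rw [Finset.disjoint_iff_inter_eq_empty.1 hU]
    simp
  | insert g 𝒢 hg ih =>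
    rw [Finset.card_insert_of_notMem hg] at hN ⊢
    simp only [Finset.mem_insert, forall_eq_or_imp] at hTU hT hdisj
    push_cast at hN
    obtain ⟨b, S, hS, hS₀, hTS, hSU, hSR, hpath⟩ := ih hTU.2 hT.2
      (fun g hg g' hg' => (hdisj.2 g hg).2 g' hg') (by nlinarith)
    have hSg : Disjoint S (T g) := by
      rw [Finset.disjoint_left]
      intro x hx hx'
      have := hSU (Finset.mem_inter.2 ⟨hx, hTU.1 hx'⟩)
      obtain ⟨g', hg', hx''⟩ := Finset.mem_biUnion.1 this
      exact Finset.disjoint_left.1 (hdisj.1.2 g' hg' (fun h => hg (h ▸ hg'))) hx' hx''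
    obtain ⟨u, z, v, h1, h2, huz, huv, hzv, huzvR, hu, hz, hv⟩ := hR b (s g) (S ∪ U) (by
      have h1 : ((S ∪ U) ∩ R).card ≤ (S ∩ R).card + (U ∩ R).card := by
        rw [Finset.union_inter_distrib_right]
        exact Finset.card_union_le _ _
      have h2 : (((S ∪ U) ∩ R).card : ℝ) ≤ (S₀ ∩ R).card + (m + 3) * 𝒢.card + (U ∩ R).card := by
        exact_mod_cast h1.trans (by omega)
      linarith)
    simp only [Finset.mem_union, not_or] at hu hz hv
    have hTg : ∀ w, w ∉ U → w ∉ T g := fun w hw hw' => hw (hTU.1 hw')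
    refine ⟨t g, S ∪ T g ∪ {u, z, v}, ?_, ?_, ?_, ?_, ?_, ?_⟩
    · have h3 : (S ∪ T g ∪ {u, z, v}) ∩ R ⊆ (S ∩ R) ∪ (T g ∩ R) ∪ {u, z, v} := by
        intro x
        simp only [Finset.mem_union, Finset.mem_inter]
        tauto
      have h4 := Finset.card_le_card h3
      have h5 := Finset.card_union_le (S ∩ R ∪ T g ∩ R) {u, z, v}
      have h6 := Finset.card_union_le (S ∩ R) (T g ∩ R)
      have h7 : ({u, z, v} : Finset V).card ≤ 3 := Finset.card_le_three
      have := hT.1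
      nlinarith
    · exact hS₀.trans (Finset.subset_union_left.trans Finset.subset_union_left)
    · simp only [Finset.mem_insert, forall_eq_or_imp]
      exact ⟨Finset.subset_union_right.trans Finset.subset_union_left, fun g' hg' =>
        (hTS g' hg').trans (Finset.subset_union_left.trans Finset.subset_union_left)⟩
    · intro x hx
      simp only [Finset.mem_inter, Finset.mem_union, Finset.mem_insert, Finset.mem_singleton] at hx
      rw [Finset.biUnion_insert, Finset.mem_union]
      obtain ⟨(hx1 | hx1) | hx1, hx2⟩ := hx
      · exact Or.inr (hSU (Finset.mem_inter.2 ⟨hx1, hx2⟩))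
      · exact Or.inl hx1
      · rcases hx1 with rfl | rfl | rfl <;> tauto
    · rw [Finset.biUnion_insert]
      intro x hx
      simp only [Finset.mem_union] at hx ⊢
      rcases hx with (hx | hx) | hx
      · have := hSR hx
        simp only [Finset.mem_union] at this
        tauto
      · tauto
      · exact Or.inr (huzvR hx)
    · intro W φ hW hWS hWφ hφ hφS hφφ
      simp only [Finset.mem_insert, forall_eq_or_imp] at hWφ hφ hφS hφφ
      simp only [Finset.disjoint_union_right] at hWS hφS
      have h3 := hpath W φ hW hWS.1.1 hWφ.2 hφ.2 (fun g' hg' => (hφS.2 g' hg').1.1)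
        fun g hg g' hg' => (hφφ.2 g hg).2 g' hg'
      have hbad : ∀ w ∈ ({u, z, v} : Finset V), w ∉ S → w ∉ U →
          w ∉ S ∪ W ∪ 𝒢.biUnion φ ∪ (T g ∪ φ g) := by
        intro w hw hwS hwU hmem
        simp only [Finset.mem_union, Finset.mem_biUnion] at hmem
        rcases hmem with ((h | h) | ⟨g', hg', h⟩) | h | h
        · exact hwS h
        · exact Finset.disjoint_left.1 hWS.2 h hw
        · exact Finset.disjoint_left.1 (hφS.2 g' hg').2 h hw
        · exact hTg w hwU h
        · exact Finset.disjoint_left.1 hφS.1.2 h hw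
      have h4 := h3.append hφ.1 h1 h2 ?_ (hbad u (by simp) hu.1 hu.2) (hbad z (by simp) hz.1 hz.2)
        (hbad v (by simp) hv.1 hv.2) huz huv hzv
      · have h5 : S ∪ T g ∪ {u, z, v} ∪ W ∪ (insert g 𝒢).biUnion φ =
            S ∪ W ∪ 𝒢.biUnion φ ∪ (T g ∪ φ g) ∪ {u, z, v} := by
          rw [Finset.biUnion_insert]
          ac_rfl
        rw [h5]
        exact h4
      · have h5 : Disjoint (𝒢.biUnion φ) (T g ∪ φ g) := by
          rw [Finset.disjoint_biUnion_left]
          intro g' hg'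
          rw [Finset.disjoint_union_right]
          exact ⟨(hφS.2 g' hg').1.2, ((hφφ.1.2 g' hg') fun h => hg (h ▸ hg')).symm⟩
        have h6 : Disjoint W (T g ∪ φ g) := Finset.disjoint_union_right.2 ⟨hWS.1.2, hWφ.1⟩
        have h7 : Disjoint S (T g ∪ φ g) := Finset.disjoint_union_right.2 ⟨hSg, hφS.1.1.1.symm⟩
        exact Finset.disjoint_union_left.2 ⟨Finset.disjoint_union_left.2 ⟨h7, h6⟩, h5⟩

theorem exists_pairing {ι : Type*} (P : V → V → ι → Prop) (𝒢 : Finset ι) {K : ℕ}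
    (hK : ∀ x y, K ≤ (𝒢.filter (P x y)).card) (j : ℕ) (hj : j ≤ K) (W : Finset V)
    (hW : W.card = 2 * j) :
    ∃ φ : ι → Finset V, (∀ g, φ g = ∅ ∨ g ∈ 𝒢 ∧ ∃ x y, x ≠ y ∧ φ g = {x, y} ∧ P x y g) ∧
      (∀ g g', g ≠ g' → Disjoint (φ g) (φ g')) ∧ 𝒢.biUnion φ = W ∧
      (𝒢.filter fun g => φ g ≠ ∅).card ≤ j := by
  induction j generalizing W with
  | zero =>
    rw [mul_zero, Finset.card_eq_zero] at hW
    subst hW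
    exact ⟨fun _ => ∅, by simp, by simp, by ext; simp, by simp⟩
  | succ j ih =>
    obtain ⟨x, hx, y, hy, hxy⟩ := Finset.one_lt_card.1 (show 1 < W.card by omega)
    have hsub : ({x, y} : Finset V) ⊆ W := by
      rw [Finset.insert_subset_iff, Finset.singleton_subset_iff]
      exact ⟨hx, hy⟩
    obtain ⟨φ, h1, h2, h3, h4⟩ := ih (by omega) (W \ {x, y}) (by
      rw [Finset.card_sdiff_of_subset hsub, Finset.card_pair hxy]
      omega)
    obtain ⟨g, hg, hg'⟩ := Finset.exists_mem_notMem_of_card_lt_card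
      (show (𝒢.filter fun g => φ g ≠ ∅).card < (𝒢.filter (P x y)).card by
        have := hK x y
        omega)
    have hgφ : φ g = ∅ := by
      by_contra hcon
      exact hg' (Finset.mem_filter.2 ⟨(Finset.mem_filter.1 hg).1, hcon⟩)
    rw [Finset.mem_filter] at hg
    have hφW : ∀ g', Disjoint (φ g') {x, y} := by
      intro g'
      rcases h1 g' with h | ⟨h, -⟩
      · rw [h]
        exact Finset.disjoint_empty_left _
      · have := Finset.subset_biUnion_of_mem φ h
        rw [h3] at this
        exact Finset.disjoint_of_subset_left this Finset.sdiff_disjoint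
    have hup : ∀ g', g' ∈ 𝒢.erase g → Function.update φ g {x, y} g' = φ g' := fun g' hg' =>
      Function.update_of_ne (Finset.mem_erase.1 hg').1 _ _
    refine ⟨Function.update φ g {x, y}, fun g' => ?_, fun g₁ g₂ hne => ?_, ?_, ?_⟩
    · by_cases h : g' = g
      · subst h
        exact Or.inr ⟨hg.1, x, y, hxy, by simp, hg.2⟩
      · simpa [h] using h1 g'
    · by_cases h : g₁ = g
      · subst h
        simpa [hne.symm] using (hφW g₂).symm
      · by_cases h' : g₂ = g
        · subst h'
          simpa [hne] using hφW g₁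
        · simpa [h, h'] using h2 g₁ g₂ hne
    · rw [← Finset.insert_erase hg.1, Finset.biUnion_insert, Finset.biUnion_congr rfl hup,
        Function.update_self]
      rw [← Finset.insert_erase hg.1, Finset.biUnion_insert, hgφ, Finset.empty_union] at h3
      rw [h3, Finset.union_sdiff_of_subset hsub]
    · have h5 : (𝒢.filter fun g' => Function.update φ g {x, y} g' ≠ ∅) ⊆
          insert g (𝒢.filter fun g => φ g ≠ ∅) := by
        intro g' hg'
        rw [Finset.mem_filter] at hg'
        by_cases h : g' = g
        · simp [h]
        · rw [Function.update_of_ne h] at hg'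
          exact Finset.mem_insert_of_mem (Finset.mem_filter.2 hg')
      exact (Finset.card_le_card h5).trans ((Finset.card_insert_le _ _).trans (by omega))

/-- A short path which can absorb every small even set of vertices. -/
theorem exists_absorbing {η : ℝ} (hη : 0 < η) : ∃ κ : ℝ, 0 < κ ∧ ∃ n₀ : ℕ, ∀ (V : Type) [Fintype V],
    n₀ ≤ Fintype.card V → ∀ E : V → V → V → Prop, (∀ x y z, E x y z → E y x z) →
    (∀ x y z, E x y z → E x z y) →
    (∀ v, 7 / 16 * (Fintype.card V : ℝ) ^ 2 ≤ ∑ x, ((Finset.univ.filter (E v x)).card : ℝ)) →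
    ∃ a b, ∃ S : Finset V, (S.card : ℝ) ≤ η * Fintype.card V ∧ ∀ W : Finset V, Disjoint W S →
      Even W.card → (W.card : ℝ) ≤ κ * Fintype.card V → LoosePath E a b (S ∪ W) := by
  set c : ℝ := 1 / 10 ^ 7 with hc
  have hc0 : 0 < c := by positivity
  set β : ℝ := min (c / 200) (η / 50) with hβ
  have hβ0 : 0 < β := by positivity
  have hβ1 : β ≤ c / 200 := min_le_left _ _
  have hβ2 : β ≤ η / 50 := min_le_right _ _
  obtain ⟨κ, hκ, n₀, hn₀⟩ := exists_selection (c := c) (β := β) (k := 19) hc0 (by norm_num [hc]) hβ0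
    (by norm_num) (by push_cast; linarith)
  refine ⟨κ, hκ, max n₀ ⌈20 / β⌉₊, fun V _ hn E h12 h23 hD => ?_⟩
  obtain ⟨𝒢, h𝒢, hG, hdisj, hcount⟩ := hn₀ V (le_trans (le_max_left _ _) hn)
    (fun i => IsGadget E i.1 i.2) (fun i => manyList_isGadget h12 h23 hD _ _) ∅ (by
      simp only [Finset.card_empty, Nat.cast_zero]; positivity)
  set n : ℝ := ((Fintype.card V : ℕ) : ℝ) with hndef
  have hnβ : 20 ≤ β * n := by
    have h1 : (⌈20 / β⌉₊ : ℝ) ≤ n := by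
      rw [hndef]
      exact_mod_cast le_trans (le_max_right _ _) hn
    have h2 := (Nat.le_ceil (20 / β)).trans h1
    rw [div_le_iff₀ hβ0] at h2
    linarith
  have hn0 : 0 < n := by
    by_contra! hcon
    nlinarith
  set U := 𝒢.biUnion List.toFinset with hU
  have hUcard : (U.card : ℝ) ≤ 19 * (β * n) := by
    have h1 : U.card ≤ 𝒢.card * 19 := Finset.card_biUnion_le_card_mul _ _ _ fun g hg =>
      (List.toFinset_card_le g).trans (hG g hg).1.le
    have h2 : (U.card : ℝ) ≤ 𝒢.card * 19 := by exact_mod_cast h1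
    linarith
  have hβn : β * n ≤ c / 200 * n := by gcongr
  have hcn : c * n ≤ n := by nlinarith [show c ≤ 1 by norm_num [hc]]
  obtain ⟨r, hr⟩ : ∃ r, r ∉ U := by
    by_contra! hcon
    have : U = Finset.univ := Finset.eq_univ_iff_forall.2 hcon
    rw [this, Finset.card_univ] at hUcard
    linarith
  have hst : ∀ g : List V, ∃ s t, g ∈ 𝒢 → LoosePath E s t g.toFinset ∧
      ∀ x y, IsGadget E x y g → x ≠ y → x ∉ g → y ∉ g →
      LoosePath E s t (g.toFinset ∪ {x, y}) := by
    intro g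
    by_cases hg : g ∈ 𝒢
    · obtain ⟨s, t, h⟩ := gadget_loosePath h12 h23 (hG g hg).2.1 (hG g hg).2.2.2
      exact ⟨s, t, fun _ => h⟩
    · exact ⟨r, r, fun h => absurd h hg⟩
  choose s t hst using hst
  obtain ⟨b, S, hS, hrS, hTS, -, -, hpath⟩ := (linkedIn_univ h12 h23 hD).exists_chain
    List.toFinset s t (m := 19) (U := U) (S₀ := {r}) r r (by simpa using hr) 𝒢
    (fun g hg => Finset.subset_biUnion_of_mem List.toFinset hg)
    (fun g hg => (Finset.card_le_card Finset.inter_subset_left).trans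
      ((List.toFinset_card_le g).trans (hG g hg).1.le)) hdisj (by
      simp only [Finset.inter_univ, Finset.card_singleton]
      rw [← hndef, ← hc]
      push_cast
      linarith)
  simp only [Finset.inter_univ, Finset.card_singleton] at hS
  refine ⟨r, b, S, ?_, fun W hWS hWe hW => ?_⟩
  · have h1 : (S.card : ℝ) ≤ 1 + (19 + 3) * 𝒢.card := by exact_mod_cast hS
    have h2 : β * n ≤ η / 50 * n := by gcongr
    linarith
  · obtain ⟨j, hj⟩ := hWe
    obtain ⟨φ, h1, h2, h3, -⟩ := exists_pairing (fun x y g => IsGadget E x y g) 𝒢 (K := j)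
      (fun x y => by
        have h1 := hcount (x, y)
        have h2 : (W.card : ℝ) = j + j := by rw [hj]; push_cast; ring
        have h3 : (j : ℝ) ≤ ((𝒢.filter fun g => IsGadget E x y g).card : ℝ) := by
          refine le_trans ?_ h1
          have : (0 : ℝ) ≤ j := Nat.cast_nonneg _
          linarith
        exact_mod_cast h3) j le_rfl W (by omega)
    have hφS : ∀ g ∈ 𝒢, Disjoint (φ g) S := fun g hg =>
      Finset.disjoint_of_subset_left (h3 ▸ Finset.subset_biUnion_of_mem φ hg) hWS
    have := hpath ∅ φ (by simpa using LoosePath.single r) (Finset.disjoint_empty_left _)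
      (fun _ _ => Finset.disjoint_empty_left _) (fun g hg => ?_) hφS
      fun g _ g' _ hne => h2 g g' hne
    · rwa [Finset.union_empty, h3] at this
    · rcases h1 g with h | ⟨-, x, y, hxy, h, hgad⟩
      · rw [h, Finset.union_empty]
        exact (hst g hg).1
      · have h5 := hφS g hg
        rw [h, Finset.disjoint_left] at h5
        rw [h]
        refine (hst g hg).2 x y hgad hxy (fun hx => ?_) fun hy => ?_
        · exact h5 (by simp) (hTS g hg (List.mem_toFinset.2 hx))
        · exact h5 (by simp) (hTS g hg (List.mem_toFinset.2 hy))

end Absorbing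

section WeightedPath

open scoped Classical

variable {V : Type*} {E : V → V → V → Prop}

theorem card_filter_mul_le {t η : ℝ} (ht : 0 ≤ t) (hη : 0 < η) (K : ℕ) :
    (((Finset.range K).filter fun j : ℕ => (j + 1) * η ≤ t).card : ℝ) ≤ t / η := by
  have h1 : ((Finset.range K).filter fun j : ℕ => (j + 1) * η ≤ t) ⊆
      Finset.range ⌊t / η⌋₊ := by
    intro j hj
    rw [Finset.mem_filter] at hj
    rw [Finset.mem_range, Nat.lt_iff_add_one_le, Nat.le_floor_iff (by positivity),
      le_div_iff₀ hη]
    exact_mod_cast hj.2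
  calc _ ≤ ((Finset.range ⌊t / η⌋₊).card : ℝ) := by exact_mod_cast Finset.card_le_card h1
    _ ≤ _ := by
      rw [Finset.card_range]
      exact Nat.floor_le (by positivity)

/-- Few pairs have a sum of weights which is much larger than four times the average weight. -/
theorem card_heavy_pairs_le (U : Finset V) (z : V → ℝ) (hz : ∀ x, 0 ≤ z x) {S : ℝ} (hS : 0 < S)
    (hsum : ∑ x ∈ U, z x ≤ U.card * S) {J : ℕ} (hJ : 0 < J) :
    (((U ×ˢ U).filter fun p => 4 * (1 + 1 / (2 * J)) * S ≤ z p.1 + z p.2).card : ℝ) ≤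
      7 / 16 * (U.card : ℝ) ^ 2 := by
  have hJ' : (0 : ℝ) < J := by exact_mod_cast hJ
  set η : ℝ := 2 * S / J with hη
  have hη0 : 0 < η := by positivity
  set p : ℕ → ℝ := fun j => ((U.filter fun x => j * η ≤ z x).card : ℝ) with hp
  have h1 : ∑ j ∈ Finset.range (J + J), p (j + 1) ≤ U.card * J / 2 := by
    have h2 : ∑ j ∈ Finset.range (J + J), p (j + 1) = ∑ x ∈ U,
        (((Finset.range (J + J)).filter fun j : ℕ => (j + 1) * η ≤ z x).card : ℝ) := by
      have := Finset.sum_card_bipartiteAbove_eq_sum_card_bipartiteBelow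
        (s := Finset.range (J + J)) (t := U) (fun (j : ℕ) x => (j + 1) * η ≤ z x)
      simp only [hp, Nat.cast_add, Nat.cast_one]
      exact_mod_cast this
    rw [h2]
    calc _ ≤ ∑ x ∈ U, z x / η := Finset.sum_le_sum fun x _ => card_filter_mul_le (hz x) hη0 _
      _ = (∑ x ∈ U, z x) / η := by rw [Finset.sum_div]
      _ ≤ U.card * S / η := by gcongr
      _ = _ := by rw [hη]; field_simp
  obtain ⟨j, hj, hjp⟩ : ∃ j < J, p (j + 1) + p (2 * J - j) ≤ U.card / 2 := by
    by_contra! hcon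
    rw [Finset.sum_range_add, ← Finset.sum_range_reflect (fun x => p (J + x + 1)),
      ← Finset.sum_add_distrib] at h1
    have h3 : ∑ j ∈ Finset.range J, ((U.card : ℝ) / 2) <
        ∑ j ∈ Finset.range J, (p (j + 1) + p (J + (J - 1 - j) + 1)) := by
      refine Finset.sum_lt_sum_of_nonempty (by simpa using hJ.ne') fun j hj => ?_
      have h4 := hcon j (Finset.mem_range.1 hj)
      have h5 : J + (J - 1 - j) + 1 = 2 * J - j := by
        have := Finset.mem_range.1 hj
        omega
      rwa [h5]
    simp only [Finset.sum_const, Finset.card_range, nsmul_eq_mul] at h3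
    linarith
  set P := U.filter fun x => ((j + 1 : ℕ) : ℝ) * η ≤ z x with hP
  set Q := U.filter fun x => ((2 * J - j : ℕ) : ℝ) * η ≤ z x with hQ
  have hQP : Q ⊆ P := by
    intro x hx
    rw [hQ, Finset.mem_filter] at hx
    rw [hP, Finset.mem_filter]
    refine ⟨hx.1, le_trans ?_ hx.2⟩
    gcongr
    omega
  have hsub : ((U ×ˢ U).filter fun p => 4 * (1 + 1 / (2 * J)) * S ≤ z p.1 + z p.2) ⊆
      P ×ˢ P ∪ (Q ×ˢ (U \ P) ∪ (U \ P) ×ˢ Q) := by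
    have h6 : 4 * (1 + 1 / (2 * J)) * S = ((j + 1 : ℕ) : ℝ) * η + ((2 * J - j : ℕ) : ℝ) * η := by
      rw [Nat.cast_sub (by omega), hη]
      push_cast
      field_simp
      ring
    intro ⟨x, y⟩ hxy
    simp only [Finset.mem_filter, Finset.mem_product, h6] at hxy
    simp only [Finset.mem_union, Finset.mem_product, Finset.mem_sdiff]
    by_cases hx : x ∈ P <;> by_cases hy : y ∈ P
    · exact Or.inl ⟨hx, hy⟩
    · refine Or.inr (Or.inl ⟨?_, hxy.1.2, hy⟩)
      simp only [hP, hQ, Finset.mem_filter, not_and, not_le] at hy ⊢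
      exact ⟨hxy.1.1, by linarith [hy hxy.1.2]⟩
    · refine Or.inr (Or.inr ⟨⟨hxy.1.1, hx⟩, ?_⟩)
      simp only [hP, hQ, Finset.mem_filter, not_and, not_le] at hx ⊢
      exact ⟨hxy.1.2, by linarith [hx hxy.1.1]⟩
    · exfalso
      have : Q ⊆ P := hQP
      simp only [hP, Finset.mem_filter, not_and, not_le] at hx hy
      have h7 : ((j + 1 : ℕ) : ℝ) * η ≤ ((2 * J - j : ℕ) : ℝ) * η := by
        gcongr
        omega
      linarith [hx hxy.1.1, hy hxy.1.2]
  have h8 : (((U ×ˢ U).filter fun p => 4 * (1 + 1 / (2 * J)) * S ≤ z p.1 + z p.2).card : ℝ) ≤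
      P.card * P.card + (Q.card * (U \ P).card + (U \ P).card * Q.card) := by
    have := (Finset.card_le_card hsub).trans ((Finset.card_union_le _ _).trans
      (Nat.add_le_add_left (Finset.card_union_le _ _) _))
    simp only [Finset.card_product] at this
    exact_mod_cast this
  have h9 : ((U \ P).card : ℝ) = U.card - P.card := by
    rw [Finset.card_sdiff_of_subset (Finset.filter_subset _ _),
      Nat.cast_sub (Finset.card_le_card (Finset.filter_subset _ _))]
  have h10 : (Q.card : ℝ) ≤ P.card := by exact_mod_cast Finset.card_le_card hQP
  have h11 : (P.card : ℝ) + Q.card ≤ U.card / 2 := hjp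
  have h12 : (0 : ℝ) ≤ Q.card := Nat.cast_nonneg _
  rw [h9] at h8
  refine h8.trans ?_
  generalize (P.card : ℝ) = a at *
  generalize (Q.card : ℝ) = b at *
  generalize (U.card : ℝ) = N at *
  rcases le_total a (N / 4) with h | h
  · nlinarith
  · have h13 : b * (N - a) ≤ (N / 2 - a) * (N - a) := by
      apply mul_le_mul_of_nonneg_right <;> linarith
    nlinarith

theorem exists_lightest (U : Finset V) (w : V → ℝ) (k : ℕ) (hk : k ≤ U.card) :
    ∃ X ⊆ U, X.card = k ∧ ∀ x ∈ X, ∀ y ∈ U \ X, w x ≤ w y := by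
  induction k with
  | zero => exact ⟨∅, by simp, rfl, by simp⟩
  | succ k ih =>
    obtain ⟨X, hXU, hX, hle⟩ := ih (by omega)
    have hne : (U \ X).Nonempty := by
      rw [← Finset.card_pos, Finset.card_sdiff_of_subset hXU]
      omega
    obtain ⟨v, hv, hmin⟩ := Finset.exists_min_image (U \ X) w hne
    rw [Finset.mem_sdiff] at hv
    refine ⟨insert v X, Finset.insert_subset hv.1 hXU,
      by rw [Finset.card_insert_of_notMem hv.2, hX], fun x hx y hy => ?_⟩
    have hy' : y ∈ U \ X := by
      simp only [Finset.mem_sdiff, Finset.mem_insert, not_or] at hy ⊢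
      tauto
    rcases Finset.mem_insert.1 hx with rfl | hx
    · exact hmin y hy'
    · exact hle x hx y hy'

theorem exists_minDegree (R : V → V → Prop) (hR : ∀ x y, R x y → R y x) (d : ℝ) (Y : Finset V)
    (h : 2 * d * Y.card < (((Y ×ˢ Y).filter fun p => R p.1 p.2).card : ℝ)) :
    ∃ Y' ⊆ Y, Y'.Nonempty ∧ ∀ x ∈ Y', d ≤ ((Y'.filter (R x)).card : ℝ) := by
  induction hm : Y.card generalizing Y with
  | zero =>
    rw [Finset.card_eq_zero] at hm
    subst hm
    simp at h
  | succ m ih =>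
    by_cases hall : ∀ x ∈ Y, d ≤ ((Y.filter (R x)).card : ℝ)
    · exact ⟨Y, subset_rfl, Finset.card_pos.1 (by omega), hall⟩
    · push Not at hall
      obtain ⟨x, hx, hlt⟩ := hall
      have key : 2 * d * ((Y.erase x).card : ℝ) <
          (((Y.erase x ×ˢ Y.erase x).filter fun p => R p.1 p.2).card : ℝ) := by
        have hsub : ((Y ×ˢ Y).filter fun p => R p.1 p.2) ⊆
            ((Y.erase x ×ˢ Y.erase x).filter fun p => R p.1 p.2) ∪
            ((Y.filter (R x)).image (fun y => (x, y)) ∪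
              (Y.filter (R x)).image (fun y => (y, x))) := by
          intro ⟨a, b⟩ hab
          simp only [Finset.mem_filter, Finset.mem_product, Finset.mem_union, Finset.mem_erase,
            Finset.mem_image, Prod.mk.injEq] at hab ⊢
          by_cases ha : a = x
          · subst ha
            exact Or.inr (Or.inl ⟨b, ⟨hab.1.2, hab.2⟩, rfl, rfl⟩)
          · by_cases hb : b = x
            · subst hb
              exact Or.inr (Or.inr ⟨a, ⟨hab.1.1, hR _ _ hab.2⟩, rfl, rfl⟩)
            · exact Or.inl ⟨⟨⟨ha, hab.1.1⟩, hb, hab.1.2⟩, hab.2⟩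
        have h1 := (Finset.card_le_card hsub).trans ((Finset.card_union_le _ _).trans
          (Nat.add_le_add_left ((Finset.card_union_le _ _).trans
            (Nat.add_le_add Finset.card_image_le Finset.card_image_le)) _))
        have h2 : (((Y ×ˢ Y).filter fun p => R p.1 p.2).card : ℝ) ≤
            (((Y.erase x ×ˢ Y.erase x).filter fun p => R p.1 p.2).card : ℝ) +
            (((Y.filter (R x)).card : ℝ) + ((Y.filter (R x)).card : ℝ)) := by exact_mod_cast h1
        have h3 : ((Y.erase x).card : ℝ) = Y.card - 1 := by
          rw [Finset.card_erase_of_mem hx, Nat.cast_sub (by omega)]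
          simp
        rw [h3]
        linarith
      obtain ⟨Y', hY', h'⟩ := ih (Y.erase x) key (by rw [Finset.card_erase_of_mem hx]; omega)
      exact ⟨Y', hY'.trans (Finset.erase_subset _ _), h'⟩

theorem exists_loosePath_of_minDegree (R : V → V → Prop) {X Y : Finset V} (hXY : Disjoint X Y)
    (hY : Y.Nonempty) {j : ℕ} (hdeg : ∀ x ∈ Y, 4 * j + 4 ≤ (Y.filter (R x)).card)
    (hcod : ∀ x ∈ Y, ∀ y ∈ Y, R x y → 4 * j + 4 ≤ (X.filter fun v => E x v y).card)
    {w : V → ℝ} {w₀ θ : ℝ} (hX : ∀ v ∈ X, w v ≤ w₀) (hθ : ∀ x y, R x y → w x + w y ≤ θ)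
    (i : ℕ) (hi : i ≤ j) :
    ∃ a b S, LoosePath E a b S ∧ S ⊆ X ∪ Y ∧ b ∈ Y ∧ S.card = 4 * i + 3 ∧
      ∑ x ∈ S, w x ≤ (2 * i + 1) * w₀ + (i + 1) * θ := by
  have hstep : ∀ (S : Finset V), S.card ≤ 4 * j + 3 → ∀ b ∈ Y, ∃ x ∈ Y, x ∉ S ∧ R b x :=
    fun S hS b hb => by
      obtain ⟨x, hx, hxS⟩ := Finset.exists_mem_notMem_of_card_lt_card
        (show S.card < (Y.filter (R b)).card by have := hdeg b hb; omega)
      rw [Finset.mem_filter] at hx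
      exact ⟨x, hx.1, hxS, hx.2⟩
  have hlink : ∀ (S : Finset V), S.card ≤ 4 * j + 3 → ∀ b ∈ Y, ∀ x ∈ Y, R b x →
      ∃ v ∈ X, v ∉ S ∧ E b v x :=
    fun S hS b hb x hx hbx => by
      obtain ⟨v, hv, hvS⟩ := Finset.exists_mem_notMem_of_card_lt_card
        (show S.card < (X.filter fun v => E b v x).card by have := hcod b hb x hx hbx; omega)
      rw [Finset.mem_filter] at hv
      exact ⟨v, hv.1, hvS, hv.2⟩
  have hne : ∀ v ∈ X, ∀ y ∈ Y, v ≠ y := fun v hv y hy h =>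
    Finset.disjoint_left.1 hXY hv (h ▸ hy)
  induction i with
  | zero =>
    obtain ⟨a, ha⟩ := hY
    obtain ⟨b, hb, hba, hab⟩ := hstep {a} (by simp) a ha
    obtain ⟨v, hv, -, hE⟩ := hlink ∅ (by simp) a ha b hb hab
    have hva := hne v hv a ha
    have hvb := hne v hv b hb
    rw [Finset.mem_singleton] at hba
    refine ⟨a, b, _, (LoosePath.single a).snoc v b hE (by simpa using hva) (by simpa using hba)
      hvb, ?_, hb, ?_, ?_⟩
    · intro x
      simp only [Finset.mem_insert, Finset.mem_singleton, Finset.mem_union]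
      rintro (rfl | rfl | rfl) <;> tauto
    · rw [Finset.card_insert_of_notMem (by simp [hva, hvb]),
        Finset.card_insert_of_notMem (by simpa using hba)]
      simp
    · rw [Finset.sum_insert (by simp [hva, hvb]), Finset.sum_insert (by simpa using hba),
        Finset.sum_singleton]
      have := hX v hv
      have := hθ a b hab
      push_cast
      linarith
  | succ i ih =>
    obtain ⟨a, b, S, hpath, hS, hb, hcard, hsum⟩ := ih (by omega)
    obtain ⟨x, hx, hxS, hbx⟩ := hstep S (by omega) b hb
    obtain ⟨v, hv, hvS, hE⟩ := hlink S (by omega) b hb x hx hbx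
    have hvx := hne v hv x hx
    have h1 := hpath.snoc v x hE hvS hxS hvx
    have hc1 : (insert v (insert x S)).card = 4 * i + 5 := by
      rw [Finset.card_insert_of_notMem (by simp [hvS, hvx]), Finset.card_insert_of_notMem hxS,
        hcard]
    have hs1 : ∑ y ∈ insert v (insert x S), w y = w v + (w x + ∑ y ∈ S, w y) := by
      rw [Finset.sum_insert (by simp [hvS, hvx]), Finset.sum_insert hxS]
    obtain ⟨x', hx', hxS', hxx'⟩ := hstep (insert v (insert x S)) (by omega) x hx
    obtain ⟨v', hv', hvS', hE'⟩ := hlink (insert v (insert x S)) (by omega) x hx x' hx' hxx'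
    have hvx' := hne v' hv' x' hx'
    refine ⟨a, x', _, h1.snoc v' x' hE' hvS' hxS' hvx', ?_, hx', ?_, ?_⟩
    · intro y hy
      simp only [Finset.mem_insert] at hy
      rcases hy with rfl | rfl | rfl | rfl | hy
      · exact Finset.mem_union_left _ hv'
      · exact Finset.mem_union_right _ hx'
      · exact Finset.mem_union_left _ hv
      · exact Finset.mem_union_right _ hx
      · exact hS hy
    · rw [Finset.card_insert_of_notMem (by rw [Finset.mem_insert, not_or]; exact ⟨hvx', hvS'⟩),
        Finset.card_insert_of_notMem hxS', hc1]
      ring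
    · rw [Finset.sum_insert (by rw [Finset.mem_insert, not_or]; exact ⟨hvx', hvS'⟩),
        Finset.sum_insert hxS', hs1]
      have := hX v hv
      have := hX v' hv'
      have := hθ x x' hxx'
      push_cast
      linarith

end WeightedPath

section LightPath

open scoped Classical

theorem sum_card_filter_eq_card_product {V : Type*} (U : Finset V) (P : V → V → Prop) :
    ∑ x ∈ U, ((U.filter (P x)).card : ℝ) = (((U ×ˢ U).filter fun p => P p.1 p.2).card : ℝ) := by
  simp only [Finset.card_filter, Finset.sum_product]
  push_cast
  rfl

/-- If all links have large density, most links are dense also on light pairs outside a small set. -/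
theorem card_light_link {V : Type*} {E : V → V → V → Prop} {U X : Finset V}
    {γ : ℝ} (hX : (X.card : ℝ) ≤ γ / 4 * U.card) {v : V}
    (hD : (7 / 16 + γ) * (U.card : ℝ) ^ 2 ≤ ∑ x ∈ U, ((U.filter (E v x)).card : ℝ))
    {z : V → ℝ} {θ : ℝ}
    (hz : (((U ×ˢ U).filter fun p => θ ≤ z p.1 + z p.2).card : ℝ) ≤ 7 / 16 * (U.card : ℝ) ^ 2) :
    γ / 2 * (U.card : ℝ) ^ 2 ≤ ((((U \ X) ×ˢ (U \ X)).filter fun p =>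
      E v p.1 p.2 ∧ z p.1 + z p.2 ≤ θ).card : ℝ) := by
  rw [sum_card_filter_eq_card_product] at hD
  have hsub : ((U ×ˢ U).filter fun p => E v p.1 p.2) ⊆
      (((U \ X) ×ˢ (U \ X)).filter fun p => E v p.1 p.2 ∧ z p.1 + z p.2 ≤ θ) ∪
      (((U ×ˢ U).filter fun p => θ ≤ z p.1 + z p.2) ∪ (X ×ˢ U ∪ U ×ˢ X)) := by
    intro p hp
    simp only [Finset.mem_filter, Finset.mem_product, Finset.mem_union, Finset.mem_sdiff] at hp ⊢
    rcases le_total (z p.1 + z p.2) θ with h | h <;> tauto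
  have h1 := (Finset.card_le_card hsub).trans ((Finset.card_union_le _ _).trans
    (Nat.add_le_add_left ((Finset.card_union_le _ _).trans
      (Nat.add_le_add_left (Finset.card_union_le _ _) _)) _))
  simp only [Finset.card_product] at h1
  have h2 : (((U ×ˢ U).filter fun p => E v p.1 p.2).card : ℝ) ≤
      ((((U \ X) ×ˢ (U \ X)).filter fun p => E v p.1 p.2 ∧ z p.1 + z p.2 ≤ θ).card : ℝ) +
      ((((U ×ˢ U).filter fun p => θ ≤ z p.1 + z p.2).card : ℝ) +
        (X.card * U.card + U.card * X.card)) := by exact_mod_cast h1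
  have h3 : (X.card : ℝ) * U.card ≤ γ / 4 * U.card * U.card := by gcongr
  nlinarith

theorem card_high_codegree {V : Type*} {E : V → V → V → Prop} {X Y : Finset V} (hX : X.Nonempty)
    {γ N : ℝ} (hγ : 0 ≤ γ) (hY : (Y.card : ℝ) ≤ N) (Q : V → V → Prop)
    (h : ∀ v ∈ X, γ / 2 * N ^ 2 ≤ (((Y ×ˢ Y).filter fun p => E v p.1 p.2 ∧ Q p.1 p.2).card : ℝ)) :
    γ / 4 * N ^ 2 ≤ (((Y ×ˢ Y).filter fun p => Q p.1 p.2 ∧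
      γ / 4 * X.card ≤ ((X.filter fun v => E v p.1 p.2).card : ℝ)).card : ℝ) := by
  have hX0 : (0 : ℝ) < X.card := by exact_mod_cast hX.card_pos
  set R := (Y ×ˢ Y).filter fun p => Q p.1 p.2 ∧
      γ / 4 * X.card ≤ ((X.filter fun v => E v p.1 p.2).card : ℝ) with hR
  have h1 := Finset.sum_le_sum h
  rw [Finset.sum_const, nsmul_eq_mul] at h1
  have h2 : ∑ v ∈ X, (((Y ×ˢ Y).filter fun p => E v p.1 p.2 ∧ Q p.1 p.2).card : ℝ) =
      ∑ p ∈ Y ×ˢ Y, ((X.filter fun v => E v p.1 p.2 ∧ Q p.1 p.2).card : ℝ) := by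
    exact_mod_cast Finset.sum_card_bipartiteAbove_eq_sum_card_bipartiteBelow
        (s := X) (t := Y ×ˢ Y) (fun v p => E v p.1 p.2 ∧ Q p.1 p.2)
  have h3 : ∑ p ∈ Y ×ˢ Y, ((X.filter fun v => E v p.1 p.2 ∧ Q p.1 p.2).card : ℝ) ≤
      ∑ p ∈ Y ×ˢ Y, ((if Q p.1 p.2 ∧
        γ / 4 * X.card ≤ ((X.filter fun v => E v p.1 p.2).card : ℝ) then (X.card : ℝ) else 0) +
          γ / 4 * X.card) := by
    refine Finset.sum_le_sum fun p _ => ?_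
    have h4 : (X.filter fun v => E v p.1 p.2 ∧ Q p.1 p.2).card ≤
        (X.filter fun v => E v p.1 p.2).card :=
      Finset.card_le_card fun v hv => by simp only [Finset.mem_filter] at hv ⊢; tauto
    split_ifs with hp
    · have h5 : ((X.filter fun v => E v p.1 p.2 ∧ Q p.1 p.2).card : ℝ) ≤ X.card := by
        exact_mod_cast Finset.card_filter_le _ _
      have : 0 ≤ γ / 4 * X.card := by positivity
      linarith
    · by_cases hQ : Q p.1 p.2
      · have h6 := not_le.1 fun hcon => hp ⟨hQ, hcon⟩
        have h7 : ((X.filter fun v => E v p.1 p.2 ∧ Q p.1 p.2).card : ℝ) ≤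
          (X.filter fun v => E v p.1 p.2).card := by exact_mod_cast h4
        linarith
      · simp only [hQ, and_false, Finset.filter_false, Finset.card_empty, Nat.cast_zero]
        positivity
  rw [Finset.sum_add_distrib, ← Finset.sum_filter, ← hR, Finset.sum_const, Finset.sum_const,
    nsmul_eq_mul, nsmul_eq_mul, Finset.card_product] at h3
  push_cast at h3
  rw [h2] at h1
  have hN0 : 0 ≤ N := (Nat.cast_nonneg _).trans hY
  have h8 : (Y.card : ℝ) * Y.card ≤ N * N := by gcongr
  have h9 : (Y.card : ℝ) * Y.card * (γ / 4 * X.card) ≤ N * N * (γ / 4 * X.card) := by gcongr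
  have h10 : X.card * (γ / 4 * N ^ 2) ≤ X.card * (R.card : ℝ) := by nlinarith
  exact le_of_mul_le_mul_left h10 hX0

set_option maxHeartbeats 800000 in
/-- In a 3-graph with dense links there are loose paths of any fixed length whose weight
is close to the average. -/
theorem exists_light_loosePath {γ : ℝ} (hγ : 0 < γ) (j : ℕ) : ∃ N₀ : ℕ, ∀ (V : Type)
    (E : V → V → V → Prop), (∀ x y z, E x y z → E y x z) → (∀ x y z, E x y z → E x z y) →
    ∀ U : Finset V, N₀ ≤ U.card →
    (∀ v ∈ U, (7 / 16 + γ) * (U.card : ℝ) ^ 2 ≤ ∑ x ∈ U, ((U.filter (E v x)).card : ℝ)) →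
    ∀ w : V → ℝ, (∀ x ∈ U, 0 ≤ w x) → 0 < ∑ x ∈ U, w x →
    ∃ a b S, LoosePath E a b S ∧ S ⊆ U ∧ S.card = 4 * j + 3 ∧
      (∑ x ∈ S, w x) * U.card ≤ (4 * j + 5) * ∑ x ∈ U, w x := by
  set δ : ℝ := 1 / (12 * (j + 1)) with hδ
  have hδ0 : 0 < δ := by positivity
  set ξ : ℝ := min δ (γ / 4) with hξ
  have hξ0 : 0 < ξ := by positivity
  have hξδ : ξ ≤ δ := min_le_left _ _
  have hξγ : ξ ≤ γ / 4 := min_le_right _ _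
  refine ⟨⌈((4 * j + 4) * 4 / γ + 1) / ξ⌉₊ + ⌈(4 * j + 4) * 9 / γ⌉₊,
    fun V E h12 h23 U hU hD w hw hW => ?_⟩
  have hN1 : ((4 * j + 4) * 4 / γ + 1) / ξ ≤ U.card :=
    (Nat.le_ceil _).trans (by exact_mod_cast le_trans (Nat.le_add_right _ _) hU)
  have hN2 : (4 * j + 4) * 9 / γ ≤ U.card :=
    (Nat.le_ceil _).trans (by exact_mod_cast le_trans (Nat.le_add_left _ _) hU)
  rw [div_le_iff₀ hξ0] at hN1
  rw [div_le_iff₀ hγ] at hN2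
  set N : ℝ := ((U.card : ℕ) : ℝ) with hN
  have hN0 : 0 < N := by
    by_contra! hcon
    nlinarith [(Nat.cast_nonneg j : (0 : ℝ) ≤ j)]
  have hδ1 : δ ≤ 1 / 12 := by
    rw [hδ]
    apply one_div_le_one_div_of_le <;> linarith [(Nat.cast_nonneg j : (0 : ℝ) ≤ j)]
  have hδj : δ * (4 * (j + 1)) = 1 / 3 := by
    rw [hδ]
    field_simp
    norm_num
  have hkN : (⌊ξ * N⌋₊ : ℝ) ≤ ξ * N := Nat.floor_le (by positivity)
  have hkN' : ξ * N - 1 < ⌊ξ * N⌋₊ := Nat.sub_one_lt_floor _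
  obtain ⟨X, hXU, hXk, hXle⟩ := exists_lightest U w ⌊ξ * N⌋₊ (by
    have : (⌊ξ * N⌋₊ : ℝ) ≤ N := by nlinarith
    rw [hN] at this
    exact_mod_cast this)
  rw [← hXk] at hkN hkN'
  have hXpos : (0 : ℝ) < X.card := by
    have : 0 ≤ (4 * (j : ℝ) + 4) * 4 / γ := by positivity
    linarith
  have hXne : X.Nonempty := Finset.card_pos.1 (by exact_mod_cast hXpos)
  obtain ⟨x₀, hx₀, hmax⟩ := Finset.exists_max_image X w hXne
  set w₀ := w x₀ with hw₀
  have hw₀0 : 0 ≤ w₀ := hw _ (hXU hx₀)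
  have hYle : ∀ y ∈ U \ X, w₀ ≤ w y := fun y hy => hXle _ hx₀ y hy
  set W := ∑ x ∈ U, w x with hWdef
  set Y := U \ X with hY
  have hYcard : (Y.card : ℝ) = N - X.card := by
    rw [hY, Finset.card_sdiff_of_subset hXU, Nat.cast_sub (Finset.card_le_card hXU)]
  have hsplit : ∑ x ∈ Y, w x + ∑ x ∈ X, w x = W := Finset.sum_sdiff hXU
  set z : V → ℝ := fun x => max (w x - w₀) 0 with hz
  have hzsum : ∑ x ∈ U, z x ≤ W - (N - X.card) * w₀ := by
    rw [← Finset.sum_sdiff hXU, ← hY]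
    have h1 : ∑ x ∈ X, z x = 0 := Finset.sum_eq_zero fun x hx => by
      simp only [hz]
      exact max_eq_right (by linarith [hmax x hx])
    have h2 : ∑ x ∈ Y, z x = ∑ x ∈ Y, (w x - w₀) := Finset.sum_congr rfl fun x hx => by
      simp only [hz]
      exact max_eq_left (by linarith [hYle x hx])
    rw [h1, h2, Finset.sum_sub_distrib, Finset.sum_const, nsmul_eq_mul, hYcard]
    have : 0 ≤ ∑ x ∈ X, w x := Finset.sum_nonneg fun x hx => hw x (hXU hx)
    linarith
  have hznn : 0 ≤ ∑ x ∈ U, z x := Finset.sum_nonneg fun x _ => le_max_right _ _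
  set μ := W / N with hμ
  have hμ0 : 0 < μ := by positivity
  have hμN : N * μ = W := by rw [hμ]; field_simp
  set S' : ℝ := (W - (N - X.card) * w₀) / N + ξ * μ with hS'
  have hS'0 : 0 < S' := by
    have : 0 ≤ (W - (N - X.card) * w₀) / N := div_nonneg (hznn.trans hzsum) hN0.le
    positivity
  have hS'N : N * S' = W - (N - X.card) * w₀ + ξ * W := by
    rw [hS', ← hμN]
    field_simp
  have hheavy := card_heavy_pairs_le U z (fun x => le_max_right _ _) hS'0 (by
    rw [← hN, hS'N]
    have : 0 ≤ ξ * W := by positivity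
    linarith) (J := 6 * (j + 1)) (by positivity)
  have hδJ : (1 : ℝ) / (2 * ((6 * (j + 1) : ℕ) : ℝ)) = δ := by
    rw [hδ]
    push_cast
    ring_nf
  rw [hδJ] at hheavy
  have hXγ : (X.card : ℝ) ≤ γ / 4 * U.card := by
    rw [← hN]
    exact hkN.trans (by gcongr)
  have hlink := fun v hv => card_light_link hXγ (hD v (hXU hv)) hheavy
  have hcodeg := card_high_codegree hXne hγ.le (N := N) (Y := Y) (by rw [hYcard]; linarith)
    (fun x y => z x + z y ≤ 4 * (1 + δ) * S') hlink
  obtain ⟨R, hR⟩ : ∃ R : V → V → Prop, ∀ x y, R x y ↔ (z x + z y ≤ 4 * (1 + δ) * S' ∧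
    γ / 4 * X.card ≤ ((X.filter fun v => E v x y).card : ℝ)) := ⟨_, fun _ _ => Iff.rfl⟩
  simp only [← hR] at hcodeg
  obtain ⟨Y', hY'Y, hY'ne, hdeg⟩ := exists_minDegree R (by
    intro x y hxy
    obtain ⟨h1, h2⟩ := (hR x y).1 hxy
    refine (hR y x).2 ⟨by linarith, h2.trans ?_⟩
    exact_mod_cast Finset.card_le_card fun v hv => by
      simp only [Finset.mem_filter] at hv ⊢
      exact ⟨hv.1, h23 _ _ _ hv.2⟩) (γ * N / 9) Y (by
    refine lt_of_lt_of_le ?_ hcodeg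
    have h1 : 2 * (γ * N / 9) * (Y.card : ℝ) ≤ 2 * (γ * N / 9) * N := by
      gcongr
      rw [hYcard]
      linarith
    have h2 : 0 < γ * N ^ 2 := by positivity
    nlinarith)
  obtain ⟨a, b, S, hpath, hSsub, -, hScard, hSsum⟩ := exists_loosePath_of_minDegree (E := E)
    R (X := X) (Y := Y') (w := w)
    (w₀ := w₀) (θ := 2 * w₀ + 4 * (1 + δ) * S') (j := j)
    (Finset.disjoint_of_subset_right hY'Y Finset.disjoint_sdiff) hY'ne (fun x hx => by
      have h1 : ((4 * j + 4 : ℕ) : ℝ) ≤ ((Y'.filter (R x)).card : ℝ) := by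
        refine le_trans ?_ (hdeg x hx)
        push_cast
        linarith
      exact_mod_cast h1) (fun x hx y hy hxy => by
      have h1 : ((4 * j + 4 : ℕ) : ℝ) ≤ ((X.filter fun v => E v x y).card : ℝ) := by
        refine le_trans ?_ ((hR x y).1 hxy).2
        have h2 : (4 * (j : ℝ) + 4) * 4 / γ ≤ X.card := by linarith
        rw [div_le_iff₀ hγ] at h2
        push_cast
        linarith
      refine (Nat.cast_le.1 h1).trans (Finset.card_le_card fun v hv => ?_)
      simp only [Finset.mem_filter] at hv ⊢
      exact ⟨hv.1, h12 _ _ _ hv.2⟩) hmax (fun x y hxy => by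
      have h1 : w x - w₀ ≤ z x := le_max_left _ _
      have h2 : w y - w₀ ≤ z y := le_max_left _ _
      linarith [((hR x y).1 hxy).1]) j le_rfl
  refine ⟨a, b, S, hpath, hSsub.trans (Finset.union_subset hXU
    (hY'Y.trans Finset.sdiff_subset)), hScard, ?_⟩
  have h1 : (∑ x ∈ S, w x) * N ≤
      ((2 * j + 1) * w₀ + (j + 1) * (2 * w₀ + 4 * (1 + δ) * S')) * N := by gcongr
  have h2 : ((2 * j + 1) * w₀ + (j + 1) * (2 * w₀ + 4 * (1 + δ) * S')) * N =
      (4 * j + 3) * (w₀ * N) + 4 * (j + 1) * (1 + δ) * (N * S') := by ring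
  rw [h2, hS'N] at h1
  have h3 : (X.card : ℝ) * w₀ ≤ δ * (w₀ * N) := by
    have : (X.card : ℝ) * w₀ ≤ δ * N * w₀ := by
      gcongr
      exact hkN.trans (by gcongr)
    linarith
  have h4 : 0 ≤ w₀ * N := by positivity
  have h5 : ξ * W ≤ δ * W := by gcongr
  have h6 : W - (N - X.card) * w₀ + ξ * W ≤ (1 + δ) * W - (1 - δ) * (w₀ * N) := by linarith
  have h7 : 4 * (j + 1) * (1 + δ) * (W - (N - X.card) * w₀ + ξ * W) ≤
      4 * (j + 1) * (1 + δ) * ((1 + δ) * W - (1 - δ) * (w₀ * N)) := by gcongr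
  have h8 : 4 * (j + 1) * (1 + δ) * ((1 + δ) * W - (1 - δ) * (w₀ * N)) =
      (4 * (j + 1) + 2 * (δ * (4 * (j + 1))) + δ * (δ * (4 * (j + 1)))) * W
        - (4 * (j + 1) - δ * (δ * (4 * (j + 1)))) * (w₀ * N) := by ring
  rw [h8, hδj] at h7
  nlinarith

end LightPath

section Tiling

open scoped Classical

/-- The number of ordered pairs in `U` forming an edge with `v`. -/
noncomputable def linkCard {V : Type*} (E : V → V → V → Prop) (U : Finset V) (v : V) : ℝ :=
  ∑ x ∈ U, ((U.filter (E v x)).card : ℝ)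

theorem linkCard_nonneg {V : Type*} (E : V → V → V → Prop) (U : Finset V) (v : V) :
    0 ≤ linkCard E U v := Finset.sum_nonneg fun _ _ => Nat.cast_nonneg _

theorem linkCard_le_sq {V : Type*} (E : V → V → V → Prop) (U : Finset V) (v : V) :
    linkCard E U v ≤ (U.card : ℝ) ^ 2 := by
  have : linkCard E U v ≤ ∑ x ∈ U, (U.card : ℝ) := Finset.sum_le_sum fun x _ => by
    exact_mod_cast Finset.card_filter_le _ _
  rw [Finset.sum_const, nsmul_eq_mul] at this
  rw [sq]
  exact this

theorem le_linkCard_sdiff {V : Type*} {E : V → V → V → Prop}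
    (h23 : ∀ x y z, E x y z → E x z y) {U S : Finset V} (hS : S ⊆ U) (v : V) :
    linkCard E U v - 2 * ∑ x ∈ S, ((U.filter (E v x)).card : ℝ) ≤ linkCard E (U \ S) v := by
  have h1 : linkCard E U v = ∑ x ∈ U \ S, ((U.filter (E v x)).card : ℝ) +
      ∑ x ∈ S, ((U.filter (E v x)).card : ℝ) := (Finset.sum_sdiff hS).symm
  have h2 : ∑ x ∈ U \ S, ((U.filter (E v x)).card : ℝ) ≤
      ∑ x ∈ U \ S, ((((U \ S).filter (E v x)).card : ℝ) + ((S.filter (E v x)).card : ℝ)) := by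
    refine Finset.sum_le_sum fun x _ => ?_
    have : U.filter (E v x) ⊆ (U \ S).filter (E v x) ∪ S.filter (E v x) := by
      rw [← Finset.filter_union, Finset.sdiff_union_of_subset hS]
    exact_mod_cast (Finset.card_le_card this).trans (Finset.card_union_le _ _)
  have h3 : ∑ x ∈ U \ S, ((S.filter (E v x)).card : ℝ) ≤
      ∑ x ∈ U, ((S.filter (E v x)).card : ℝ) :=
    Finset.sum_le_sum_of_subset_of_nonneg Finset.sdiff_subset fun _ _ _ => Nat.cast_nonneg _
  have h4 : ∑ x ∈ U, ((S.filter (E v x)).card : ℝ) = ∑ x ∈ S, ((U.filter (E v x)).card : ℝ) := by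
    have := Finset.sum_card_bipartiteAbove_eq_sum_card_bipartiteBelow
      (s := U) (t := S) (fun x y => E v x y)
    have h5 : ∀ y, Finset.bipartiteBelow (fun x y => E v x y) U y = U.filter (E v y) := fun y =>
      Finset.filter_congr fun x _ => ⟨h23 _ _ _, h23 _ _ _⟩
    simp only [h5] at this
    exact_mod_cast this
  rw [Finset.sum_add_distrib] at h2
  simp only [linkCard] at *
  linarith

theorem exp_density_step {c L N D D' d : ℝ} (hc : 0 ≤ c) (hL : 1 ≤ L) (hLN : 4 * L ^ 2 ≤ N)
    (hcN : 16 * L ^ 2 * c ≤ N) (hD' : 0 ≤ D') (hDd : D - 2 * d ≤ D') (hd : 0 ≤ d)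
    (hdL : d ≤ L * N) (hD : 0 ≤ D) (hDN : D ≤ N ^ 2) :
    Real.exp (-(c * (D' / (N - L) ^ 2))) ≤ Real.exp (-(c * (D / N ^ 2))) *
      (1 + c * (2 * (d / N ^ 2) - 2 * L * (D / N ^ 3)) + 2 * c / N) := by
  have hN : 0 < N := by nlinarith
  have hNL : 0 < N - L := by nlinarith
  set a := d / N ^ 2 with ha
  set b := D / N ^ 3 with hb
  set p := 1 / N with hp
  have hp0 : 0 < p := by positivity
  have ha0 : 0 ≤ a := by positivity
  have hb0 : 0 ≤ b := by positivity
  have haL : a ≤ L * p := by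
    rw [ha, hp, div_le_iff₀ (by positivity)]
    calc d ≤ L * N := hdL
      _ = _ := by field_simp
  have hbp : b ≤ p := by
    rw [hb, hp, div_le_iff₀ (by positivity)]
    calc D ≤ N ^ 2 := hDN
      _ = _ := by field_simp
  have hLp : 4 * L ^ 2 * p ≤ 1 := by
    rw [hp, mul_one_div, div_le_one hN]
    exact hLN
  have hcp : 16 * L ^ 2 * c * p ≤ 1 := by
    rw [hp, mul_one_div, div_le_one hN]
    exact hcN
  set Y := c * (2 * a - 2 * L * b + 4 * L ^ 2 * p * p) with hY
  have hkey : D / N ^ 2 + 2 * L * b - 2 * a - 4 * L ^ 2 * p * p ≤ D' / (N - L) ^ 2 := by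
    have h1 : (1 + 2 * L * p) / N ^ 2 ≤ 1 / (N - L) ^ 2 := by
      rw [div_le_div_iff₀ (by positivity) (by positivity)]
      have h2 : N - L = N * (1 - L * p) := by rw [hp]; field_simp
      rw [h2, mul_pow]
      have h3 : (1 + 2 * L * p) * (1 - L * p) ^ 2 ≤ 1 := by
        have : 0 ≤ L * p := by positivity
        have : L * p ≤ 1 := by nlinarith
        nlinarith [mul_nonneg (sq_nonneg (L * p)) (by linarith : 0 ≤ 3 - 2 * (L * p))]
      have h4 : 0 < N ^ 2 := by positivity
      nlinarith
    have h5 : D' * ((1 + 2 * L * p) / N ^ 2) ≤ D' * (1 / (N - L) ^ 2) := by gcongr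
    have h6 : (D - 2 * d) * ((1 + 2 * L * p) / N ^ 2) ≤ D' * ((1 + 2 * L * p) / N ^ 2) := by
      gcongr
    have h7 : (D - 2 * d) * ((1 + 2 * L * p) / N ^ 2) =
        D / N ^ 2 + 2 * L * b - 2 * a - 4 * (L * p) * a := by
      rw [ha, hb, hp]
      field_simp
      ring
    have h8 : 4 * (L * p) * a ≤ 4 * (L * p) * (L * p) := by gcongr
    rw [h7] at h6
    have h9 : D' * (1 / (N - L) ^ 2) = D' / (N - L) ^ 2 := mul_one_div _ _
    have h10 : 4 * (L * p) * (L * p) = 4 * L ^ 2 * p * p := by ring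
    linarith
  have hle : -(c * (D' / (N - L) ^ 2)) ≤ -(c * (D / N ^ 2)) + Y := by
    have := mul_le_mul_of_nonneg_left hkey hc
    rw [hY]
    linarith
  have hq : 4 * L ^ 2 * p * p ≤ L * p := by
    have : 4 * L ^ 2 * p * p ≤ 1 * p := by gcongr
    nlinarith
  have hbL : L * b ≤ L * p := by gcongr
  have hLb : 0 ≤ L * b := by positivity
  have hq0 : 0 ≤ 4 * L ^ 2 * p * p := by positivity
  have hYabs : |Y| ≤ c * (4 * (L * p)) := by
    rw [hY, abs_mul, abs_of_nonneg hc]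
    gcongr
    rw [abs_le]
    constructor <;> linarith
  have hY1 : |Y| ≤ 1 := hYabs.trans (by
    have h1 : L * (c * p) ≤ L ^ 2 * (c * p) := by
      have : 0 ≤ c * p := by positivity
      nlinarith [mul_nonneg this (by linarith : 0 ≤ L - 1)]
    have h2 : 0 ≤ L * (c * p) := by positivity
    linarith)
  have hY2 : Y ^ 2 ≤ c * p := by
    have h1 : Y ^ 2 ≤ (c * (4 * (L * p))) ^ 2 := by
      rw [← sq_abs]
      gcongr
    have h2 : (c * (4 * (L * p))) ^ 2 = (16 * L ^ 2 * c * p) * (c * p) := by ring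
    have h3 : (16 * L ^ 2 * c * p) * (c * p) ≤ 1 * (c * p) := by gcongr
    linarith
  have hexp := (abs_le.1 (Real.abs_exp_sub_one_sub_id_le hY1)).2
  calc Real.exp (-(c * (D' / (N - L) ^ 2))) ≤ Real.exp (-(c * (D / N ^ 2)) + Y) :=
        Real.exp_le_exp.2 hle
    _ = Real.exp (-(c * (D / N ^ 2))) * Real.exp Y := Real.exp_add _ _
    _ ≤ _ := by
        gcongr
        have h1 : 2 * c / N = 2 * (c * p) := by rw [hp]; ring
        have h2 : 4 * L ^ 2 * p * (c * p) ≤ 1 * (c * p) := by gcongr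
        rw [h1]
        linarith

/-- The exponential potential measuring how dense the links of `U₀` are inside `U`. -/
noncomputable def linkPotential {V : Type*} (E : V → V → V → Prop) (c : ℝ) (U₀ U : Finset V) : ℝ :=
  ∑ v ∈ U₀, Real.exp (-(c * (linkCard E U v / (U.card : ℝ) ^ 2)))

theorem exists_linkPotential_step {γ : ℝ} (hγ : 0 < γ) (j : ℕ) : ∃ N₀ : ℕ, ∀ (V : Type)
    (E : V → V → V → Prop), (∀ x y z, E x y z → E y x z) → (∀ x y z, E x y z → E x z y) →
    ∀ (U₀ U : Finset V), U ⊆ U₀ → N₀ ≤ U.card →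
    (∀ v ∈ U, (7 / 16 + γ) * (U.card : ℝ) ^ 2 ≤ linkCard E U v) →
    ∀ c : ℝ, 0 ≤ c → 16 * (4 * j + 3) ^ 2 * c ≤ U.card →
    ∃ a b S, LoosePath E a b S ∧ S ⊆ U ∧ S.card = 4 * j + 3 ∧
      linkPotential E c U₀ (U \ S) ≤ linkPotential E c U₀ U * Real.exp (6 * c / U.card) := by
  obtain ⟨N₀, h₀⟩ := exists_light_loosePath hγ j
  refine ⟨N₀ + 4 * (4 * j + 3) ^ 2, fun V E h12 h23 U₀ U hUU hU hD c hc hcN => ?_⟩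
  have hLN : (4 * (4 * j + 3) ^ 2 : ℝ) ≤ U.card := by
    exact_mod_cast le_trans (Nat.le_add_left _ _) hU
  set φ : V → ℝ := fun v => Real.exp (-(c * (linkCard E U v / (U.card : ℝ) ^ 2))) with hφ
  have hφ0 : ∀ v, 0 < φ v := fun v => Real.exp_pos _
  set w : V → ℝ := fun x => ∑ v ∈ U₀, φ v * ((U.filter (E v x)).card : ℝ) with hw
  have hswap : ∀ S : Finset V, ∑ x ∈ S, w x =
      ∑ v ∈ U₀, φ v * ∑ x ∈ S, ((U.filter (E v x)).card : ℝ) := fun S => by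
    simp only [hw, Finset.mul_sum]
    exact Finset.sum_comm
  set N : ℝ := ((U.card : ℕ) : ℝ) with hN
  have hL0 : (1 : ℝ) ≤ 4 * j + 3 := by linarith [(Nat.cast_nonneg j : (0 : ℝ) ≤ j)]
  have hN0 : 0 < N := by nlinarith
  have hUne : U.Nonempty := Finset.card_pos.1 (by rw [hN] at hN0; exact_mod_cast hN0)
  have hWpos : 0 < ∑ x ∈ U, w x := by
    rw [hswap]
    obtain ⟨v, hv⟩ := hUne
    refine Finset.sum_pos' (fun v _ => mul_nonneg (hφ0 v).le (linkCard_nonneg E U v))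
      ⟨v, hUU hv, mul_pos (hφ0 v) (lt_of_lt_of_le ?_ (hD v hv))⟩
    positivity
  obtain ⟨a, b, S, hpath, hSU, hS, hlight⟩ := h₀ V E h12 h23 U (le_trans (Nat.le_add_right _ _) hU)
    hD w (fun x _ => Finset.sum_nonneg fun v _ => mul_nonneg (hφ0 v).le (Nat.cast_nonneg _)) hWpos
  refine ⟨a, b, S, hpath, hSU, hS, ?_⟩
  rw [hswap, hswap, ← hN] at hlight
  set L : ℝ := 4 * j + 3 with hL
  have hSL : (S.card : ℝ) = L := by rw [hS, hL]; push_cast; ring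
  have hcard : ((U \ S).card : ℝ) = N - L := by
    rw [Finset.card_sdiff_of_subset hSU, Nat.cast_sub (Finset.card_le_card hSU), hSL]
  have hDN : ∀ v, linkCard E U v ≤ N ^ 2 := fun v => linkCard_le_sq E U v
  have hstep : linkPotential E c U₀ (U \ S) ≤ ∑ v ∈ U₀, φ v *
      (1 + c * (2 * ((∑ x ∈ S, ((U.filter (E v x)).card : ℝ)) / N ^ 2) -
        2 * L * (linkCard E U v / N ^ 3)) + 2 * c / N) := by
    unfold linkPotential
    rw [hcard]
    refine Finset.sum_le_sum fun v _ => exp_density_step hc hL0 hLN hcN (linkCard_nonneg _ _ _)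
      (le_linkCard_sdiff h23 hSU v) (Finset.sum_nonneg fun _ _ => Nat.cast_nonneg _) ?_
      (linkCard_nonneg _ _ _) (hDN v)
    rw [← hSL, ← nsmul_eq_mul]
    exact Finset.sum_le_card_nsmul _ _ _ fun x _ => by
      rw [hN]
      exact_mod_cast Finset.card_filter_le _ _
  have hsum : ∑ v ∈ U₀, φ v *
      (1 + c * (2 * ((∑ x ∈ S, ((U.filter (E v x)).card : ℝ)) / N ^ 2) -
        2 * L * (linkCard E U v / N ^ 3)) + 2 * c / N) =
      (1 + 2 * c / N) * ∑ v ∈ U₀, φ v +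
        2 * c / N ^ 2 * (∑ v ∈ U₀, φ v * ∑ x ∈ S, ((U.filter (E v x)).card : ℝ)) -
        2 * L * c / N ^ 3 * ∑ v ∈ U₀, φ v * linkCard E U v := by
    rw [Finset.mul_sum, Finset.mul_sum, Finset.mul_sum, ← Finset.sum_add_distrib,
      ← Finset.sum_sub_distrib]
    exact Finset.sum_congr rfl fun v _ => by ring
  rw [hsum] at hstep
  set Φ := ∑ v ∈ U₀, φ v with hΦ
  set A := ∑ v ∈ U₀, φ v * ∑ x ∈ S, ((U.filter (E v x)).card : ℝ) with hA
  have hB : ∑ v ∈ U₀, φ v * linkCard E U v ≤ Φ * N ^ 2 := by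
    rw [hΦ, Finset.sum_mul]
    exact Finset.sum_le_sum fun v _ => mul_le_mul_of_nonneg_left (hDN v) (hφ0 v).le
  change A * N ≤ _ * (∑ v ∈ U₀, φ v * linkCard E U v) at hlight
  set B := ∑ v ∈ U₀, φ v * linkCard E U v with hBdef
  have hΦ0 : 0 ≤ Φ := Finset.sum_nonneg fun v _ => (hφ0 v).le
  have h1 : 2 * c / N ^ 2 * A = 2 * c / N ^ 3 * (A * N) := by field_simp
  have h2 : 2 * c / N ^ 3 * (A * N) ≤ 2 * c / N ^ 3 * ((L + 2) * B) := by
    refine mul_le_mul_of_nonneg_left (hlight.trans_eq ?_) (by positivity)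
    rw [hL]
    ring
  have h3 : 4 * c / N ^ 3 * B ≤ 4 * c / N ^ 3 * (Φ * N ^ 2) := by gcongr
  have h4 : 4 * c / N ^ 3 * (Φ * N ^ 2) = 4 * c / N * Φ := by field_simp
  have h5 : 6 * c / N + 1 ≤ Real.exp (6 * c / N) := Real.add_one_le_exp _
  calc linkPotential E c U₀ (U \ S) ≤ (6 * c / N + 1) * Φ := by
        refine hstep.trans ?_
        rw [h1]
        have h6 : 2 * L * c / N ^ 3 * B = L * (2 * c / N ^ 3 * B) := by ring
        have h7 : 2 * c / N ^ 3 * ((L + 2) * B) =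
          L * (2 * c / N ^ 3 * B) + 4 * c / N ^ 3 * B := by ring
        have h8 : 6 * c / N = 2 * c / N + 4 * c / N := by ring
        rw [h8]
        linarith
    _ ≤ Real.exp (6 * c / N) * Φ := by gcongr
    _ = _ := mul_comm _ _

/-- A dense 3-graph can be covered by few loose paths, up to few vertices. -/
theorem exists_tiling {γ ε : ℝ} (hγ : 0 < γ) (hε : 0 < ε) (hε1 : ε ≤ 1) : ∃ n₀ : ℕ, ∀ (V : Type)
    (E : V → V → V → Prop), (∀ x y z, E x y z → E y x z) → (∀ x y z, E x y z → E x z y) →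
    ∀ U₀ : Finset V, n₀ ≤ U₀.card →
    (∀ v ∈ U₀, (7 / 16 + γ) * (U₀.card : ℝ) ^ 2 ≤ linkCard E U₀ v) →
    ∃ 𝒯 : Finset (Finset V), (𝒯.card : ℝ) ≤ ε * U₀.card ∧
      (∀ T ∈ 𝒯, T ⊆ U₀ ∧ ∃ a b, LoosePath E a b T) ∧
      (∀ T ∈ 𝒯, ∀ T' ∈ 𝒯, T ≠ T' → Disjoint T T') ∧
      ((U₀ \ 𝒯.biUnion id).card : ℝ) ≤ 2 * ε * U₀.card := by
  set j : ℕ := ⌈24 / (ε * γ) + 1 / ε⌉₊ with hj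
  set L : ℝ := 4 * j + 3 with hL
  have hjL : 24 / (ε * γ) + 1 / ε ≤ L := (Nat.le_ceil _).trans (by
    rw [hL]
    linarith [(Nat.cast_nonneg j : (0 : ℝ) ≤ j)])
  have hL1 : 24 / (ε * γ) ≤ L := by
    have : 0 ≤ 1 / ε := by positivity
    linarith
  have hL2 : 1 / ε ≤ L := by
    have : 0 ≤ 24 / (ε * γ) := by positivity
    linarith
  rw [div_le_iff₀ (by positivity)] at hL1 hL2
  have hL0 : 0 < L := by positivity
  obtain ⟨N₀, h₀⟩ := exists_linkPotential_step (half_pos hγ) j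
  set c : ℝ := ε / (16 * L ^ 2) with hc
  have hc0 : 0 < c := by positivity
  obtain ⟨n₁, h₁⟩ := exists_mul_pow_lt_exp 1 1 (b := c * γ / 4) (by positivity)
  refine ⟨n₁ + ⌈(N₀ + L) / ε⌉₊ + 1, fun V E h12 h23 U₀ hU₀ hD => ?_⟩
  set n : ℝ := ((U₀.card : ℕ) : ℝ) with hn
  have hnN : (N₀ + L) / ε ≤ n := (Nat.le_ceil _).trans (by
    rw [hn]
    exact_mod_cast (by omega : ⌈(N₀ + L) / ε⌉₊ ≤ U₀.card))
  rw [div_le_iff₀ hε] at hnN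
  have hn0 : 0 < n := by
    rw [hn]
    exact_mod_cast (by omega : 0 < U₀.card)
  have hexp : n < Real.exp (c * γ / 4 * n) := by
    have := h₁ U₀.card (by omega)
    rwa [one_mul, pow_one] at this
  have hmain : ∀ t : ℕ, (t * L ≤ (1 - ε) * n) → ∃ 𝒯 : Finset (Finset V), 𝒯.card = t ∧
      (∀ T ∈ 𝒯, T ⊆ U₀ ∧ ∃ a b, LoosePath E a b T) ∧
      (∀ T ∈ 𝒯, ∀ T' ∈ 𝒯, T ≠ T' → Disjoint T T') ∧
      ((U₀ \ 𝒯.biUnion id).card : ℝ) = n - t * L ∧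
      linkPotential E (c * n) U₀ (U₀ \ 𝒯.biUnion id) ≤
        n * Real.exp (-(c * n * (7 / 16 + γ))) * Real.exp (t * (6 * (c * n) / (ε * n))) := by
    intro t
    induction t with
    | zero =>
      intro _
      refine ⟨∅, rfl, by simp, by simp, by simp [hn], ?_⟩
      simp only [Finset.biUnion_empty, Finset.sdiff_empty, Nat.cast_zero, zero_mul, Real.exp_zero,
        mul_one]
      unfold linkPotential
      rw [hn, ← nsmul_eq_mul]
      refine Finset.sum_le_card_nsmul _ _ _ fun v hv => Real.exp_le_exp.2 (neg_le_neg ?_)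
      rw [← hn]
      refine mul_le_mul_of_nonneg_left ?_ (by positivity)
      rw [le_div_iff₀ (by positivity)]
      exact hD v hv
    | succ t ih =>
      intro ht
      push_cast at ht
      have ht' : t * L ≤ (1 - ε) * n := by linarith
      obtain ⟨𝒯, hcard, hpath, hdisj, hleft, hpot⟩ := ih ht'
      set U := U₀ \ 𝒯.biUnion id with hU
      have hUn : ε * n + L ≤ U.card := by rw [hleft]; linarith
      have hUpos : (0 : ℝ) < U.card := by
        have : 0 < ε * n := by positivity
        linarith
      have hrate : t * (6 * (c * n) / (ε * n)) ≤ c * γ / 4 * n := by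
        have h1 : t * (6 * (c * n) / (ε * n)) = t * 6 * c / ε := by field_simp
        rw [h1, div_le_iff₀ hε]
        have h2 : (t : ℝ) * L ≤ n := by nlinarith
        have h3 : (t : ℝ) * 24 ≤ n * (ε * γ) := by
          have h4 : (t : ℝ) * 24 ≤ t * (L * (ε * γ)) := by gcongr
          have h5 : t * L * (ε * γ) ≤ n * (ε * γ) := by gcongr
          linarith
        have h6 : c * (t * 24) ≤ c * (n * (ε * γ)) := by gcongr
        linarith
      have hdense : ∀ v ∈ U, (7 / 16 + γ / 2) * (U.card : ℝ) ^ 2 ≤ linkCard E U v := by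
        intro v hv
        by_contra! hcon
        have h1 : linkCard E U v / (U.card : ℝ) ^ 2 ≤ 7 / 16 + γ / 2 := by
          rw [div_le_iff₀ (by positivity)]
          exact hcon.le
        have h2 : Real.exp (-(c * n * (7 / 16 + γ / 2))) ≤ linkPotential E (c * n) U₀ U := by
          refine le_trans (Real.exp_le_exp.2 (neg_le_neg ?_))
            (Finset.single_le_sum (f := fun v => Real.exp (-(c * n *
              (linkCard E U v / (U.card : ℝ) ^ 2)))) (fun v _ => (Real.exp_pos _).le)
              (Finset.sdiff_subset hv))
          gcongr
        have h3 : linkPotential E (c * n) U₀ U <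
            Real.exp (c * γ / 4 * n) * Real.exp (-(c * n * (7 / 16 + γ))) *
              Real.exp (c * γ / 4 * n) := by
          refine hpot.trans_lt ?_
          have h4 : Real.exp (t * (6 * (c * n) / (ε * n))) ≤ Real.exp (c * γ / 4 * n) :=
            Real.exp_le_exp.2 hrate
          calc n * Real.exp (-(c * n * (7 / 16 + γ))) * Real.exp (t * (6 * (c * n) / (ε * n))) ≤
              n * Real.exp (-(c * n * (7 / 16 + γ))) * Real.exp (c * γ / 4 * n) := by gcongr
            _ < _ := by gcongr
        rw [← Real.exp_add, ← Real.exp_add] at h3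
        have h5 := Real.exp_lt_exp.1 (h2.trans_lt h3)
        linarith
      have hεn : N₀ ≤ U.card := by
        have : (N₀ : ℝ) ≤ U.card := by linarith
        exact_mod_cast this
      obtain ⟨a, b, S, hS, hSU, hScard, hSpot⟩ := h₀ V E h12 h23 U₀ U Finset.sdiff_subset hεn hdense
        (c * n) (by positivity) (by
          rw [← hL, hc]
          have : 16 * L ^ 2 * (ε / (16 * L ^ 2) * n) = ε * n := by field_simp
          rw [this]
          linarith)
      have hST : ∀ T ∈ 𝒯, Disjoint S T := fun T hT =>
        (Finset.disjoint_of_subset_left hSU Finset.sdiff_disjoint).mono_right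
          (Finset.subset_biUnion_of_mem id hT)
      have hSnot : S ∉ 𝒯 := fun hmem => by
        have := Finset.disjoint_self_iff_empty S |>.1 (hST S hmem)
        rw [this] at hScard
        simp at hScard
      have hUS : U₀ \ (insert S 𝒯).biUnion id = U \ S := by
        rw [Finset.biUnion_insert, hU, sdiff_sdiff_left, Finset.sup_eq_union, id, Finset.union_comm]
      refine ⟨insert S 𝒯, by rw [Finset.card_insert_of_notMem hSnot, hcard], ?_, ?_, ?_, ?_⟩
      · intro T hT
        rcases Finset.mem_insert.1 hT with rfl | hT
        · exact ⟨hSU.trans Finset.sdiff_subset, a, b, hS⟩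
        · exact hpath T hT
      · intro T hT T' hT' hne
        rcases Finset.mem_insert.1 hT with h1 | h1 <;> rcases Finset.mem_insert.1 hT' with h2 | h2
        · exact absurd (h1.trans h2.symm) hne
        · exact h1 ▸ hST _ h2
        · exact h2 ▸ (hST _ h1).symm
        · exact hdisj _ h1 _ h2 hne
      · rw [hUS, Finset.card_sdiff_of_subset hSU, Nat.cast_sub (Finset.card_le_card hSU), hleft,
          hScard, hL]
        push_cast
        ring
      · rw [hUS]
        have h1 : 6 * (c * n) / U.card ≤ 6 * (c * n) / (ε * n) := by
          gcongr
          linarith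
        calc linkPotential E (c * n) U₀ (U \ S) ≤ _ := hSpot
          _ ≤ n * Real.exp (-(c * n * (7 / 16 + γ))) * Real.exp (t * (6 * (c * n) / (ε * n))) *
              Real.exp (6 * (c * n) / (ε * n)) := by gcongr
          _ = _ := by
            rw [mul_assoc, ← Real.exp_add]
            congr 2
            push_cast
            ring
  have hε' : 0 ≤ (1 - ε) * n := mul_nonneg (by linarith) hn0.le
  have hfl := Nat.floor_le (div_nonneg hε' hL0.le)
  have hfl' := Nat.lt_floor_add_one ((1 - ε) * n / L)
  rw [le_div_iff₀ hL0] at hfl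
  rw [div_lt_iff₀ hL0] at hfl'
  obtain ⟨𝒯, hcard, hpath, hdisj, hleft, -⟩ := hmain _ hfl
  refine ⟨𝒯, ?_, hpath, hdisj, ?_⟩
  · rw [hcard]
    have h1 : (⌊(1 - ε) * n / L⌋₊ : ℝ) * 1 ≤ ⌊(1 - ε) * n / L⌋₊ * (L * ε) := by gcongr
    nlinarith
  · rw [hleft]
    have : (0 : ℝ) ≤ N₀ := Nat.cast_nonneg _
    linarith

end Tiling

section Assembly

open scoped Classical

/-- A small set of vertices through which any two vertices can be linked in many ways. -/
theorem exists_reservoir {β : ℝ} (hβ : 0 < β) (hβ1 : β ≤ 1 / 10 ^ 7 / 12) :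
    ∃ κ : ℝ, 0 < κ ∧ ∃ n₀ : ℕ, ∀ (V : Type) [Fintype V], n₀ ≤ Fintype.card V →
    ∀ E : V → V → V → Prop, (∀ x y z, E x y z → E y x z) → (∀ x y z, E x y z → E x z y) →
    (∀ v, 7 / 16 * (Fintype.card V : ℝ) ^ 2 ≤ ∑ x, ((Finset.univ.filter (E v x)).card : ℝ)) →
    ∀ F : Finset V, (F.card : ℝ) ≤ 1 / 10 ^ 7 / 4 * Fintype.card V →
    ∃ R : Finset V, (R.card : ℝ) ≤ 3 * β * Fintype.card V ∧ Disjoint R F ∧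
      LinkedIn E R (κ * Fintype.card V) := by
  obtain ⟨κ, hκ, n₀, h₀⟩ := exists_selection (c := 1 / 10 ^ 7) (β := β) (k := 3) (by norm_num)
    (by norm_num) hβ (by norm_num) (by push_cast; linarith)
  refine ⟨κ / 2, by positivity, n₀ + 1, fun V _ hn E h12 h23 hD F hF => ?_⟩
  obtain ⟨𝒢, hcard, hgood, hdisj, hmany⟩ := h₀ V (by omega) (fun i => IsConnector E i.1 i.2)
    (fun i => manyList_isConnector h12 h23 hD i.1 i.2) F hF
  have hn0 : (0 : ℝ) < Fintype.card V := by exact_mod_cast (by omega : 0 < Fintype.card V)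
  refine ⟨𝒢.biUnion List.toFinset, ?_, ?_, ?_⟩
  · have h1 : (𝒢.biUnion List.toFinset).card ≤ 𝒢.card * 3 :=
      Finset.card_biUnion_le_card_mul _ _ _ fun g hg =>
        (List.toFinset_card_le g).trans (hgood g hg).1.le
    have h2 : ((𝒢.biUnion List.toFinset).card : ℝ) ≤ 𝒢.card * 3 := by exact_mod_cast h1
    linarith
  · exact Finset.disjoint_biUnion_left _ _ _ |>.2 fun g hg => (hgood g hg).2.2.1
  · intro b c F' hF'
    obtain ⟨g, hg, hgF⟩ : ∃ g ∈ 𝒢.filter (IsConnector E b c), Disjoint g.toFinset F' := by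
      by_contra! hcon
      have h1 : (𝒢.filter (IsConnector E b c)).card ≤
          ((𝒢.filter (IsConnector E b c)).biUnion fun g => g.toFinset ∩ F').card := by
        rw [Finset.card_biUnion fun g hg g' hg' hne =>
          (hdisj g (Finset.mem_filter.1 hg).1 g' (Finset.mem_filter.1 hg').1 hne).mono
            Finset.inter_subset_left Finset.inter_subset_left, Finset.card_eq_sum_ones]
        refine Finset.sum_le_sum fun g hg => Finset.card_pos.2 ?_
        rw [Finset.nonempty_iff_ne_empty, ne_eq, ← Finset.disjoint_iff_inter_eq_empty]
        exact hcon g hg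
      have h2 : ((𝒢.filter (IsConnector E b c)).biUnion fun g => g.toFinset ∩ F').card ≤
          (F' ∩ 𝒢.biUnion List.toFinset).card := by
        refine Finset.card_le_card (Finset.biUnion_subset.2 fun g hg x hx => ?_)
        have hx' := Finset.mem_inter.1 hx
        exact Finset.mem_inter.2 ⟨hx'.2, Finset.mem_biUnion.2
          ⟨g, (Finset.mem_filter.1 hg).1, hx'.1⟩⟩
      have h3 : ((𝒢.filter (IsConnector E b c)).card : ℝ) ≤
          (F' ∩ 𝒢.biUnion List.toFinset).card := by exact_mod_cast h1.trans h2
      have h4 : κ * Fintype.card V ≤ ((𝒢.filter (IsConnector E b c)).card : ℝ) := by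
        convert hmany (b, c)
      have h5 : 0 < κ * Fintype.card V := by positivity
      linarith
    obtain ⟨hg𝒢, z, u, v, rfl, h1, h2⟩ := Finset.mem_filter.1 hg
    have hnd := (hgood _ hg𝒢).2.1
    simp only [List.nodup_cons, List.mem_cons, List.not_mem_nil, or_false, not_or,
      not_false_eq_true, List.nodup_nil, and_true] at hnd
    simp only [List.toFinset_cons, Finset.disjoint_insert_left] at hgF
    refine ⟨u, z, v, h1, h2, Ne.symm hnd.1.1, hnd.2, hnd.1.2, ?_, hgF.2.1, hgF.1, hgF.2.2.1⟩
    intro x hx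
    refine Finset.mem_biUnion.2 ⟨_, hg𝒢, ?_⟩
    simp only [Finset.mem_insert, Finset.mem_singleton] at hx
    simp only [List.toFinset_cons, List.toFinset_nil, Finset.mem_insert, Finset.notMem_empty]
    tauto

/-- A 3-graph whose links have density above 7/16 has a loose Hamilton cycle. -/
theorem exists_loose_cycle {γ : ℝ} (hγ : 0 < γ) : ∃ n₀ : ℕ, ∀ (V : Type) [Fintype V],
    n₀ ≤ Fintype.card V → Even (Fintype.card V) →
    ∀ E : V → V → V → Prop, (∀ x y z, E x y z → E y x z) → (∀ x y z, E x y z → E x z y) →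
    (∀ v, (7 / 16 + γ) * (Fintype.card V : ℝ) ^ 2 ≤
      ∑ x, ((Finset.univ.filter (E v x)).card : ℝ)) →
    ∃ f : ℕ → V, Set.InjOn f (Set.Iio (Fintype.card V)) ∧ f (Fintype.card V) = f 0 ∧
      ∀ i < Fintype.card V / 2, E (f (2 * i)) (f (2 * i + 1)) (f (2 * i + 2)) := by
  set η : ℝ := min (1 / 10 ^ 7 / 4) (γ / 8) with hη
  have hη0 : 0 < η := by positivity
  have hη1 : η ≤ 1 / 10 ^ 7 / 4 := min_le_left _ _
  have hη2 : η ≤ γ / 8 := min_le_right _ _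
  obtain ⟨κ, hκ, n₁, h₁⟩ := exists_absorbing hη0
  set β : ℝ := min (1 / 10 ^ 7 / 12) (min (γ / 24) (κ / 12)) with hβ
  have hβ0 : 0 < β := by positivity
  have hβ1 : β ≤ 1 / 10 ^ 7 / 12 := min_le_left _ _
  have hβ2 : β ≤ γ / 24 := (min_le_right _ _).trans (min_le_left _ _)
  have hβ3 : β ≤ κ / 12 := (min_le_right _ _).trans (min_le_right _ _)
  obtain ⟨κ', hκ', n₂, h₂⟩ := exists_reservoir hβ0 hβ1
  set ε : ℝ := min 1 (min (κ / 8) (κ' / 3)) with hε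
  have hε0 : 0 < ε := by positivity
  have hε1 : ε ≤ 1 := min_le_left _ _
  have hε2 : ε ≤ κ / 8 := (min_le_right _ _).trans (min_le_left _ _)
  have hε3 : ε ≤ κ' / 3 := (min_le_right _ _).trans (min_le_right _ _)
  obtain ⟨n₃, h₃⟩ := exists_tiling (half_pos hγ) hε0 hε1
  refine ⟨n₁ + n₂ + 2 * n₃, fun V _ hn heven E h12 h23 hD => ?_⟩
  have hD' : ∀ v, 7 / 16 * (Fintype.card V : ℝ) ^ 2 ≤
      ∑ x, ((Finset.univ.filter (E v x)).card : ℝ) := fun v => le_trans (by gcongr; linarith) (hD v)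
  obtain ⟨a₀, b₀, A, hA, habs⟩ := h₁ V (by omega) E h12 h23 hD'
  obtain ⟨R, hR, hRA, hlink⟩ := h₂ V (by omega) E h12 h23 hD' A (hA.trans (by gcongr))
  have hn3 : 2 * (n₃ : ℝ) ≤ Fintype.card V := by
    exact_mod_cast (by omega : 2 * n₃ ≤ Fintype.card V)
  set n : ℝ := ((Fintype.card V : ℕ) : ℝ) with hnn
  have hn0 : 0 ≤ n := Nat.cast_nonneg _
  have hηn : η * n ≤ 1 / 10 ^ 7 / 4 * n := by gcongr
  have hηγ : η * n ≤ γ / 8 * n := by gcongr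
  have hβn : β * n ≤ 1 / 10 ^ 7 / 12 * n := by gcongr
  have hβγ : β * n ≤ γ / 24 * n := by gcongr
  have hβκ : β * n ≤ κ / 12 * n := by gcongr
  set U : Finset V := Finset.univ \ (A ∪ R) with hU
  have hAR : ((A ∪ R).card : ℝ) ≤ A.card + R.card := by exact_mod_cast Finset.card_union_le _ _
  have hUcard : (U.card : ℝ) = n - (A ∪ R).card := by
    rw [hU, Finset.card_sdiff_of_subset (Finset.subset_univ _),
      Nat.cast_sub (Finset.card_le_card (Finset.subset_univ _)), Finset.card_univ]
  have hUn : (U.card : ℝ) ≤ n := by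
    have : (0 : ℝ) ≤ (A ∪ R).card := Nat.cast_nonneg _
    linarith
  have hUn3 : n₃ ≤ U.card := by
    have : (n₃ : ℝ) ≤ U.card := by linarith
    exact_mod_cast this
  obtain ⟨𝒯, h𝒯card, h𝒯, h𝒯disj, hleft⟩ := h₃ V E h12 h23 U hUn3 (fun v _ => by
    have h1 := le_linkCard_sdiff h23 (Finset.subset_univ (A ∪ R)) v
    have h2 : ∑ x ∈ A ∪ R, ((Finset.univ.filter (E v x)).card : ℝ) ≤ (A ∪ R).card * n := by
      rw [← nsmul_eq_mul]
      refine Finset.sum_le_card_nsmul _ _ _ fun x _ => ?_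
      rw [hnn]
      exact_mod_cast Finset.card_le_univ _
    have h3 : ((A ∪ R).card : ℝ) * n ≤ γ / 4 * n * n := by
      gcongr
      linarith
    have h4 : (7 / 16 + γ / 2) * (U.card : ℝ) ^ 2 ≤ (7 / 16 + γ / 2) * n ^ 2 := by gcongr
    have h5 : (7 / 16 + γ) * n ^ 2 ≤ linkCard E Finset.univ v := hD v
    linarith)
  have hends : ∀ T : Finset V, ∃ a b, T ∈ 𝒯 → LoosePath E a b T := fun T => by
    by_cases hT : T ∈ 𝒯
    · obtain ⟨-, a, b, h⟩ := h𝒯 T hT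
      exact ⟨a, b, fun _ => h⟩
    · exact ⟨a₀, b₀, fun h => absurd h hT⟩
  choose s t hst using hends
  have hUA : Disjoint U A := Finset.sdiff_disjoint.mono_right Finset.subset_union_left
  have hUR : Disjoint U R := Finset.sdiff_disjoint.mono_right Finset.subset_union_right
  have h𝒯n : 3 * (𝒯.card : ℝ) ≤ κ' * n := by
    have h1 : ε * U.card ≤ κ' / 3 * n := by gcongr
    linarith
  obtain ⟨b, S, hSR, hAS, hTS, -, -, hpath⟩ := hlink.exists_chain id s t (m := 0) a₀ b₀ hUA.symm 𝒯
    (fun T hT => (h𝒯 T hT).1)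
    (fun T hT => by
      rw [id, Finset.disjoint_iff_inter_eq_empty.1 (hUR.mono_left (h𝒯 T hT).1), Finset.card_empty])
    h𝒯disj (by
      rw [Finset.disjoint_iff_inter_eq_empty.1 hRA.symm, Finset.disjoint_iff_inter_eq_empty.1 hUR,
        Finset.card_empty]
      push_cast
      linarith)
  have hpath' : ∀ W : Finset V, Even W.card → (W.card : ℝ) ≤ κ * n → Disjoint W S →
      LoosePath E a₀ b (S ∪ W) := fun W hW hWn hWS => by
    have := hpath W (fun _ => ∅) (habs W (hWS.mono_right hAS) hW hWn) hWS (by simp)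
      (fun T hT => by simpa using hst T hT) (by simp) (by simp)
    have hempty : 𝒯.biUnion (fun _ => (∅ : Finset V)) = ∅ := by
      ext
      simp
    rwa [hempty, Finset.union_empty] at this
  have hSodd : Odd S.card := by
    have := (hpath' ∅ (by simp) (by simp; positivity) (by simp)).card_odd
    simpa using this
  rw [Finset.disjoint_iff_inter_eq_empty.1 hRA.symm, Finset.card_empty] at hSR
  obtain ⟨u, z, v, h1, h2, huz, huv, hzv, -, huS, hzS, hvS⟩ := hlink b a₀ S (by
    have : ((S ∩ R).card : ℝ) ≤ 3 * 𝒯.card := by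
      exact_mod_cast hSR.trans (by omega)
    linarith)
  set C : Finset V := insert u (insert z (insert v S)) with hC
  have hCcard : C.card = S.card + 3 := by
    rw [hC, Finset.card_insert_of_notMem (by simp [huz, huv, huS]),
      Finset.card_insert_of_notMem (by simp [hzv, hzS]), Finset.card_insert_of_notMem hvS]
  have hSC : S ⊆ C := fun x hx => by simp [hC, hx]
  have hWsub : Finset.univ \ C ⊆ R ∪ (U \ 𝒯.biUnion id) := by
    intro x hx
    have hxS : x ∉ S := fun h => (Finset.mem_sdiff.1 hx).2 (hSC h)
    by_cases hxR : x ∈ R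
    · exact Finset.mem_union_left _ hxR
    · refine Finset.mem_union_right _ (Finset.mem_sdiff.2 ⟨?_, fun hx𝒯 => ?_⟩)
      · simp only [hU, Finset.mem_sdiff, Finset.mem_univ, true_and, Finset.mem_union, not_or]
        exact ⟨fun h => hxS (hAS h), hxR⟩
      · obtain ⟨T, hT, hxT⟩ := Finset.mem_biUnion.1 hx𝒯
        exact hxS (hTS T hT hxT)
  have hW := hpath' (Finset.univ \ C) (by
    rw [Finset.card_sdiff_of_subset (Finset.subset_univ _), Finset.card_univ, hCcard,
      Nat.even_sub (by rw [← hCcard]; exact Finset.card_le_univ _)]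
    refine iff_of_true heven ?_
    exact hSodd.add_odd (by decide)) (by
    have h3 : ((Finset.univ \ C).card : ℝ) ≤ R.card + (U \ 𝒯.biUnion id).card := by
      exact_mod_cast (Finset.card_le_card hWsub).trans (Finset.card_union_le _ _)
    have h4 : ε * U.card ≤ κ / 8 * n := by gcongr
    have h5 : 0 ≤ κ * n := by positivity
    linarith) (Finset.sdiff_disjoint.mono_right hSC)
  have hnot : ∀ x ∈ C, x ∉ S → x ∉ S ∪ Finset.univ \ C := fun x hx hxS => by simp [hx, hxS]
  have hfinal := hW.snoc u z h1 (hnot u (by simp [hC]) huS) (hnot z (by simp [hC]) hzS) huz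
  refine LoosePath.exists_cycle (v := v) ?_ h2
  convert hfinal using 1
  ext x
  simp only [Finset.mem_sdiff, Finset.mem_univ, true_and, Finset.mem_singleton, Finset.mem_insert,
    Finset.mem_union, hC, not_or]
  by_cases h3 : x = u
  · simp [h3, huv]
  · by_cases h4 : x = z
    · simp [h4, hzv]
    · by_cases h5 : x = v
      · simp [h5, Ne.symm huv, Ne.symm hzv, hvS]
      · by_cases h6 : x ∈ S <;> simp [h3, h4, h5, h6]

end Assembly

theorem two_mul_hdeg_le {V : Type*} [Fintype V] [DecidableEq V] {H : Finset (Finset V)}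
    (h3 : ∀ e ∈ H, e.card = 3) (v : V) :
    2 * hdeg H v ≤ ((Finset.univ ×ˢ Finset.univ : Finset (V × V)).filter
      fun p => ({v, p.1, p.2} : Finset V) ∈ H).card := by
  rw [Finset.card_eq_sum_card_fiberwise (f := fun p => ({v, p.1, p.2} : Finset V))
    (t := H.filter fun e => v ∈ e) (fun p hp => by
      simp only [Finset.coe_filter, Set.mem_ofPred_eq] at hp ⊢
      exact ⟨hp.2, by simp⟩), hdeg, mul_comm, ← smul_eq_mul]
  refine Finset.card_nsmul_le_sum _ _ _ fun e he => ?_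
  obtain ⟨he, hv⟩ := Finset.mem_filter.1 he
  obtain ⟨x, y, hxy, hexy⟩ := Finset.card_eq_two.1
    (show (e.erase v).card = 2 by rw [Finset.card_erase_of_mem hv, h3 e he])
  have h1 : ({v, x, y} : Finset V) = e := by rw [← hexy, Finset.insert_erase hv]
  have h2 : ({v, y, x} : Finset V) = e := by rw [Finset.pair_comm y x, h1]
  rw [← Finset.card_pair (show (x, y) ≠ (y, x) from fun h => hxy (Prod.ext_iff.1 h).1)]
  refine Finset.card_le_card fun p hp => ?_
  simp only [Finset.mem_insert, Finset.mem_singleton] at hp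
  rcases hp with rfl | rfl <;> simp [h1, h2, he]

theorem hasLooseHamCycle_of_seq {n : ℕ} (hn : 0 < n) {H : Finset (Finset (Fin n))} {f : ℕ → Fin n}
    (hinj : Set.InjOn f (Set.Iio n)) (hf : f n = f 0)
    (hE : ∀ i < n / 2, ({f (2 * i), f (2 * i + 1), f (2 * i + 2)} : Finset (Fin n)) ∈ H) :
    HasLooseHamCycle n H := by
  have : NeZero n := ⟨hn.ne'⟩
  refine ⟨fun i => f i.val, ?_, fun i hi => ?_⟩
  · rw [Fintype.bijective_iff_injective_and_card]
    refine ⟨fun i j hij => ZMod.val_injective n (hinj (ZMod.val_lt i) (ZMod.val_lt j) hij), ?_⟩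
    rw [ZMod.card, Fintype.card_fin]
  · have h1 : ∀ k ≤ n, f (k : ZMod n).val = f k := fun k hk => by
      rcases hk.lt_or_eq with h | rfl
      · rw [ZMod.val_natCast_of_lt h]
      · rw [ZMod.natCast_self, ZMod.val_zero, hf]
    dsimp only
    rw [h1 _ (by omega), h1 _ (by omega), h1 _ (by omega)]
    exact hE i hi

/-- Buß–Hàn–Schacht: minimum vertex degree greater than `(7/16 + γ) C(n,2)` forces a
loose Hamilton cycle in a 3-graph on `n` vertices, `n` even and large. -/
theorem stmt_5 (γ : ℝ) (hγ : 0 < γ) :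
    ∃ n₀ : ℕ, ∀ n : ℕ, n > n₀ → Even n →
      ∀ H : Finset (Finset (Fin n)), (∀ e ∈ H, e.card = 3) →
      (∀ v : Fin n, (7 / 16 + γ) * (n.choose 2 : ℝ) < (hdeg H v : ℝ)) →
      HasLooseHamCycle n H := by
  obtain ⟨n₀, h₀⟩ := exists_loose_cycle (half_pos hγ)
  refine ⟨n₀ + ⌈1 / γ⌉₊ + 2, fun n hn heven H h3 hH => ?_⟩
  have hn' : 1 / γ + 2 ≤ n := by
    have h1 : 1 / γ ≤ ⌈1 / γ⌉₊ := Nat.le_ceil _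
    have h2 : (⌈1 / γ⌉₊ : ℝ) + 2 ≤ n := by exact_mod_cast (by omega : ⌈1 / γ⌉₊ + 2 ≤ n)
    linarith
  have hnγ : 1 + 2 * γ ≤ n * γ := by
    calc 1 + 2 * γ = (1 / γ + 2) * γ := by field_simp
      _ ≤ n * γ := by gcongr
  obtain ⟨f, hinj, hf, hE⟩ := h₀ (Fin n) (by rw [Fintype.card_fin]; omega)
    (by rwa [Fintype.card_fin]) (fun x y z => ({x, y, z} : Finset (Fin n)) ∈ H)
    (fun x y z h => by rwa [Finset.insert_comm]) (fun x y z h => by rwa [Finset.pair_comm])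
    (fun v => by
      rw [Fintype.card_fin, sum_card_filter_eq_card_product]
      have h1 : (2 : ℝ) * hdeg H v ≤ ((Finset.univ ×ˢ Finset.univ :
          Finset (Fin n × Fin n)).filter fun p => ({v, p.1, p.2} : Finset (Fin n)) ∈ H).card := by
        exact_mod_cast two_mul_hdeg_le h3 v
      have h2 := hH v
      rw [Nat.cast_choose_two] at h2
      have h3 : (7 / 16 + γ / 2) * (n : ℝ) ^ 2 ≤
          ((Finset.univ ×ˢ Finset.univ : Finset (Fin n × Fin n)).filter
            fun p => ({v, p.1, p.2} : Finset (Fin n)) ∈ H).card := by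
        have h4 : n * (1 + 2 * γ) ≤ n * (n * γ) := by gcongr
        have h5 : (0 : ℝ) ≤ n := Nat.cast_nonneg n
        linarith
      convert h3)
  rw [Fintype.card_fin] at hinj hf hE
  exact hasLooseHamCycle_of_seq (by omega) hinj hf hE
end

section
/- For any 0 < γ₁ ≤ 10⁻¹⁴ there exists an integer n₀ such that the following holds. Let H be a 3-graph on n > n₀ vertices with δ₁(H) ≥ (13/32)·C(n,2). Then there is a loose path P in H with |V(P)| ≤ γ₁·n such that for every subset U ⊆ V(H) \ V(P) with |U| ≤ γ₁³·n and |U| even, there exists a loose path Q in H with V(Q) = V(P) ∪ U such that P and Q have the same ends. -/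
/-- `v 0, v 1, …, v (2k)` is a loose path in the 3-graph `H`: the vertices are distinct
and `{v (2i), v (2i+1), v (2i+2)} ∈ H` for all `i < k`. -/
def IsLoosePath {α : Type*} [DecidableEq α] (H : Finset (Finset α)) (k : ℕ)
    (v : ℕ → α) : Prop :=
  Set.InjOn v (Set.Iio (2 * k + 1)) ∧
  ∀ i : ℕ, i < k → ({v (2 * i), v (2 * i + 1), v (2 * i + 2)} : Finset α) ∈ H

/-- The vertex set of the loose path `v 0, …, v (2k)`. -/
def pathVerts {α : Type*} [DecidableEq α] (k : ℕ) (v : ℕ → α) : Finset α :=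
  (Finset.range (2 * k + 1)).image v

namespace LooseAbsorb

open Finset

lemma insert_swap {α : Type*} [DecidableEq α] (a b c : α) :
    ({a, b, c} : Finset α) = {b, a, c} := by grind

lemma insert_swap' {α : Type*} [DecidableEq α] (a b c : α) :
    ({a, b, c} : Finset α) = {a, c, b} := by grind

section Degrees

variable {α : Type*} [Fintype α] [DecidableEq α]

/-- The vertices completing `x` and `v` to an edge of `H`. -/
def nb (H : Finset (Finset α)) (x v : α) : Finset α :=
  univ.filter fun w => ({x, v, w} : Finset α) ∈ H

/-- The vertices whose codegree with `x` is at least `n / 1024`. -/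
def big (H : Finset (Finset α)) (x : α) : Finset α :=
  univ.filter fun v => Fintype.card α ≤ 1024 * #(nb H x v)

/-- The vertices whose codegree with `x` is at least `(3 / 8 + 1 / 256) n`. -/
def huge (H : Finset (Finset α)) (x : α) : Finset α :=
  univ.filter fun v => 97 * Fintype.card α ≤ 256 * #(nb H x v)

/-- The sum of the codegrees of `x` is at least `(13 / 32) n ^ 2 - n`, for every `x`. -/
def Dense (H : Finset (Finset α)) : Prop :=
  ∀ x, (13 / 32 : ℝ) * (Fintype.card α : ℝ) ^ 2 - Fintype.card α ≤ ∑ v, (#(nb H x v) : ℝ)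

lemma nb_comm (H : Finset (Finset α)) (x v : α) : nb H x v = nb H v x := by
  ext w; simp [nb, insert_swap x v w]

lemma mem_nb {H : Finset (Finset α)} {x v w : α} :
    w ∈ nb H x v ↔ ({x, v, w} : Finset α) ∈ H := by simp [nb]

lemma mem_nb_swap {H : Finset (Finset α)} {x v w : α} : w ∈ nb H x v ↔ v ∈ nb H x w := by
  rw [mem_nb, mem_nb, insert_swap']

lemma mem_big_comm {H : Finset (Finset α)} {x v : α} : v ∈ big H x ↔ x ∈ big H v := by
  simp [big, nb_comm H x v]

lemma two_mul_hdeg_le (H : Finset (Finset α)) (h3 : ∀ e ∈ H, #e = 3) (x : α) :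
    2 * hdeg H x ≤ ∑ v, #(nb H x v) := by
  have h1 : ∀ v ∈ univ.erase x, #((H.filter fun e => x ∈ e).filter fun e => v ∈ e) ≤
      #(nb H x v) := by
    intro v hv
    have hvx : v ≠ x := by simpa using hv
    refine le_trans (card_le_card (t := (nb H x v).image fun w => ({x, v, w} : Finset α)) ?_)
      card_image_le
    intro e he
    simp only [mem_filter] at he
    obtain ⟨⟨heH, hxe⟩, hve⟩ := he
    have hc : #((e.erase x).erase v) = 1 := by
      rw [card_erase_of_mem (by simp [hvx, hve]), card_erase_of_mem hxe, h3 e heH]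
    obtain ⟨w, hw⟩ := card_eq_one.1 hc
    have : ({x, v, w} : Finset α) = e := by
      have h2 : insert v ((e.erase x).erase v) = e.erase x :=
        insert_erase (by simp [hvx, hve])
      rw [hw] at h2
      rw [h2, insert_erase hxe]
    exact mem_image.2 ⟨w, by rw [mem_nb, this]; exact heH, this⟩
  calc 2 * hdeg H x = ∑ e ∈ H.filter (fun e => x ∈ e), 2 := by
        rw [sum_const, smul_eq_mul, hdeg, mul_comm]
    _ = ∑ e ∈ H.filter (fun e => x ∈ e), #((univ.erase x).filter fun v => v ∈ e) := by
        refine sum_congr rfl fun e he => ?_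
        simp only [mem_filter] at he
        have : (univ.erase x).filter (fun v => v ∈ e) = e.erase x := by
          ext v; simp
        rw [this, card_erase_of_mem he.2, h3 e he.1]
    _ = ∑ v ∈ univ.erase x, #((H.filter fun e => x ∈ e).filter fun e => v ∈ e) :=
        sum_card_bipartiteAbove_eq_sum_card_bipartiteBelow fun e v => v ∈ e
    _ ≤ ∑ v ∈ univ.erase x, #(nb H x v) := sum_le_sum h1
    _ ≤ ∑ v, #(nb H x v) := sum_le_sum_of_subset (subset_univ _)

lemma dense_of_hdeg (H : Finset (Finset α)) (h3 : ∀ e ∈ H, #e = 3)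
    (hd : ∀ x, (13 / 32 : ℝ) * ((Fintype.card α).choose 2 : ℝ) ≤ (hdeg H x : ℝ)) :
    Dense H := by
  intro x
  have h1 : (2 : ℝ) * hdeg H x ≤ ∑ v, (#(nb H x v) : ℝ) := by
    exact_mod_cast two_mul_hdeg_le H h3 x
  have h2 := hd x
  rw [Nat.cast_choose_two] at h2
  have h0 : (0 : ℝ) ≤ Fintype.card α := Nat.cast_nonneg _
  nlinarith

lemma sum_card_nb_le (H : Finset (Finset α)) (x : α) :
    ∑ v, (#(nb H x v) : ℝ) ≤
      ∑ v ∈ big H x, (#(nb H x v ∩ big H x) : ℝ) + (Fintype.card α : ℝ) ^ 2 / 512 := by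
  have hsmall : ∑ v ∈ (big H x)ᶜ, (#(nb H x v) : ℝ) ≤ (Fintype.card α : ℝ) ^ 2 / 1024 := by
    have h1 : ∀ v ∈ (big H x)ᶜ, (#(nb H x v) : ℝ) ≤ Fintype.card α / 1024 := by
      intro v hv
      have : ¬ Fintype.card α ≤ 1024 * #(nb H x v) := by simpa [big] using hv
      have h2 : (1024 * #(nb H x v) : ℝ) ≤ Fintype.card α := by
        exact_mod_cast (not_le.1 this).le
      linarith
    have h2 := sum_le_card_nsmul _ _ _ h1
    have h3 : (#(big H x)ᶜ : ℝ) ≤ Fintype.card α := by exact_mod_cast card_le_univ _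
    rw [nsmul_eq_mul] at h2
    have h0 : (0 : ℝ) ≤ Fintype.card α := Nat.cast_nonneg _
    nlinarith
  have hout : ∑ v ∈ big H x, (#(nb H x v \ big H x) : ℝ) ≤
      ∑ v ∈ (big H x)ᶜ, (#(nb H x v) : ℝ) := by
    have e1 : ∀ v, nb H x v \ big H x = (big H x)ᶜ.filter fun w => w ∈ nb H x v := by
      intro v; ext w; simp [and_comm]
    have e2 : ∀ w, (univ.filter fun v => w ∈ nb H x v) = nb H x w := by
      intro w; ext v; simp [mem_nb_swap (x := x) (v := v)]
    have := sum_card_bipartiteAbove_eq_sum_card_bipartiteBelow (s := (univ : Finset α))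
      (t := (big H x)ᶜ) fun v w => w ∈ nb H x v
    simp only [bipartiteAbove, bipartiteBelow, e2, ← e1] at this
    calc ∑ v ∈ big H x, (#(nb H x v \ big H x) : ℝ)
        ≤ ∑ v, (#(nb H x v \ big H x) : ℝ) :=
          sum_le_sum_of_subset_of_nonneg (subset_univ _) fun _ _ _ => Nat.cast_nonneg _
      _ = _ := by exact_mod_cast this
  have hsplit : ∑ v ∈ big H x, (#(nb H x v) : ℝ) =
      ∑ v ∈ big H x, (#(nb H x v ∩ big H x) : ℝ) +
        ∑ v ∈ big H x, (#(nb H x v \ big H x) : ℝ) := by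
    rw [← sum_add_distrib]
    refine sum_congr rfl fun v _ => ?_
    exact_mod_cast (card_inter_add_card_sdiff _ _).symm
  rw [← sum_add_sum_compl (big H x)]
  linarith

lemma card_big (H : Finset (Finset α)) (hH : Dense H) (hn : 1024 ≤ Fintype.card α) (x : α) :
    (5 / 8 : ℝ) * Fintype.card α ≤ #(big H x) := by
  have h1 := hH x
  have h2 := sum_card_nb_le H x
  have h3 : ∑ v ∈ big H x, (#(nb H x v ∩ big H x) : ℝ) ≤ (#(big H x) : ℝ) * #(big H x) := by
    rw [← nsmul_eq_mul]
    exact sum_le_card_nsmul _ _ _ fun v _ => by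
      exact_mod_cast card_le_card inter_subset_right
  have hn' : (1024 : ℝ) ≤ Fintype.card α := by exact_mod_cast hn
  by_contra! h
  have h0 : (0 : ℝ) ≤ #(big H x) := Nat.cast_nonneg _
  nlinarith

lemma huge_subset_big (H : Finset (Finset α)) (x : α) : huge H x ⊆ big H x := by
  intro v hv
  simp only [huge, big, mem_filter, mem_univ, true_and] at hv ⊢
  omega

lemma sum_inner_le (H : Finset (Finset α)) (x : α) :
    ∑ v ∈ big H x, (#(nb H x v ∩ big H x) : ℝ) ≤
      (#(huge H x) : ℝ) * #(big H x) +
        ((#(big H x) : ℝ) - #(huge H x)) * (97 / 256 * Fintype.card α) := by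
  have hs := sum_sdiff (f := fun v => (#(nb H x v ∩ big H x) : ℝ)) (huge_subset_big H x)
  have h1 : ∑ v ∈ huge H x, (#(nb H x v ∩ big H x) : ℝ) ≤ (#(huge H x) : ℝ) * #(big H x) := by
    rw [← nsmul_eq_mul]
    exact sum_le_card_nsmul _ _ _ fun v _ => by
      exact_mod_cast card_le_card inter_subset_right
  have h2 : ∑ v ∈ big H x \ huge H x, (#(nb H x v ∩ big H x) : ℝ) ≤
      (#(big H x \ huge H x) : ℝ) * (97 / 256 * Fintype.card α) := by
    rw [← nsmul_eq_mul]
    refine sum_le_card_nsmul _ _ _ fun v hv => ?_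
    have hv' : ¬ 97 * Fintype.card α ≤ 256 * #(nb H x v) := by
      have := (mem_sdiff.1 hv).2
      simpa [huge] using this
    have h3 : (256 * #(nb H x v) : ℝ) ≤ 97 * Fintype.card α := by
      exact_mod_cast (not_le.1 hv').le
    have h4 : (#(nb H x v ∩ big H x) : ℝ) ≤ #(nb H x v) := by
      exact_mod_cast card_le_card inter_subset_left
    linarith
  have h3 : (#(big H x \ huge H x) : ℝ) = #(big H x) - #(huge H x) := by
    rw [card_sdiff_of_subset (huge_subset_big H x),
      Nat.cast_sub (card_le_card (huge_subset_big H x))]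
  rw [h3] at h2
  linarith

lemma card_huge_inter_big_aux (H : Finset (Finset α)) (hH : Dense H)
    (hn : 1024 ≤ Fintype.card α) (x y : α) (hxy : #(big H x) ≤ #(big H y)) :
    (Fintype.card α : ℝ) / 1024 ≤ #(huge H x ∩ big H y) := by
  have h1 := hH x
  have h2 := sum_card_nb_le H x
  have h3 := sum_inner_le H x
  have h4 := card_big H hH hn x
  have hn' : (1024 : ℝ) ≤ Fintype.card α := by exact_mod_cast hn
  have h5 : (#(big H x) : ℝ) ≤ #(big H y) := by exact_mod_cast hxy
  have h6 : (#(huge H x) : ℝ) + #(big H y) ≤ Fintype.card α + #(huge H x ∩ big H y) := by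
    have := card_union_add_card_inter (huge H x) (big H y)
    have h7 := card_le_univ (huge H x ∪ big H y)
    have : #(huge H x) + #(big H y) ≤ Fintype.card α + #(huge H x ∩ big H y) := by omega
    exact_mod_cast this
  have h7 : (#(big H x) : ℝ) ≤ Fintype.card α := by exact_mod_cast card_le_univ _
  by_contra! h
  set n : ℝ := (Fintype.card α : ℝ)
  set q : ℝ := (#(big H x) : ℝ)
  set p : ℝ := (#(huge H x) : ℝ)
  have hp : p ≤ n - q + n / 1024 := by linarith
  have h8 : p * (q - 97 / 256 * n) ≤ (n - q + n / 1024) * (q - 97 / 256 * n) :=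
    mul_le_mul_of_nonneg_right hp (by linarith)
  nlinarith [sq_nonneg (q - 7 / 8 * n)]

lemma card_huge_inter_big (H : Finset (Finset α)) (hH : Dense H)
    (hn : 1024 ≤ Fintype.card α) (x y : α) :
    (Fintype.card α : ℝ) / 1024 ≤ #(huge H x ∩ big H y) ∨
      (Fintype.card α : ℝ) / 1024 ≤ #(huge H y ∩ big H x) :=
  (le_total #(big H x) #(big H y)).imp (card_huge_inter_big_aux H hH hn x y)
    (card_huge_inter_big_aux H hH hn y x)

lemma card_big_inter_big (H : Finset (Finset α)) (hH : Dense H)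
    (hn : 1024 ≤ Fintype.card α) (x y : α) :
    (Fintype.card α : ℝ) / 1024 ≤ #(big H x ∩ big H y) := by
  have h1 := card_big H hH hn x
  have h2 := card_big H hH hn y
  have h3 : (#(big H x) : ℝ) + #(big H y) ≤ Fintype.card α + #(big H x ∩ big H y) := by
    have := card_union_add_card_inter (big H x) (big H y)
    have h7 := card_le_univ (big H x ∪ big H y)
    have : #(big H x) + #(big H y) ≤ Fintype.card α + #(big H x ∩ big H y) := by omega
    exact_mod_cast this
  have hn' : (1024 : ℝ) ≤ Fintype.card α := by exact_mod_cast hn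
  linarith

lemma card_nb_inter_big (H : Finset (Finset α)) (hH : Dense H)
    (hn : 1024 ≤ Fintype.card α) {x v : α} (hv : v ∈ huge H x) (u : α) :
    (Fintype.card α : ℝ) / 1024 ≤ #(nb H x v ∩ big H u) := by
  have h1 : (97 * Fintype.card α : ℝ) ≤ 256 * #(nb H x v) := by
    have : 97 * Fintype.card α ≤ 256 * #(nb H x v) := by simpa [huge] using hv
    exact_mod_cast this
  have h2 := card_big H hH hn u
  have h3 : (#(nb H x v) : ℝ) + #(big H u) ≤ Fintype.card α + #(nb H x v ∩ big H u) := by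
    have := card_union_add_card_inter (nb H x v) (big H u)
    have h7 := card_le_univ (nb H x v ∪ big H u)
    have : #(nb H x v) + #(big H u) ≤ Fintype.card α + #(nb H x v ∩ big H u) := by omega
    exact_mod_cast this
  have hn' : (1024 : ℝ) ≤ Fintype.card α := by exact_mod_cast hn
  linarith

lemma card_nb_of_mem_big {H : Finset (Finset α)} {x v : α} (hv : v ∈ big H x) :
    (Fintype.card α : ℝ) / 1024 ≤ #(nb H x v) := by
  have h1 : (Fintype.card α : ℝ) ≤ 1024 * #(nb H x v) := by
    have : Fintype.card α ≤ 1024 * #(nb H x v) := by simpa [big] using hv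
    exact_mod_cast this
  linarith

end Degrees

section Counting

lemma card_mul_le_card_filter {α β : Type*} [Fintype α] [Fintype β] [DecidableEq α]
    (P : α × β → Prop) [DecidablePred P] (S : Finset α) {c : ℝ}
    (h : ∀ a ∈ S, c ≤ #(univ.filter fun b => P (a, b))) :
    #S * c ≤ #(univ.filter P) := by
  calc #S * c ≤ ∑ a ∈ S, (#(univ.filter fun b => P (a, b)) : ℝ) := by
        rw [← nsmul_eq_mul]
        exact card_nsmul_le_sum _ _ _ h
    _ ≤ ∑ a, (#(univ.filter fun b => P (a, b)) : ℝ) :=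
        sum_le_sum_of_subset_of_nonneg (subset_univ _) fun _ _ _ => Nat.cast_nonneg _
    _ = #(univ.filter P) := by
        simp only [card_filter, Fintype.sum_prod_type]
        push_cast
        rfl

variable {α : Type*} [Fintype α] [DecidableEq α]

lemma le_card_sdiff {S W : Finset α} (hS : (Fintype.card α : ℝ) / 1024 ≤ #S)
    (hW : (#W : ℝ) ≤ Fintype.card α / 2048) : (Fintype.card α : ℝ) / 2048 ≤ #(S \ W) := by
  have h1 : (#S : ℝ) ≤ #(S \ W) + #W := by
    exact_mod_cast card_le_card_sdiff_add_card
  linarith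

lemma mul_le_card_filter {β : Type*} [Fintype β] (P : α × β → Prop) [DecidablePred P]
    (W S : Finset α) {c : ℝ} (hc : 0 ≤ c) (hS : (Fintype.card α : ℝ) / 1024 ≤ #S)
    (hW : (#W : ℝ) ≤ Fintype.card α / 2048)
    (h : ∀ a ∈ S, a ∉ W → c ≤ #(univ.filter fun b => P (a, b))) :
    (Fintype.card α : ℝ) / 2048 * c ≤ #(univ.filter P) :=
  (mul_le_mul_of_nonneg_right (le_card_sdiff hS hW) hc).trans
    (card_mul_le_card_filter P (S \ W) fun a ha => h a (mem_sdiff.1 ha).1 (mem_sdiff.1 ha).2)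

lemma le_card_filter (P : α → Prop) [DecidablePred P]
    (W S : Finset α) (hS : (Fintype.card α : ℝ) / 1024 ≤ #S)
    (hW : (#W : ℝ) ≤ Fintype.card α / 2048) (h : ∀ a ∈ S, a ∉ W → P a) :
    (Fintype.card α : ℝ) / 2048 ≤ #(univ.filter P) := by
  refine (le_card_sdiff hS hW).trans ?_
  have : S \ W ⊆ univ.filter P := fun a ha => by
    simpa using h a (mem_sdiff.1 ha).1 (mem_sdiff.1 ha).2
  exact_mod_cast card_le_card this

lemma exists_mem_notMem {S W : Finset α} (hn : 1024 ≤ Fintype.card α)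
    (hS : (Fintype.card α : ℝ) / 1024 ≤ #S)
    (hW : (#W : ℝ) ≤ Fintype.card α / 2048) : ∃ a ∈ S, a ∉ W := by
  have h := le_card_sdiff hS hW
  have hn' : (1024 : ℝ) ≤ Fintype.card α := by exact_mod_cast hn
  have : (0 : ℝ) < #(S \ W) := by linarith
  obtain ⟨a, ha⟩ := card_pos.1 (Nat.cast_pos.1 this)
  exact ⟨a, (mem_sdiff.1 ha).1, (mem_sdiff.1 ha).2⟩

/-- A candidate for an absorber: the vertices `v₁, …, v₇` of a loose path, listed in the order
`v₄, v₆, v₅, v₃, v₂, v₁, v₇` in which they are chosen. -/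
abbrev Septuple (α : Type*) := α × α × α × α × α × α × α

/-- The septuple is a loose path `v₁ ⋯ v₇` in `H` that avoids `W`. -/
def Fits (H : Finset (Finset α)) (W : Finset α) : Septuple α → Prop
  | (v₄, v₆, v₅, v₃, v₂, v₁, v₇) =>
    [v₁, v₂, v₃, v₄, v₅, v₆, v₇].Nodup ∧ (∀ v ∈ [v₁, v₂, v₃, v₄, v₅, v₆, v₇], v ∉ W) ∧
      ({v₁, v₂, v₃} : Finset α) ∈ H ∧ ({v₃, v₄, v₅} : Finset α) ∈ H ∧
      ({v₅, v₆, v₇} : Finset α) ∈ H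

/-- The edges that turn the path `v₁ ⋯ v₇` into the path `v₁ v₃ v₂ x v₄ y v₆ v₅ v₇`. -/
def Absorbs (H : Finset (Finset α)) (x y : α) : Septuple α → Prop
  | (v₄, v₆, _, _, v₂, _, _) => ({v₂, x, v₄} : Finset α) ∈ H ∧ ({v₄, y, v₆} : Finset α) ∈ H

/-- The septuple absorbs the pair `{x, y}` in one of the two possible orders. -/
def Hits (H : Finset (Finset α)) (p : α × α) (t : Septuple α) : Prop :=
  Absorbs H p.1 p.2 t ∨ Absorbs H p.2 p.1 t

noncomputable instance (H : Finset (Finset α)) (W : Finset α) : DecidablePred (Fits H W) :=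
  Classical.decPred _

noncomputable instance (H : Finset (Finset α)) (p : α × α) : DecidablePred (Hits H p) :=
  Classical.decPred _

lemma le_card_fits_of_huge (H : Finset (Finset α)) (hH : Dense H)
    (hn : 1024 ≤ Fintype.card α) (W : Finset α)
    (hW : (#W : ℝ) + 10 ≤ Fintype.card α / 2048) (x y : α)
    (hxy : (Fintype.card α : ℝ) / 1024 ≤ #(huge H x ∩ big H y))
    (P : Septuple α → Prop) [DecidablePred P]
    (hP : ∀ t, Fits H W t → Absorbs H x y t → P t) :
    ((Fintype.card α : ℝ) / 2048) ^ 7 ≤ #(univ.filter P) := by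
  have hc : (0 : ℝ) ≤ Fintype.card α / 2048 := by positivity
  have hW' : ∀ l : List α, l.length ≤ 10 → (#(l.toFinset ∪ W) : ℝ) ≤ Fintype.card α / 2048 := by
    intro l hl
    have h1 : #(l.toFinset ∪ W) ≤ 10 + #W :=
      (card_union_le _ _).trans (by have := l.toFinset_card_le; omega)
    have h2 : (#(l.toFinset ∪ W) : ℝ) ≤ 10 + #W := by exact_mod_cast h1
    linarith
  simp only [pow_succ', pow_zero, mul_one]
  refine mul_le_card_filter _ _ _ (by positivity) hxy (hW' [] (by simp)) fun v₄ h₄ w₄ => ?_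
  rw [mem_inter] at h₄
  refine mul_le_card_filter _ _ _ (by positivity) (card_nb_of_mem_big h₄.2)
    (hW' [v₄] (by simp)) fun v₆ h₆ w₆ => ?_
  refine mul_le_card_filter _ _ _ (by positivity) (card_big_inter_big H hH hn v₄ v₆)
    (hW' [v₄, v₆] (by simp)) fun v₅ h₅ w₅ => ?_
  rw [mem_inter] at h₅
  refine mul_le_card_filter _ _ _ (by positivity) (card_nb_of_mem_big h₅.1)
    (hW' [v₄, v₆, v₅] (by simp)) fun v₃ h₃ w₃ => ?_
  refine mul_le_card_filter _ _ _ (by positivity) (card_nb_inter_big H hH hn h₄.1 v₃)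
    (hW' [v₄, v₆, v₅, v₃] (by simp)) fun v₂ h₂ w₂ => ?_
  rw [mem_inter] at h₂
  refine mul_le_card_filter _ _ _ (by positivity) (card_nb_of_mem_big h₂.2)
    (hW' [v₄, v₆, v₅, v₃, v₂] (by simp)) fun v₁ h₁ w₁ => ?_
  refine le_card_filter _ _ _ (card_nb_of_mem_big h₅.2)
    (hW' [v₄, v₆, v₅, v₃, v₂, v₁] (by simp)) fun v₇ h₇ w₇ => ?_
  refine hP _ ⟨?_, ?_, ?_, ?_, ?_⟩ ⟨?_, ?_⟩
  · simp at w₁ w₂ w₃ w₄ w₅ w₆ w₇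
    simp
    grind
  · simp at w₁ w₂ w₃ w₄ w₅ w₆ w₇
    simp [*]
  · rw [mem_nb] at h₁
    rwa [insert_swap, insert_swap', insert_swap] at h₁
  · rw [mem_nb] at h₃
    rwa [insert_swap', insert_swap] at h₃
  · rw [mem_nb] at h₇
    rwa [insert_swap] at h₇
  · rw [mem_nb] at h₂
    rw [insert_swap, insert_swap']
    exact h₂.1
  · rw [mem_nb] at h₆
    rwa [insert_swap]

lemma le_card_fits_hits (H : Finset (Finset α)) (hH : Dense H)
    (hn : 1024 ≤ Fintype.card α) (W : Finset α)
    (hW : (#W : ℝ) + 10 ≤ Fintype.card α / 2048) (p : α × α) :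
    ((Fintype.card α : ℝ) / 2048) ^ 7 ≤ #((univ.filter (Fits H W)).filter (Hits H p)) := by
  rw [filter_filter]
  rcases card_huge_inter_big H hH hn p.1 p.2 with h | h
  · exact le_card_fits_of_huge H hH hn W hW _ _ h _ fun t h1 h2 => ⟨h1, Or.inl h2⟩
  · exact le_card_fits_of_huge H hH hn W hW _ _ h _ fun t h1 h2 => ⟨h1, Or.inr h2⟩

/-- Some `t ∈ A` halves at least the average amount of weight. -/
lemma exists_halving {T P : Type*} [Fintype T] [Fintype P] [Nonempty T] [Nonempty P]
    (A : Finset T) (R : P → T → Prop) [∀ p, DecidablePred (R p)] (w : P → ℝ)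
    (hw : ∀ p, 0 ≤ w p) {β : ℝ} (hβ : 0 < β)
    (h : ∀ p, β * Fintype.card T ≤ #(A.filter (R p))) :
    ∃ t ∈ A, ∑ p, w p * (if R p t then 1 / 2 else 1) ≤ (1 - β / 2) * ∑ p, w p := by
  have hT : (0 : ℝ) < Fintype.card T := by exact_mod_cast Fintype.card_pos
  have hA : A.Nonempty := by
    obtain ⟨p⟩ := ‹Nonempty P›
    have : (0 : ℝ) < #(A.filter (R p)) := (mul_pos hβ hT).trans_le (h p)
    exact (card_pos.1 (Nat.cast_pos.1 this)).mono (filter_subset _ _)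
  by_contra! hcon
  have h1 := sum_lt_sum_of_nonempty hA hcon
  rw [sum_const, nsmul_eq_mul, sum_comm] at h1
  have h2 : ∀ p, ∑ t ∈ A, w p * (if R p t then 1 / 2 else 1) ≤
      w p * (#A - β * Fintype.card T / 2) := by
    intro p
    rw [← mul_sum]
    refine mul_le_mul_of_nonneg_left ?_ (hw p)
    have e : ∀ t, (if R p t then (1 / 2 : ℝ) else 1) = 1 - (if R p t then 1 else 0) / 2 := by
      intro t; split_ifs <;> norm_num
    simp only [e, sum_sub_distrib, ← sum_div, sum_boole, sum_const, nsmul_eq_mul, mul_one]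
    linarith [h p]
  have h3 := sum_le_sum fun p (_ : p ∈ univ) => h2 p
  rw [← sum_mul] at h3
  have hA' : (#A : ℝ) ≤ Fintype.card T := by exact_mod_cast card_le_univ _
  have hS : 0 ≤ ∑ p, w p := sum_nonneg fun p _ => hw p
  nlinarith [mul_nonneg hS (mul_nonneg hβ.le (sub_nonneg.2 hA'))]

end Counting

section Paths

variable {α : Type*} [DecidableEq α]

/-- `a :: l` is a sequence of vertices ending in `z` whose consecutive triples sharing
one vertex are edges of `H`. -/
inductive LooseChain (H : Finset (Finset α)) (z : α) : α → List α → Prop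
  | nil : LooseChain H z z []
  | cons {a b c : α} {l : List α} :
    ({a, b, c} : Finset α) ∈ H → LooseChain H z c l → LooseChain H z a (b :: c :: l)

lemma looseChain_cons_iff {H : Finset (Finset α)} {z a b c : α} {l : List α} :
    LooseChain H z a (b :: c :: l) ↔ ({a, b, c} : Finset α) ∈ H ∧ LooseChain H z c l :=
  ⟨fun h => by cases h with | cons h1 h2 => exact ⟨h1, h2⟩, fun h => .cons h.1 h.2⟩

lemma LooseChain.exists_length {H : Finset (Finset α)} {z a : α} {l : List α}
    (h : LooseChain H z a l) :
    ∃ k, l.length = 2 * k ∧ (a :: l).getD (2 * k) z = z ∧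
      ∀ i < k, ({(a :: l).getD (2 * i) z, (a :: l).getD (2 * i + 1) z,
        (a :: l).getD (2 * i + 2) z} : Finset α) ∈ H := by
  induction h with
  | nil => exact ⟨0, by simp⟩
  | @cons a b c l h1 _ ih =>
    obtain ⟨k, hk, hz, he⟩ := ih
    refine ⟨k + 1, by simp [hk]; ring, ?_, ?_⟩
    · rw [mul_add]
      simpa using hz
    · intro i hi
      cases i with
      | zero => simpa using h1
      | succ i =>
        have := he i (by omega)
        rw [mul_add]
        simpa using this

lemma LooseChain.isLoosePath {H : Finset (Finset α)} {z a : α} {l : List α}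
    (h : LooseChain H z a l) (hl : (a :: l).Nodup) :
    ∃ (k : ℕ) (v : ℕ → α), l.length = 2 * k ∧ IsLoosePath H k v ∧
      pathVerts k v = (a :: l).toFinset ∧ v 0 = a ∧ v (2 * k) = z := by
  obtain ⟨k, hk, hz, he⟩ := h.exists_length
  have hlen : (a :: l).length = 2 * k + 1 := by simp [hk]
  refine ⟨k, fun i => (a :: l).getD i z, hk, ⟨?_, he⟩, ?_, by simp, hz⟩
  · intro i hi j hj hij
    rw [Set.mem_Iio, ← hlen] at hi hj
    simp only [List.getD_eq_getElem _ _ hi, List.getD_eq_getElem _ _ hj] at hij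
    exact (hl.getElem_inj_iff).1 hij
  · ext x
    rw [pathVerts, mem_image, List.mem_toFinset, List.mem_iff_getElem, ← hlen]
    constructor
    · rintro ⟨i, hi, rfl⟩
      exact ⟨i, mem_range.1 hi, (List.getD_eq_getElem _ _ (mem_range.1 hi)).symm⟩
    · rintro ⟨i, hi, rfl⟩
      exact ⟨i, mem_range.2 hi, List.getD_eq_getElem _ _ hi⟩

/-- An absorber, the three vertices leading from its last vertex to the next absorber,
and the ordered pair it has absorbed, if any. -/
abbrev Block (α : Type*) := Septuple α × (α × α × α) × Option (α × α)

/-- The first vertex of the path given by a list of blocks and the last vertex `z`. -/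
def firstVertex (z : α) : List (Block α) → α
  | [] => z
  | ((_, _, _, _, _, v₁, _), _) :: _ => v₁

/-- The remaining vertices of the path given by a list of blocks and the last vertex `z`. -/
def restVertices (z : α) : List (Block α) → List α
  | [] => []
  | ((v₄, v₆, v₅, v₃, v₂, _, v₇), (b, w, a), none) :: L =>
    v₂ :: v₃ :: v₄ :: v₅ :: v₆ :: v₇ :: b :: w :: a :: firstVertex z L :: restVertices z L
  | ((v₄, v₆, v₅, v₃, v₂, _, v₇), (b, w, a), some (x, y)) :: L =>
    v₃ :: v₂ :: x :: v₄ :: y :: v₆ :: v₅ :: v₇ :: b :: w :: a :: firstVertex z L ::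
      restVertices z L

/-- The list of blocks describes a loose path in `H`, up to distinctness of vertices. -/
def ChainBlocks (H : Finset (Finset α)) (z : α) (L : List (Block α)) : Prop :=
  LooseChain H z (firstVertex z L) (restVertices z L)

lemma absorb_one {H : Finset (Finset α)} {z x y : α} {t : Septuple α} {c : α × α × α}
    {L₂ : List (Block α)} (ht : Absorbs H x y t) :
    ∀ L₁ : List (Block α), ChainBlocks H z (L₁ ++ (t, c, none) :: L₂) →
      ChainBlocks H z (L₁ ++ (t, c, some (x, y)) :: L₂) ∧
      firstVertex z (L₁ ++ (t, c, some (x, y)) :: L₂) =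
        firstVertex z (L₁ ++ (t, c, none) :: L₂) ∧
      (restVertices z (L₁ ++ (t, c, some (x, y)) :: L₂)).Perm
        (x :: y :: restVertices z (L₁ ++ (t, c, none) :: L₂)) := by
  intro L₁
  induction L₁ with
  | nil =>
    obtain ⟨v₄, v₆, v₅, v₃, v₂, v₁, v₇⟩ := t
    obtain ⟨b, w, a⟩ := c
    simp only [List.nil_append, ChainBlocks, firstVertex, restVertices, looseChain_cons_iff,
      Absorbs] at ht ⊢
    rintro ⟨h1, h2, h3, h4⟩
    refine ⟨⟨?_, ht.1, ht.2, ?_, h4⟩, trivial, ?_⟩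
    · rwa [insert_swap']
    · rwa [insert_swap]
    · rw [List.perm_iff_count]
      intro u
      simp only [List.count_cons]
      ring
  | cons B L ih =>
    obtain ⟨⟨v₄, v₆, v₅, v₃, v₂, v₁, v₇⟩, ⟨b, w, a⟩, o⟩ := B
    rcases o with _ | ⟨p, q⟩ <;>
    · simp only [List.cons_append, ChainBlocks, firstVertex, restVertices,
        looseChain_cons_iff] at ih ⊢
      intro h
      obtain ⟨i1, i2, i3⟩ := ih (by tauto)
      rw [i2] at i1 ⊢
      refine ⟨by tauto, trivial, ?_⟩
      rw [List.perm_iff_count] at i3 ⊢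
      intro u
      have := i3 u
      simp only [List.count_cons] at this ⊢
      omega

/-- The number of unused absorbers in the list that can absorb the pair `p`. -/
noncomputable def freeHits (H : Finset (Finset α)) (p : α × α) (L : List (Block α)) : ℕ :=
  L.countP fun B => decide (B.2.2 = none ∧ Hits H p B.1)

lemma absorb_all {H : Finset (Finset α)} {z : α} (m : ℕ) :
    ∀ (U : Finset α) (L : List (Block α)), #U = 2 * m → ChainBlocks H z L →
      (∀ p, m ≤ freeHits H p L) →
      ∃ L', ChainBlocks H z L' ∧ firstVertex z L' = firstVertex z L ∧
        (restVertices z L').Perm (U.toList ++ restVertices z L) := by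
  induction m with
  | zero =>
    intro U L hU hL _
    have : U = ∅ := by simpa using hU
    exact ⟨L, hL, rfl, by simp [this]⟩
  | succ m ih =>
    intro U L hU hL hm
    obtain ⟨x, U₁, hx, rfl, hU₁⟩ := card_eq_succ.1 (show #U = (2 * m + 1) + 1 by omega)
    obtain ⟨y, U₂, hy, rfl, hU₂⟩ := card_eq_succ.1 hU₁
    have hpos : 0 < freeHits H (x, y) L := by have := hm (x, y); omega
    obtain ⟨⟨t, c, o⟩, hB, hB'⟩ := List.countP_pos_iff.1 hpos
    obtain ⟨rfl, ht⟩ := of_decide_eq_true hB'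
    obtain ⟨L₁, L₂, rfl⟩ := List.append_of_mem hB
    have key : ∀ x' y', Absorbs H x' y' t → [x', y'].Perm [x, y] →
        ∃ L', ChainBlocks H z L' ∧ firstVertex z L' = firstVertex z (L₁ ++ (t, c, none) :: L₂) ∧
        (restVertices z L').Perm ((insert x (insert y U₂)).toList ++
          restVertices z (L₁ ++ (t, c, none) :: L₂)) := by
      intro x' y' ha hxy
      obtain ⟨a1, a2, a3⟩ := absorb_one ha L₁ hL
      obtain ⟨L', b1, b2, b3⟩ := ih U₂ _ hU₂ a1 fun p => by
        have := hm p
        simp only [freeHits, List.countP_append, List.countP_cons] at this ⊢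
        simp only [reduceCtorEq, false_and, decide_false, Bool.false_eq_true, if_false]
        split_ifs at this <;> omega
      refine ⟨L', b1, b2.trans a2, ?_⟩
      have e : (insert x (insert y U₂)).toList.Perm (x :: y :: U₂.toList) :=
        (toList_insert hx).trans ((toList_insert hy).cons x)
      rw [List.perm_iff_count] at a3 b3 e hxy ⊢
      intro u
      have := a3 u
      have := b3 u
      have := e u
      have := hxy u
      simp only [List.count_append, List.count_cons, List.count_nil] at *
      omega
    rcases ht with ht | ht
    · exact key x y ht (List.Perm.refl _)
    · exact key y x ht (List.Perm.swap _ _ _)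

end Paths

section Greedy

variable {α : Type*} [Fintype α] [DecidableEq α]

lemma exists_link (H : Finset (Finset α)) (hH : Dense H) (hn : 1024 ≤ Fintype.card α)
    (W : Finset α) (hW : (#W : ℝ) + 2 ≤ Fintype.card α / 2048) (u s : α) :
    ∃ b w a, [b, w, a].Nodup ∧ (∀ v ∈ [b, w, a], v ∉ W) ∧
      ({u, b, w} : Finset α) ∈ H ∧ ({w, a, s} : Finset α) ∈ H := by
  obtain ⟨w, hw, hwW⟩ := exists_mem_notMem hn (card_big_inter_big H hH hn u s)
    (W := W) (by linarith)
  rw [mem_inter] at hw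
  have h1 : (#(insert w W) : ℝ) ≤ #W + 1 := by exact_mod_cast card_insert_le _ _
  obtain ⟨b, hb, hbW⟩ := exists_mem_notMem hn (card_nb_of_mem_big hw.1)
    (W := insert w W) (by linarith)
  have h2 : (#(insert b (insert w W)) : ℝ) ≤ #(insert w W) + 1 := by
    exact_mod_cast card_insert_le _ _
  obtain ⟨a, ha, haW⟩ := exists_mem_notMem hn (card_nb_of_mem_big (mem_big_comm.1 hw.2))
    (W := insert b (insert w W)) (by linarith)
  rw [mem_nb, insert_swap'] at hb ha
  refine ⟨b, w, a, ?_, ?_, hb, ha⟩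
  · simp at hbW haW ⊢
    grind
  · simp at hbW haW ⊢
    grind

/-- Adding one block at the front of a path. -/
lemma exists_cons_block (H : Finset (Finset α)) (hH : Dense H) (hn : 1024 ≤ Fintype.card α)
    (z : α) (L : List (Block α)) (hL : ChainBlocks H z L)
    (hnd : (firstVertex z L :: restVertices z L).Nodup)
    (hlen : ((restVertices z L).length : ℝ) + 11 ≤ Fintype.card α / 2048) :
    ∃ B : Block α, ChainBlocks H z (B :: L) ∧
      (firstVertex z (B :: L) :: restVertices z (B :: L)).Nodup ∧
      (restVertices z (B :: L)).length = (restVertices z L).length + 10 ∧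
      ∑ p, (1 / 2 : ℝ) ^ freeHits H p (B :: L) ≤
        (1 - (1 / 2048) ^ 7 / 2) * ∑ p, (1 / 2 : ℝ) ^ freeHits H p L := by
  set W := (firstVertex z L :: restVertices z L).toFinset with hWdef
  have hW : (#W : ℝ) ≤ (restVertices z L).length + 1 := by
    exact_mod_cast List.toFinset_card_le (firstVertex z L :: restVertices z L)
  have : Nonempty α := ⟨z⟩
  obtain ⟨t, ht, hsum⟩ := exists_halving (univ.filter (Fits H W)) (Hits H)
    (fun p => (1 / 2 : ℝ) ^ freeHits H p L) (fun p => by positivity)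
    (β := (1 / 2048) ^ 7) (by positivity) fun p => by
      refine le_trans (le_of_eq ?_) (le_card_fits_hits H hH hn W (by linarith) p)
      simp only [Fintype.card_prod]
      push_cast
      ring
  rw [mem_filter] at ht
  obtain ⟨v₄, v₆, v₅, v₃, v₂, v₁, v₇⟩ := t
  obtain ⟨-, h1, h2, h3, h4, h5⟩ := ht
  have hW' : (#([v₁, v₂, v₃, v₄, v₅, v₆, v₇].toFinset ∪ W) : ℝ) ≤ 7 + #W := by
    exact_mod_cast (card_union_le _ _).trans
      (Nat.add_le_add_right (List.toFinset_card_le _) _)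
  obtain ⟨b, w, a, l1, l2, l3, l4⟩ := exists_link H hH hn
    ([v₁, v₂, v₃, v₄, v₅, v₆, v₇].toFinset ∪ W) (by linarith) v₇ (firstVertex z L)
  refine ⟨((v₄, v₆, v₅, v₃, v₂, v₁, v₇), (b, w, a), none), ?_, ?_, ?_, ?_⟩
  · simp only [ChainBlocks, firstVertex, restVertices, looseChain_cons_iff]
    exact ⟨h3, h4, h5, l3, l4, hL⟩
  · have key : ([v₁, v₂, v₃, v₄, v₅, v₆, v₇] ++ ([b, w, a] ++
        firstVertex z L :: restVertices z L)).Nodup := by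
      refine List.nodup_append'.2 ⟨h1, List.nodup_append'.2 ⟨l1, hnd, ?_⟩, ?_⟩
      · intro v hv hv'
        exact l2 v hv (mem_union_right _ (List.mem_toFinset.2 hv'))
      · intro v hv hv'
        rcases List.mem_append.1 hv' with h | h
        · exact l2 v h (mem_union_left _ (List.mem_toFinset.2 hv))
        · exact h2 v hv (List.mem_toFinset.2 h)
    exact key
  · simp [restVertices]
  · refine le_trans (le_of_eq (sum_congr rfl fun p _ => ?_)) hsum
    simp only [freeHits, List.countP_cons, true_and, decide_eq_true_eq, pow_add]
    split_ifs <;> simp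

lemma exists_blocks (H : Finset (Finset α)) (hH : Dense H) (hn : 1024 ≤ Fintype.card α)
    (z : α) (M : ℕ) (hM : (10 * M : ℝ) + 11 ≤ Fintype.card α / 2048) :
    ∃ L : List (Block α), ChainBlocks H z L ∧
      (firstVertex z L :: restVertices z L).Nodup ∧
      (restVertices z L).length = 10 * M ∧
      ∑ p, (1 / 2 : ℝ) ^ freeHits H p L ≤
        (1 - (1 / 2048) ^ 7 / 2) ^ M * (Fintype.card α : ℝ) ^ 2 := by
  induction M with
  | zero =>
    refine ⟨[], .nil, by simp [restVertices], by simp [restVertices], ?_⟩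
    simp [freeHits, Fintype.card_prod, sq]
  | succ M ih =>
    push_cast at hM
    obtain ⟨L, h1, h2, h3, h4⟩ := ih (by linarith)
    obtain ⟨B, b1, b2, b3, b4⟩ := exists_cons_block H hH hn z L h1 h2 (by
      rw [h3]; push_cast; linarith)
    refine ⟨B :: L, b1, b2, by omega, b4.trans ?_⟩
    rw [pow_succ' _ M, mul_assoc]
    exact mul_le_mul_of_nonneg_left h4 (by norm_num)

end Greedy

/-- The numerical bound behind the choice of the number of absorbers. -/
lemma pow_mul_sq_lt {γ n : ℝ} {M m : ℕ} (hγ : 0 < γ) (hn : 6 < γ ^ 9 * n)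
    (hM : 4 * 2048 ^ 7 * γ ^ 3 * n ≤ M) (hm : 2 * m ≤ γ ^ 3 * n) :
    (1 - (1 / 2048 : ℝ) ^ 7 / 2) ^ M * n ^ 2 < (1 / 2) ^ m := by
  have hn0 : 0 < n := by
    by_contra! h
    have := mul_nonpos_of_nonneg_of_nonpos (pow_pos hγ 9).le h
    linarith
  have h1 : (1 - (1 / 2048 : ℝ) ^ 7 / 2) ^ M ≤ Real.exp (-(2 * (γ ^ 3 * n))) := by
    calc (1 - (1 / 2048 : ℝ) ^ 7 / 2) ^ M
        ≤ Real.exp (-((1 / 2048 : ℝ) ^ 7 / 2)) ^ M :=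
          pow_le_pow_left₀ (by norm_num) (Real.one_sub_le_exp_neg _) _
      _ = Real.exp (M * -((1 / 2048 : ℝ) ^ 7 / 2)) := (Real.exp_nat_mul _ _).symm
      _ ≤ _ := Real.exp_le_exp.2 (by norm_num at hM ⊢; linarith)
  have h2 : Real.exp (-(γ ^ 3 * n)) ≤ (1 / 2 : ℝ) ^ m := by
    have h3 : Real.exp (-1) ≤ 1 / 2 := by
      have := Real.exp_one_gt_d9
      rw [Real.exp_neg, one_div]
      exact inv_anti₀ (by norm_num) (by linarith)
    calc Real.exp (-(γ ^ 3 * n)) ≤ Real.exp (m * (-1)) :=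
          Real.exp_le_exp.2 (by have : (0 : ℝ) ≤ m := Nat.cast_nonneg _; linarith)
      _ = Real.exp (-1) ^ m := Real.exp_nat_mul _ _
      _ ≤ _ := pow_le_pow_left₀ (Real.exp_pos _).le h3 _
  have h4 : n ^ 2 < Real.exp (γ ^ 3 * n) := by
    have := Real.pow_div_factorial_le_exp (γ ^ 3 * n) (by positivity) 3
    norm_num [Nat.factorial] at this
    nlinarith [mul_pos (sub_pos.2 hn) (pow_pos hn0 2)]
  calc (1 - (1 / 2048 : ℝ) ^ 7 / 2) ^ M * n ^ 2
      < Real.exp (-(2 * (γ ^ 3 * n))) * Real.exp (γ ^ 3 * n) :=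
        mul_lt_mul' h1 h4 (by positivity) (Real.exp_pos _)
    _ = Real.exp (-(γ ^ 3 * n)) := by rw [← Real.exp_add]; ring_nf
    _ ≤ _ := h2

end LooseAbsorb

/-- Absorbing Lemma: under minimum vertex degree `(13/32) C(n,2)` there is a short loose
path `P` that can absorb any small even set of vertices, keeping the same ends. -/
theorem stmt_6 (γ₁ : ℝ) (h₁ : 0 < γ₁) (h₂ : γ₁ ≤ 1 / 10 ^ 14) :
    ∃ n₀ : ℕ, ∀ n : ℕ, n > n₀ →
      ∀ H : Finset (Finset (Fin n)), (∀ e ∈ H, e.card = 3) →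
      (∀ x : Fin n, (13 / 32 : ℝ) * (n.choose 2 : ℝ) ≤ (hdeg H x : ℝ)) →
      ∃ (k : ℕ) (v : ℕ → Fin n), IsLoosePath H k v ∧
        ((2 * k + 1 : ℕ) : ℝ) ≤ γ₁ * n ∧
        ∀ U : Finset (Fin n), U ⊆ Finset.univ \ pathVerts k v →
          (U.card : ℝ) ≤ γ₁ ^ 3 * n → Even U.card →
          ∃ (k' : ℕ) (w : ℕ → Fin n), IsLoosePath H k' w ∧
            pathVerts k' w = pathVerts k v ∪ U ∧
            w 0 = v 0 ∧ w (2 * k') = v (2 * k) := by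
  refine ⟨⌈100 / γ₁ ^ 9⌉₊, fun n hn H h3 hd => ?_⟩
  have hγ1 : γ₁ ≤ 1 := h₂.trans (by norm_num)
  have hn1 : 100 < γ₁ ^ 9 * n := by
    have : 100 / γ₁ ^ 9 < n := (Nat.le_ceil _).trans_lt (by exact_mod_cast hn)
    rwa [div_lt_iff₀ (by positivity), mul_comm] at this
  have hn2 : 100 < γ₁ * n := hn1.trans_le <| mul_le_mul_of_nonneg_right
    (pow_le_of_le_one h₁.le hγ1 (by norm_num)) (Nat.cast_nonneg n)
  have hn0 : (0 : ℝ) ≤ n := Nat.cast_nonneg n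
  have hn3 : γ₁ * n ≤ n / 2048 := by nlinarith
  have hcard : 1024 ≤ Fintype.card (Fin n) := by
    rw [Fintype.card_fin]
    have : (1024 : ℝ) ≤ n := by linarith
    exact_mod_cast this
  have hH : LooseAbsorb.Dense H := LooseAbsorb.dense_of_hdeg H h3 (by simpa using hd)
  set M := ⌈4 * 2048 ^ 7 * γ₁ ^ 3 * n⌉₊
  have hM : 4 * 2048 ^ 7 * γ₁ ^ 3 * n ≤ M := Nat.le_ceil _
  have hM' : (10 * M : ℝ) + 11 ≤ γ₁ * n := by
    have h4 : (M : ℝ) < 4 * 2048 ^ 7 * γ₁ ^ 3 * n + 1 := Nat.ceil_lt_add_one (by positivity)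
    have h5 : γ₁ ^ 2 ≤ (1 / 10 ^ 14) ^ 2 := pow_le_pow_left₀ h₁.le h₂ 2
    have h6 : γ₁ ^ 2 * (γ₁ * n) ≤ (1 / 10 ^ 14) ^ 2 * (γ₁ * n) :=
      mul_le_mul_of_nonneg_right h5 (by positivity)
    have h7 : 4 * 2048 ^ 7 * γ₁ ^ 3 * n = 4 * 2048 ^ 7 * (γ₁ ^ 2 * (γ₁ * n)) := by ring
    rw [h7] at h4
    norm_num at h4 h6 ⊢
    linarith
  obtain ⟨z⟩ : Nonempty (Fin n) := Fintype.card_pos_iff.1 (by omega)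
  obtain ⟨L, l1, l2, l3, l4⟩ := LooseAbsorb.exists_blocks H hH hcard z M (by
    rw [Fintype.card_fin]; exact hM'.trans hn3)
  rw [Fintype.card_fin] at l4
  obtain ⟨k, v, p1, p2, p3, p4, p5⟩ := l1.isLoosePath l2
  refine ⟨k, v, p2, ?_, fun U hU hUc hUe => ?_⟩
  · rw [← p1, l3]
    push_cast
    linarith
  obtain ⟨m, hm⟩ := hUe
  have hfree : ∀ p, m ≤ LooseAbsorb.freeHits H p L := by
    intro p
    by_contra! hlt
    have h4 := LooseAbsorb.pow_mul_sq_lt h₁ (by linarith) hM (m := m) (by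
      rw [hm] at hUc; push_cast at hUc; linarith)
    have h5 : (1 / 2 : ℝ) ^ m ≤ (1 / 2) ^ LooseAbsorb.freeHits H p L :=
      pow_le_pow_of_le_one (by norm_num) (by norm_num) hlt.le
    have h6 := Finset.single_le_sum
      (f := fun p => (1 / 2 : ℝ) ^ LooseAbsorb.freeHits H p L)
      (fun p _ => by positivity) (Finset.mem_univ p)
    linarith
  obtain ⟨L', q1, q2, q3⟩ := LooseAbsorb.absorb_all m U L (by omega) l1 hfree
  have hperm := (q3.cons (LooseAbsorb.firstVertex z L)).trans List.perm_middle.symm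
  rw [← q2] at hperm
  have hdisj : ∀ x ∈ U, x ∉ pathVerts k v := fun x hx => (Finset.mem_sdiff.1 (hU hx)).2
  rw [p3] at hdisj
  have hnd := hperm.nodup_iff.2 (List.nodup_append'.2 ⟨U.nodup_toList, q2 ▸ l2,
    fun x hx hx' => hdisj x (Finset.mem_toList.1 hx) (List.mem_toFinset.2 (q2 ▸ hx'))⟩)
  obtain ⟨k', w, -, r2, r3, r4, r5⟩ := q1.isLoosePath hnd
  refine ⟨k', w, r2, ?_, r4.trans (q2.trans p4.symm), r5.trans p5.symm⟩
  rw [r3, List.toFinset_eq_of_perm _ _ hperm, List.toFinset_append, p3, q2, Finset.union_comm,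
    Finset.toList_toFinset]
end
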